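/- arXiv:1012.2181 — 3 statements merged into one kernel-verified Lean document; each statement's English description precedes it below -/
import Mathlib

section
/- With N = p1^m·p2 and D_0, ..., D_{p1p2−1} as in the context: for every nonzero x ∈ F_q, the number of triples (k, u, v) with 0 ≤ k ≤ p1·p2−1, u ∈ D_k, v ∈ D_k and u − v = x equals (q−1)/(p1·p2) − 1. (Equivalently, in the group ring Z[(F_q, +)] one has Σ_{k=0}^{p1p2−1} D_k² = (q−1)·0 + ((q−1)/(p1p2) − 1)·(F_q − 0), which shows the fusion scheme with classes D_k is pseudocyclic.) -/
open scoped Classical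

noncomputable section

/-- The unnormalised Fourier transform of `h` with respect to the additive character `ψ`. -/
def addFourier {F : Type*} [Field F] [Fintype F] (ψ : AddChar F ℂ) (h : F → ℂ) (y : F) : ℂ :=
  ∑ x, h x * ψ (x * y)

section Fourier

variable {F : Type*} [Field F] [Fintype F]

theorem addFourier_sum {ι : Type*} (ψ : AddChar F ℂ) (s : Finset ι) (h : ι → F → ℂ) (y : F) :
    addFourier ψ (fun x => ∑ i ∈ s, h i x) y = ∑ i ∈ s, addFourier ψ (h i) y := by
  simp only [addFourier, Finset.sum_mul]
  exact Finset.sum_comm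

theorem addFourier_dilate (ψ : AddChar F ℂ) (h : F → ℂ) {a : F} (ha : a ≠ 0) (y : F) :
    addFourier ψ (fun x => h (a⁻¹ * x)) y = addFourier ψ h (a * y) := by
  unfold addFourier
  rw [← Equiv.sum_comp (Equiv.mulLeft₀ a ha)]
  refine Finset.sum_congr rfl fun x _ => ?_
  simp [ha, mul_comm, mul_left_comm]

theorem addFourier_mul_of_homogeneous (ψ : AddChar F ℂ) {h : F → ℂ} {a : F} (ha : a ≠ 0) {w : ℂ}
    (hw : w ≠ 0) (hh : ∀ x, h (a * x) = w * h x) (y : F) :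
    addFourier ψ h (a * y) = w⁻¹ * addFourier ψ h y := by
  rw [← addFourier_dilate ψ h ha, addFourier, addFourier, Finset.mul_sum]
  refine Finset.sum_congr rfl fun x _ => ?_
  have := hh (a⁻¹ * x)
  rw [mul_inv_cancel_left₀ ha] at this
  rw [this]
  field_simp

theorem addFourier_pow_of_invariant {p : ℕ} [Fact p.Prime] [CharP F p] (ψ : AddChar F ℂ)
    (hψ : ∀ x, ψ (x ^ p) = ψ x) {h : F → ℂ} (e : ℕ) (hh : ∀ x, h (x ^ p ^ e) = h x) (y : F) :
    addFourier ψ h (y ^ p ^ e) = addFourier ψ h y := by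
  have hψe : ∀ e x, ψ (x ^ p ^ e) = ψ x := by
    intro e
    induction e with
    | zero => simp
    | succ e ih => intro x; rw [pow_succ, pow_mul, hψ, ih]
  unfold addFourier
  rw [← (bijective_iterateFrobenius F p e).sum_comp]
  refine Finset.sum_congr rfl fun x _ => ?_
  rw [iterateFrobenius_def, hh, ← mul_pow, hψe]

theorem exists_frobenius_invariant_addChar (p : ℕ) [Fact p.Prime] [CharP F p] :
    ∃ ψ : AddChar F ℂ, ψ.IsPrimitive ∧ ∀ x, ψ (x ^ p) = ψ x := by
  obtain rfl : p = ringChar F := ringChar.eq_iff.mpr inferInstance |>.symm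
  let : Algebra (ZMod (ringChar F)) F := ZMod.algebra _ _
  refine ⟨(ZMod.stdAddChar (N := ringChar F)).compAddMonoidHom
    (Algebra.trace (ZMod (ringChar F)) F).toAddMonoidHom, AddChar.IsPrimitive.of_ne_one ?_, ?_⟩
  · intro h
    obtain ⟨b, hb⟩ := FiniteField.trace_to_zmod_nondegenerate F (one_ne_zero (α := F))
    rw [one_mul] at hb
    apply hb
    have h1 := DFunLike.congr_fun h b
    simp only [AddChar.compAddMonoidHom_apply, LinearMap.toAddMonoidHom_coe,
      AddChar.one_apply] at h1
    rw [← AddChar.map_zero_eq_one (ZMod.stdAddChar (N := ringChar F))] at h1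
    exact ZMod.injective_stdAddChar h1
  · intro x
    simp only [AddChar.compAddMonoidHom_apply, LinearMap.toAddMonoidHom_coe]
    congr 1
    have := Algebra.trace_eq_of_algEquiv
      (FiniteField.frobeniusAlgEquiv (ZMod (ringChar F)) F (ringChar F)) x
    simpa [FiniteField.frobeniusAlgEquiv_apply, ZMod.card] using this

theorem sum_addFourier_mul_conj (ψ : AddChar F ℂ) (hψ : ψ.IsPrimitive) (h : F → ℂ) (x : F) :
    ∑ y, ψ (-(x * y)) * (addFourier ψ h y * starRingEnd ℂ (addFourier ψ h y)) =
      Fintype.card F * ∑ v, h (v + x) * starRingEnd ℂ (h v) := by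
  have key : ∀ y, ψ (-(x * y)) * (addFourier ψ h y * starRingEnd ℂ (addFourier ψ h y)) =
      ∑ v, ∑ u, h u * starRingEnd ℂ (h v) * ψ (y * (u - (v + x))) := by
    intro y
    unfold addFourier
    rw [map_sum, Finset.sum_mul_sum, Finset.sum_comm, Finset.mul_sum]
    refine Finset.sum_congr rfl fun v _ => ?_
    rw [Finset.mul_sum]
    refine Finset.sum_congr rfl fun u _ => ?_
    rw [map_mul (starRingEnd ℂ), ← AddChar.map_neg_eq_conj,
      show y * (u - (v + x)) = -(x * y) + u * y + -(v * y) by ring,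
      AddChar.map_add_eq_mul, AddChar.map_add_eq_mul]
    ring
  simp only [key]
  rw [Finset.sum_comm, Finset.mul_sum]
  refine Finset.sum_congr rfl fun v _ => ?_
  rw [Finset.sum_comm]
  simp only [← Finset.mul_sum, AddChar.sum_mulShift _ hψ, sub_eq_zero]
  rw [Finset.sum_eq_single (v + x)]
  · simp; ring
  · intro b _ hb; simp [hb]
  · simp

/-- A function of modulus one off the origin whose transform vanishes at the origin and has
constant modulus elsewhere has all its nontrivial autocorrelations equal to `-1`. -/
theorem autocorrelation_eq_neg_one (ψ : AddChar F ℂ) (hψ : ψ.IsPrimitive) (h : F → ℂ)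
    (h0 : h 0 = 0) (h1 : ∀ x, x ≠ 0 → ‖h x‖ = 1) (hsum : ∑ x, h x = 0)
    (hflat : ∀ y, y ≠ 0 → ‖addFourier ψ h y‖ = ‖addFourier ψ h 1‖) {x : F} (hx : x ≠ 0) :
    ∑ v, h (v + x) * starRingEnd ℂ (h v) = -1 := by
  set G : ℂ := (‖addFourier ψ h 1‖ : ℂ) ^ 2
  have hq : (Fintype.card F : ℂ) ≠ 0 := by simp
  have hq1 : (Fintype.card F : ℂ) - 1 ≠ 0 := by
    rw [sub_ne_zero]
    exact_mod_cast Fintype.one_lt_card.ne'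
  have hzero : addFourier ψ h 0 = 0 := by simp [addFourier, hsum]
  have eval : ∀ x, ∑ y, ψ (-(x * y)) * (addFourier ψ h y * starRingEnd ℂ (addFourier ψ h y)) =
      G * ((if x = 0 then (Fintype.card F : ℂ) else 0) - 1) := by
    intro x
    have e1 : ∀ y, ψ (-(x * y)) * (addFourier ψ h y * starRingEnd ℂ (addFourier ψ h y)) =
        G * (ψ (y * (-x)) - if y = 0 then 1 else 0) := by
      intro y
      rcases eq_or_ne y 0 with rfl | hy
      · simp [hzero]
      · rw [Complex.mul_conj', hflat y hy, if_neg hy, show y * (-x) = -(x * y) by ring]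
        ring
    simp only [e1]
    rw [← Finset.mul_sum, Finset.sum_sub_distrib, AddChar.sum_mulShift _ hψ]
    simp
  have e0 := (sum_addFourier_mul_conj ψ hψ h 0).symm.trans (eval 0)
  have ex := (sum_addFourier_mul_conj ψ hψ h x).symm.trans (eval x)
  have hnorm : ∑ v, h (v + 0) * starRingEnd ℂ (h v) = (Fintype.card F : ℂ) - 1 := by
    have : ∀ v, h (v + 0) * starRingEnd ℂ (h v) = 1 - if v = 0 then 1 else 0 := by
      intro v
      rcases eq_or_ne v 0 with rfl | hv
      · simp [h0]
      · rw [add_zero, Complex.mul_conj', h1 v hv]; simp [hv]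
    simp only [this, Finset.sum_sub_distrib]
    simp
  rw [hnorm, if_pos rfl] at e0
  have hG : G = Fintype.card F := (mul_right_cancel₀ hq1 e0).symm
  rw [if_neg hx, hG] at ex
  have := mul_left_cancel₀ hq ex
  simpa using this

end Fourier

/-- Every integer is `i * r + k * P` with `0 ≤ i < P`, for coprime `P` and `r`. -/
theorem exists_digit_repr {P r : ℕ} (hP : 0 < P) (hPr : P.Coprime r) (n : ℤ) :
    ∃ i < P, ∃ k : ℤ, n = (i * r : ℤ) + k * P := by
  obtain ⟨a, c, hac⟩ : IsCoprime (P : ℤ) r := Nat.isCoprime_iff_coprime.mpr hPr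
  have hP' : (0 : ℤ) < P := by exact_mod_cast hP
  have hnn := Int.emod_nonneg (n * c) hP'.ne'
  have := Int.emod_lt_of_pos (n * c) hP'
  refine ⟨((n * c) % P).toNat, by omega, n * a + (n * c) / P * r, ?_⟩
  rw [Int.toNat_of_nonneg hnn, Int.emod_def]
  linear_combination -n * hac

/-- Modulus of a sum of translates of a function `K` which is homogeneous under `g ^ P`. -/
theorem norm_sum_translates_const {F : Type*} [Field F] {g : F} (hg : g ≠ 0)
    (hgen : ∀ x : F, x ≠ 0 → ∃ n : ℤ, x = g ^ n) {P r : ℕ} (hP : 0 < P) (hPr : P.Coprime r)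
    {z : ℂ} (hz : ‖z‖ = 1) (K : F → ℂ) (hK : ∀ y, K (g ^ P * y) = z⁻¹ * K y)
    (hvan : ∀ n : ℤ, ¬ (P : ℤ) ∣ n → z ^ r = 1 ∨ K (g ^ n) = 0) {y : F} (hy : y ≠ 0) :
    ‖∑ i ∈ Finset.range P, K (g ^ (i * r) * y)‖ = ‖∑ i ∈ Finset.range P, K (g ^ (i * r) * 1)‖ := by
  set H : F → ℂ := fun y => ∑ i ∈ Finset.range P, K (g ^ (i * r) * y) with hH
  have hz0 : z ≠ 0 := by rintro rfl; simp at hz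
  have hKb : ∀ (b : ℕ) y, K (g ^ (P * b) * y) = z⁻¹ ^ b * K y := by
    intro b
    induction b with
    | zero => simp
    | succ b ih => intro y; rw [mul_add, mul_one, pow_add, mul_assoc, ih, hK]; ring
  have hHP : ∀ y, ‖H (g ^ P * y)‖ = ‖H y‖ := by
    intro y
    have : H (g ^ P * y) = z⁻¹ * H y := by
      simp only [hH, Finset.mul_sum]
      refine Finset.sum_congr rfl fun i _ => ?_
      rw [← hK]; congr 1; ring
    rw [this, norm_mul, norm_inv, hz]; simp
  have hHb : ∀ b : ℤ, ‖H (g ^ ((P : ℤ) * b))‖ = ‖H 1‖ := by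
    intro b
    induction b with
    | zero => simp
    | succ b ih =>
      rw [← ih, ← hHP (g ^ ((P : ℤ) * b)), mul_add, mul_one, zpow_add₀ hg, mul_comm (g ^ P), zpow_natCast]
    | pred b ih =>
      rw [← ih, ← hHP (g ^ ((P : ℤ) * (-b - 1))), ← zpow_natCast, ← zpow_add₀ hg]; congr 3; ring
  have hstep : ∀ n : ℤ, ¬ (P : ℤ) ∣ n → H (g ^ r * g ^ n) = H (g ^ n) := by
    intro n hn
    rw [← sub_eq_zero]
    have h1 : H (g ^ r * g ^ n) - H (g ^ n) = K (g ^ (P * r) * g ^ n) - K (g ^ n) := by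
      have := Finset.sum_range_sub (fun i : ℕ => K (g ^ (i * r) * g ^ n)) P
      simp only [zero_mul, pow_zero, one_mul] at this
      rw [← this, Finset.sum_sub_distrib]
      congr 1
      refine Finset.sum_congr rfl fun i _ => ?_
      congr 1; ring
    rw [h1, hKb]
    rcases hvan n hn with h | h
    · rw [inv_pow, h]; simp
    · rw [h]; simp
  have hind : ∀ (b : ℤ) (i : ℕ), i < P → ‖H (g ^ ((P : ℤ) * b - i * r))‖ = ‖H 1‖ := by
    intro b i
    induction i with
    | zero => intro _; simpa using hHb b
    | succ i ih =>
      intro hi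
      rw [← ih (by omega), ← hstep, ← zpow_natCast g r, ← zpow_add₀ hg]
      · congr 3; push_cast; ring
      · intro hd
        have h2 : (P : ℤ) ∣ ((i + 1 : ℕ) : ℤ) * r := by
          have := (dvd_sub_right (Dvd.intro b rfl)).mp hd
          simpa using this
        have h3 : P ∣ (i + 1) * r := by exact_mod_cast h2
        have := Nat.le_of_dvd (by omega) (hPr.dvd_of_dvd_mul_right h3)
        omega
  obtain ⟨n, rfl⟩ := hgen y hy
  obtain ⟨i, hi, b, hb⟩ := exists_digit_repr hP hPr (-n)
  rw [show n = (P : ℤ) * (-b) - i * r by linear_combination -hb]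
  exact hind _ i hi

theorem exists_pow_modEq_sq {p N : ℕ} [NeZero N] (hcop : p.Coprime N)
    (hord : 2 * orderOf (p : ZMod N) = N.totient) {c : ℕ} (hc : c.Coprime N) :
    ∃ e : ℕ, (N : ℤ) ∣ (p : ℤ) ^ e - (c : ℤ) ^ 2 := by
  set u := ZMod.unitOfCoprime p hcop
  have hu : orderOf u = orderOf (p : ZMod N) := by
    rw [← orderOf_units, ZMod.coe_unitOfCoprime]
  have hindex : (Subgroup.zpowers u).index = 2 := by
    have h1 := (Subgroup.zpowers u).card_mul_index
    rw [Nat.card_zpowers, hu, Nat.card_eq_fintype_card, ZMod.card_units_eq_totient, ← hord,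
      mul_comm 2] at h1
    refine Nat.eq_of_mul_eq_mul_left ?_ h1
    rw [← hu]
    exact orderOf_pos u
  have hmem := Subgroup.sq_mem_of_index_two hindex (ZMod.unitOfCoprime c hc)
  obtain ⟨e, he⟩ := mem_powers_iff_mem_zpowers.mpr hmem
  refine ⟨e, ?_⟩
  rw [← ZMod.intCast_zmod_eq_zero_iff_dvd]
  have := congrArg Units.val he
  simp only [Units.val_pow_eq_pow_val, u, ZMod.coe_unitOfCoprime] at this
  push_cast
  rw [this, sub_self]

/-- When `p` generates an index-two subgroup modulo `p1 ^ m * p2`, a power of `p` congruent to `1`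
modulo `p1 * p2` moves any `n` not divisible by `p1 ^ (m - 1)` by an exact multiple of that power. -/
theorem exists_pow_mul_eq_add {p p1 p2 m : ℕ} (hp1 : p1.Prime) (hp2 : p2.Prime) (hodd : p1 ≠ 2)
    (hm : 1 ≤ m) (hcop : p.Coprime (p1 ^ m * p2))
    (hord : 2 * orderOf (p : ZMod (p1 ^ m * p2)) = (p1 ^ m * p2).totient) {n : ℤ}
    (hn : ¬ ((p1 ^ (m - 1) : ℕ) : ℤ) ∣ n) :
    ∃ (e : ℕ) (B : ℤ), n * (p : ℤ) ^ e = n + ((p1 ^ (m - 1) : ℕ) : ℤ) * (p2 * B) ∧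
      ¬ (p1 : ℤ) ∣ B ∧ ((p1 * p2 : ℕ) : ℤ) ∣ (p : ℤ) ^ e - 1 := by
  have hp1' : Prime (p1 : ℤ) := Nat.prime_iff_prime_int.mp hp1
  have hn0 : n ≠ 0 := by rintro rfl; simp at hn
  have hfin : FiniteMultiplicity (p1 : ℤ) n :=
    Int.finiteMultiplicity_iff.mpr ⟨by simpa using hp1.ne_one, hn0⟩
  obtain ⟨n', hn', hn'd⟩ := hfin.exists_eq_pow_mul_and_not_dvd
  set v := multiplicity (p1 : ℤ) n
  have hv : v < m - 1 := by
    by_contra hcon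
    apply hn
    rw [hn']
    push_cast
    exact (pow_dvd_pow _ (by omega)).mul_right _
  obtain ⟨r, hr⟩ : ∃ r, m = v + r + 2 := ⟨m - v - 2, by omega⟩
  have : NeZero (p1 ^ m * p2) := ⟨mul_ne_zero (pow_ne_zero _ hp1.ne_zero) hp2.ne_zero⟩
  have hc : (1 + p1 ^ (r + 1) * p2).Coprime (p1 ^ m * p2) := by
    apply Nat.Coprime.mul_right
    · apply Nat.Coprime.pow_right
      rw [pow_succ', mul_assoc]
      simp
    · simp
  obtain ⟨e, t, ht⟩ := exists_pow_modEq_sq hcop hord hc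
  have hm1 : m - 1 = v + r + 1 := by omega
  refine ⟨e, n' * (2 + p1 ^ (r + 1) * p2 + p1 ^ (v + 1) * t), ?_, ?_, ?_⟩
  · rw [hm1]
    rw [sub_eq_iff_eq_add] at ht
    rw [ht, hr, hn']
    push_cast
    ring
  · intro hd
    rcases hp1'.dvd_or_dvd hd with h | h
    · exact hn'd h
    · have h2 : (p1 : ℤ) ∣ 2 := by
        have e1 : (2 : ℤ) + p1 ^ (r + 1) * p2 + p1 ^ (v + 1) * t =
          2 + p1 * (p1 ^ r * p2 + p1 ^ v * t) := by ring
        rw [e1] at h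
        exact (dvd_add_left (Dvd.intro _ rfl)).mp h
      have h3 : p1 ∣ 2 := by exact_mod_cast h2
      exact hodd ((Nat.prime_dvd_prime_iff_eq hp1 Nat.prime_two).mp h3)
  · rw [sub_eq_iff_eq_add] at ht
    rw [ht, hr]
    refine ⟨p1 ^ r * (2 + p1 ^ (r + 1) * p2) + p1 ^ (v + r + 1) * t, ?_⟩
    push_cast
    ring

/-- The function on a cyclic group generated by `g` equal to the character `g ^ P ↦ z` on the
subgroup generated by `g ^ P`, extended by zero. -/
theorem exists_extension_by_zero {F : Type*} [Field F] {g : F} (hg : g ≠ 0) {P M : ℕ} (hP : 0 < P)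
    (hper : ∀ n : ℤ, g ^ n = 1 → ((P * M : ℕ) : ℤ) ∣ n) {z : ℂ} (hzM : z ^ M = 1) (hz0 : z ≠ 0) :
    ∃ h : F → ℂ, h 0 = 0 ∧ (∀ n : ℤ, h (g ^ ((P : ℤ) * n)) = z ^ n) ∧
      ∀ n : ℤ, ¬ (P : ℤ) ∣ n → h (g ^ n) = 0 := by
  have hP' : (P : ℤ) ≠ 0 := by exact_mod_cast hP.ne'
  refine ⟨fun x => if hx : ∃ n : ℤ, x = g ^ ((P : ℤ) * n) then z ^ hx.choose else 0, ?_, ?_, ?_⟩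
  · refine dif_neg ?_
    rintro ⟨n, hn⟩
    exact zpow_ne_zero _ hg hn.symm
  · intro n
    have hx : ∃ k : ℤ, g ^ ((P : ℤ) * n) = g ^ ((P : ℤ) * k) := ⟨n, rfl⟩
    refine (dif_pos hx).trans ?_
    have h1 := hx.choose_spec
    set k := hx.choose
    have h2 : g ^ ((P : ℤ) * k - P * n) = 1 := by
      rw [zpow_sub₀ hg, ← h1, div_self (zpow_ne_zero _ hg)]
    obtain ⟨t, ht⟩ := hper _ h2
    have h3 : k = n + M * t := by
      apply mul_left_cancel₀ hP'
      push_cast at ht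
      linear_combination ht
    rw [h3, zpow_add₀ hz0, zpow_mul, zpow_natCast, hzM, one_zpow, mul_one]
  · intro n hn
    refine dif_neg ?_
    rintro ⟨k, hk⟩
    have h2 : g ^ (n - P * k) = 1 := by
      rw [zpow_sub₀ hg, hk, div_self (zpow_ne_zero _ hg)]
    obtain ⟨t, ht⟩ := hper _ h2
    refine hn ⟨k + M * t, ?_⟩
    push_cast at ht
    linear_combination ht

/-- Autocorrelation of the function which is a nontrivial character of `⟨g ^ P⟩`, where
`P = p1 ^ (m - 1)`, repeated on the cosets of `g ^ (i * p2)`, `i < P`. -/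
theorem exists_class_function {F : Type*} [Field F] [Fintype F] {p p1 p2 m : ℕ} [Fact p.Prime]
    [CharP F p] (hp1 : p1.Prime) (hp2 : p2.Prime) (hodd : p1 ≠ 2) (hne : p1 ≠ p2) (hm : 1 ≤ m)
    (hcop : p.Coprime (p1 ^ m * p2))
    (hord : 2 * orderOf (p : ZMod (p1 ^ m * p2)) = (p1 ^ m * p2).totient)
    {g : F} (hg : g ≠ 0) (hgen : ∀ x : F, x ≠ 0 → ∃ n : ℤ, x = g ^ n)
    (hper : ∀ n : ℤ, g ^ n = 1 → ((p1 ^ m * p2 : ℕ) : ℤ) ∣ n)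
    {z : ℂ} (hzM : z ^ (p1 * p2) = 1) (hz1 : z ≠ 1) :
    ∃ h : F → ℂ, h 0 = 0 ∧
      (∀ i < p1 ^ (m - 1), ∀ k : ℤ, h (g ^ ((i * p2 : ℤ) + k * (p1 ^ (m - 1) : ℕ))) = z ^ k) ∧
      ∀ x, x ≠ 0 → ∑ v, h (v + x) * starRingEnd ℂ (h v) = -1 := by
  set P := p1 ^ (m - 1) with hPdef
  have hPpos : 0 < P := pow_pos hp1.pos _
  have hPr : P.Coprime p2 := ((Nat.coprime_primes hp1 hp2).mpr hne).pow_left _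
  have hznorm : ‖z‖ = 1 := Complex.norm_eq_one_of_pow_eq_one hzM
    (mul_ne_zero hp1.ne_zero hp2.ne_zero)
  have hz0 : z ≠ 0 := by rintro rfl; simp at hznorm
  have hNP : p1 ^ m * p2 = P * (p1 * p2) := by
    rw [← mul_assoc, hPdef, ← pow_succ, Nat.sub_add_cancel hm]
  obtain ⟨k₀, hk00, hk0P, hk0n⟩ := exists_extension_by_zero hg hPpos
    (fun n hn => hNP ▸ hper n hn) hzM hz0
  obtain ⟨ψ, hψ, hψp⟩ := exists_frobenius_invariant_addChar (F := F) p
  have hk0z : ∀ (b : ℤ) x, k₀ (g ^ ((P : ℤ) * b) * x) = z ^ b * k₀ x := by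
    intro b x
    rcases eq_or_ne x 0 with rfl | hx
    · simp [hk00]
    obtain ⟨n, rfl⟩ := hgen x hx
    rw [← zpow_add₀ hg]
    by_cases hd : (P : ℤ) ∣ n
    · obtain ⟨a, rfl⟩ := hd
      rw [← mul_add, hk0P, hk0P, zpow_add₀ hz0]
    · rw [hk0n _ hd, hk0n, mul_zero]
      rwa [dvd_add_right (Dvd.intro _ rfl)]
  have hk0mul : ∀ x, k₀ (g ^ P * x) = z * k₀ x := by
    intro x
    simpa using hk0z 1 x
  have hKz : ∀ (b : ℤ) y, addFourier ψ k₀ (g ^ ((P : ℤ) * b) * y) =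
      (z ^ b)⁻¹ * addFourier ψ k₀ y := fun b =>
    addFourier_mul_of_homogeneous ψ (zpow_ne_zero _ hg) (zpow_ne_zero _ hz0) (hk0z b)
  have hKmul : ∀ y, addFourier ψ k₀ (g ^ P * y) = z⁻¹ * addFourier ψ k₀ y := by
    intro y
    simpa using hKz 1 y
  have hvan : ∀ n : ℤ, ¬ (P : ℤ) ∣ n → z ^ p2 = 1 ∨ addFourier ψ k₀ (g ^ n) = 0 := by
    intro n hn
    obtain ⟨e, B, hB, hBd, hM⟩ := exists_pow_mul_eq_add hp1 hp2 hodd hm hcop hord hn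
    have hco : IsCoprime (P : ℤ) ((p : ℤ) ^ e) := by
      have h1 : p.Coprime P := Nat.Coprime.coprime_mul_right_right (hNP ▸ hcop)
      exact_mod_cast Nat.isCoprime_iff_coprime.mpr (h1.symm.pow_right e)
    have hinv : ∀ x, k₀ (x ^ p ^ e) = k₀ x := by
      intro x
      rcases eq_or_ne x 0 with rfl | hx
      · rw [zero_pow (pow_ne_zero _ (Fact.out : p.Prime).ne_zero)]
      obtain ⟨n, rfl⟩ := hgen x hx
      rw [← zpow_natCast, ← zpow_mul]
      push_cast
      by_cases hd : (P : ℤ) ∣ n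
      · obtain ⟨b, rfl⟩ := hd
        obtain ⟨t, ht⟩ := hM
        rw [mul_assoc, hk0P, hk0P, sub_eq_iff_eq_add.mp ht,
          show b * (((p1 * p2 : ℕ) : ℤ) * t + 1) = b + ((p1 * p2 : ℕ) : ℤ) * (t * b) by ring,
          zpow_add₀ hz0, zpow_mul _ _ (t * b), zpow_natCast, hzM, one_zpow, mul_one]
      · rw [hk0n _ hd, hk0n]
        exact fun h => hd (hco.dvd_of_dvd_mul_right h)
    have hfrob := addFourier_pow_of_invariant ψ hψp e hinv (g ^ n)
    rw [← zpow_natCast, ← zpow_mul] at hfrob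
    push_cast at hfrob
    rw [hB, add_comm n, zpow_add₀ hg, hKz] at hfrob
    by_contra! hcon
    obtain ⟨hw, hK0⟩ := hcon
    apply hw
    have hwB : (z ^ p2) ^ B = 1 := by
      rw [← zpow_natCast z p2, ← zpow_mul]
      exact inv_eq_one.mp (mul_right_cancel₀ hK0 (hfrob.trans (one_mul _).symm))
    have hwp : (z ^ p2) ^ p1 = 1 := by rw [← pow_mul, mul_comm, hzM]
    obtain ⟨a, b, hab⟩ := ((Nat.prime_iff_prime_int.mp hp1).coprime_iff_not_dvd.mpr hBd)
    have hw0 : z ^ p2 ≠ 0 := pow_ne_zero _ hz0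
    rw [← zpow_one (z ^ p2), ← hab, zpow_add₀ hw0, mul_comm a, mul_comm b, zpow_mul, zpow_mul, hwB,
      zpow_natCast, hwp, one_zpow, one_zpow, one_mul]
  set h : F → ℂ := fun x => ∑ i ∈ Finset.range P, k₀ ((g ^ (i * p2))⁻¹ * x) with hh
  have hFh : ∀ y, addFourier ψ h y =
      ∑ i ∈ Finset.range P, addFourier ψ k₀ (g ^ (i * p2) * y) := by
    intro y
    rw [hh, addFourier_sum]
    exact Finset.sum_congr rfl fun i _ => addFourier_dilate ψ k₀ (pow_ne_zero _ hg) y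
  have hval : ∀ i < P, ∀ k : ℤ, h (g ^ ((i * p2 : ℤ) + k * (P : ℕ))) = z ^ k := by
    intro i hi k
    have harg : ∀ j : ℕ, (g ^ (j * p2))⁻¹ * g ^ ((i * p2 : ℤ) + k * (P : ℕ)) =
        g ^ (((i : ℤ) - j) * p2 + P * k) := by
      intro j
      rw [← zpow_natCast, ← zpow_neg, ← zpow_add₀ hg]
      congr 1; push_cast; ring
    simp only [hh, harg]
    rw [Finset.sum_eq_single i]
    · rw [sub_self, zero_mul, zero_add, hk0P]
    · intro j hj hji
      apply hk0n
      intro hd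
      rw [dvd_add_left (Dvd.intro _ rfl)] at hd
      have h1 : (P : ℤ) ∣ (i : ℤ) - j :=
        (Nat.isCoprime_iff_coprime.mpr hPr).dvd_of_dvd_mul_right hd
      have h2 := Finset.mem_range.mp hj
      have h3 := Int.eq_zero_of_abs_lt_dvd h1 (by rw [abs_lt]; omega)
      omega
    · intro hi'; exact absurd (Finset.mem_range.mpr hi) hi'
  have hrep : ∀ x : F, x ≠ 0 → ∃ i < P, ∃ k : ℤ, x = g ^ ((i * p2 : ℤ) + k * (P : ℕ)) := by
    intro x hx
    obtain ⟨n, rfl⟩ := hgen x hx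
    obtain ⟨i, hi, k, hk⟩ := exists_digit_repr hPpos hPr n
    exact ⟨i, hi, k, by rw [hk]⟩
  have hnorm : ∀ x, x ≠ 0 → ‖h x‖ = 1 := by
    intro x hx
    obtain ⟨i, hi, k, rfl⟩ := hrep x hx
    rw [hval i hi, norm_zpow, hznorm, one_zpow]
  have hhmul : ∀ x, h (g ^ P * x) = z * h x := by
    intro x
    simp only [hh, Finset.mul_sum]
    refine Finset.sum_congr rfl fun i _ => ?_
    rw [← hk0mul]; congr 1; ring
  have hsum : ∑ x, h x = 0 := by
    have h1 : ∑ x, h x = z * ∑ x, h x := by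
      conv_lhs => rw [← Equiv.sum_comp (Equiv.mulLeft₀ (g ^ P) (pow_ne_zero P hg))]
      rw [Finset.mul_sum]
      exact Finset.sum_congr rfl fun x _ => hhmul x
    have h2 : (1 - z) * ∑ x, h x = 0 := by linear_combination h1
    exact (mul_eq_zero.mp h2).resolve_left (sub_ne_zero.mpr hz1.symm)
  have hh0 : h 0 = 0 := by simp [hh, hk00]
  refine ⟨h, hh0, hval, fun x hx => autocorrelation_eq_neg_one ψ hψ h hh0 hnorm hsum ?_ hx⟩
  intro y hy
  rw [hFh, hFh]
  exact norm_sum_translates_const hg hgen hPpos hPr hznorm _ hKmul hvan hy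

theorem sum_pow_mul_conj_pow {M : ℕ} {ζ : ℂ} (hζ : IsPrimitiveRoot ζ M) {k l : ℕ} (hk : k < M)
    (hl : l < M) :
    ∑ j ∈ Finset.range M, (ζ ^ j) ^ k * starRingEnd ℂ ((ζ ^ j) ^ l) = if k = l then (M : ℂ) else 0 := by
  have hnorm : ‖ζ‖ = 1 := Complex.norm_eq_one_of_pow_eq_one hζ.pow_eq_one (by omega)
  have hζ0 : ζ ≠ 0 := hζ.ne_zero (by omega)
  have hconj : starRingEnd ℂ ζ = ζ⁻¹ := (Complex.inv_eq_conj hnorm).symm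
  set w := ζ ^ k * (ζ ^ l)⁻¹ with hw
  have hterm : ∀ j ∈ Finset.range M, (ζ ^ j) ^ k * starRingEnd ℂ ((ζ ^ j) ^ l) = w ^ j := by
    intro j _
    rw [map_pow, map_pow, hconj, hw, mul_pow, inv_pow, inv_pow, inv_pow, ← pow_mul, ← pow_mul,
      ← pow_mul, ← pow_mul, mul_comm j, mul_comm j]
  rw [Finset.sum_congr rfl hterm]
  split_ifs with hkl
  · have : w = 1 := by rw [hw, hkl, mul_inv_cancel₀ (pow_ne_zero _ hζ0)]
    simp [this]
  · have hw1 : w ≠ 1 := by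
      intro h
      exact hkl (hζ.pow_inj hk hl (by rwa [hw, mul_inv_eq_one₀ (pow_ne_zero _ hζ0)] at h))
    have hwM : w ^ M = 1 := by
      rw [hw, mul_pow, inv_pow, ← pow_mul, ← pow_mul, mul_comm k, mul_comm l, pow_mul, pow_mul,
        hζ.pow_eq_one]
      simp
    have := geom_sum_mul w M
    rw [hwM, sub_self] at this
    exact (mul_eq_zero.mp this).resolve_right (sub_ne_zero.mpr hw1)

/-- Counting differences inside the classes `D k`, `k < M`, of a partition of the nonzero elements,
given class functions `H j` with values `ζ ^ (j * k)` on `D k` and known autocorrelations. -/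
theorem card_differences {F : Type*} [Field F] [Fintype F] {M : ℕ} {ζ : ℂ}
    (hζ : IsPrimitiveRoot ζ M) (hM : 1 < M) (D : ℕ → Set F)
    (hD0 : ∀ k < M, (0 : F) ∉ D k) (hcover : ∀ x : F, x ≠ 0 → ∃ k < M, x ∈ D k)
    (H : ℕ → F → ℂ) (hH0 : ∀ j < M, H j 0 = 0)
    (hHval : ∀ j < M, ∀ k < M, ∀ x ∈ D k, H j x = (ζ ^ j) ^ k) {x : F}
    (hcorr : ∀ j < M, j ≠ 0 → ∑ v, H j (v + x) * starRingEnd ℂ (H j v) = -1) (hx : x ≠ 0) :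
    M * (Nat.card {w : ℕ × F × F //
        w.1 < M ∧ w.2.1 ∈ D w.1 ∧ w.2.2 ∈ D w.1 ∧ w.2.1 - w.2.2 = x} + 1) = Fintype.card F - 1 := by
  have huniq : ∀ k < M, ∀ l < M, ∀ x, x ∈ D k → x ∈ D l → k = l := by
    intro k hk l hl x hxk hxl
    refine hζ.pow_inj hk hl ?_
    have := (hHval 1 hM k hk x hxk).symm.trans (hHval 1 hM l hl x hxl)
    simpa using this
  have hcard : Nat.card {w : ℕ × F × F //
      w.1 < M ∧ w.2.1 ∈ D w.1 ∧ w.2.2 ∈ D w.1 ∧ w.2.1 - w.2.2 = x} =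
      Nat.card {v : F // ∃ k < M, v + x ∈ D k ∧ v ∈ D k} := by
    refine Nat.card_congr (Equiv.ofBijective (fun w => ⟨w.1.2.2, w.1.1, w.2.1, ?_, w.2.2.2.1⟩) ⟨?_, ?_⟩)
    · exact sub_eq_iff_eq_add'.mp w.2.2.2.2 ▸ w.2.2.1
    · rintro ⟨⟨k, u, v⟩, hk, hu, hv, huv⟩ ⟨⟨k', u', v'⟩, hk', hu', hv', huv'⟩ h
      simp only [Subtype.mk.injEq] at h hk hu hv huv hk' hu' hv' huv' ⊢
      subst h
      rw [huniq k hk k' hk' v hv hv', sub_eq_iff_eq_add.mp huv, sub_eq_iff_eq_add.mp huv']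
    · rintro ⟨v, k, hk, hu, hv⟩
      exact ⟨⟨⟨k, v + x, v⟩, hk, hu, hv, by simp⟩, rfl⟩
  have hsum : ∀ v, ∑ j ∈ Finset.range M, H j (v + x) * starRingEnd ℂ (H j v) =
      M * if ∃ k < M, v + x ∈ D k ∧ v ∈ D k then (1 : ℂ) else 0 := by
    intro v
    by_cases hv : v = 0 ∨ v + x = 0
    · rw [if_neg, mul_zero]
      · refine Finset.sum_eq_zero fun j hj => ?_
        have hj := Finset.mem_range.mp hj
        rcases hv with hv | hv
        · rw [hv, hH0 j hj, map_zero, mul_zero]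
        · rw [hv, hH0 j hj, zero_mul]
      · rintro ⟨k, hk, h1, h2⟩
        rcases hv with hv | hv
        · exact hD0 k hk (hv ▸ h2)
        · exact hD0 k hk (hv ▸ h1)
    · push Not at hv
      obtain ⟨k, hk, hvk⟩ := hcover v hv.1
      obtain ⟨l, hl, hvl⟩ := hcover _ hv.2
      have hterm : ∀ j ∈ Finset.range M, H j (v + x) * starRingEnd ℂ (H j v) =
          (ζ ^ j) ^ l * starRingEnd ℂ ((ζ ^ j) ^ k) := by
        intro j hj
        have hj := Finset.mem_range.mp hj
        rw [hHval j hj k hk v hvk, hHval j hj l hl _ hvl]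
      have hiff : (∃ k < M, v + x ∈ D k ∧ v ∈ D k) ↔ l = k := by
        constructor
        · rintro ⟨i, hi, h1, h2⟩
          rw [huniq l hl i hi _ hvl h1, huniq k hk i hi _ hvk h2]
        · rintro rfl
          exact ⟨l, hl, hvl, hvk⟩
      rw [Finset.sum_congr rfl hterm, sum_pow_mul_conj_pow hζ hl hk]
      simp [hiff]
  have hone : ∀ v, H 0 v = if v = 0 then 0 else 1 := by
    intro v
    split_ifs with hv
    · rw [hv, hH0 0 (by omega)]
    · obtain ⟨k, hk, hvk⟩ := hcover v hv
      simp [hHval 0 (by omega) k hk v hvk]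
  have hzero : ∑ v, H 0 (v + x) * starRingEnd ℂ (H 0 v) = (Fintype.card F : ℂ) - 2 := by
    have hterm : ∀ v, H 0 (v + x) * starRingEnd ℂ (H 0 v) =
        1 - (if v = 0 then 1 else 0) - if v = -x then 1 else 0 := by
      intro v
      rw [hone, hone]
      by_cases h1 : v = 0
      · simp [h1, hx]
      · by_cases h2 : v = -x
        · simp [h2, hx]
        · have h3 : v + x ≠ 0 := fun h => h2 (eq_neg_of_add_eq_zero_left h)
          simp [h1, h2, h3]
    simp only [hterm, Finset.sum_sub_distrib]
    simp
    ring
  have htotal : (M : ℂ) * Nat.card {v : F // ∃ k < M, v + x ∈ D k ∧ v ∈ D k} =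
      (Fintype.card F : ℂ) - 2 - (M - 1) := by
    rw [Nat.card_eq_fintype_card, Fintype.card_subtype, Finset.natCast_card_filter, Finset.mul_sum,
      ← Finset.sum_congr rfl fun v _ => hsum v, Finset.sum_comm,
      ← Finset.sum_erase_add _ _ (Finset.mem_range.mpr (by omega : 0 < M)), hzero,
      Finset.sum_congr rfl (g := fun _ => (-1 : ℂ))]
    · rw [Finset.sum_const, Finset.card_erase_of_mem (Finset.mem_range.mpr (by omega)),
        Finset.card_range, nsmul_eq_mul, Nat.cast_sub hM.le]
      push_cast
      ring
    · intro j hj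
      rw [Finset.mem_erase, Finset.mem_range] at hj
      exact hcorr j hj.2 hj.1
  rw [hcard]
  have hF := Fintype.card_pos (α := F)
  apply Nat.cast_injective (R := ℂ)
  push_cast [Nat.cast_sub hF]
  linear_combination htotal

/-- For `N = p1^m * p2`: for every nonzero `x ∈ F_q`, the number of triples `(k, u, v)`
with `0 ≤ k ≤ p1*p2 - 1`, `u, v ∈ D_k` and `u - v = x` equals `(q-1)/(p1*p2) - 1`;
this is the pseudocyclicity of the fusion scheme. -/
theorem pseudocyclic_two_primes
    (p1 p2 m N p f q : ℕ)
    (hp1 : p1.Prime) (hp2 : p2.Prime)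
    (hmod : (p1 % 4 = 1 ∧ p2 % 4 = 3) ∨ (p1 % 4 = 3 ∧ p2 % 4 = 1))
    (hm : 1 ≤ m) (hN : N = p1 ^ m * p2)
    (hp : p.Prime) (hcop : Nat.Coprime p N)
    (hord1 : orderOf (p : ZMod (p1 ^ m)) = Nat.totient (p1 ^ m))
    (hord2 : orderOf (p : ZMod p2) = Nat.totient p2)
    (hf : f = orderOf (p : ZMod N)) (hf2 : 2 * f = N.totient)
    (hq : q = p ^ f)
    (F : Type) [Field F] [Fintype F]
    (hF : Fintype.card F = q)
    (γ : Fˣ) (hγ : orderOf γ = q - 1)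
    (D : ℕ → Set F)
    (hD : ∀ k, D k = {x : F | ∃ i < p1 ^ (m - 1), ∃ t : ℕ,
        x = ((γ : F)) ^ (i * p2 + k * p1 ^ (m - 1) + N * t)}) :
    ∀ x : F, x ≠ 0 →
      Nat.card {w : ℕ × F × F //
          w.1 < p1 * p2 ∧ w.2.1 ∈ D w.1 ∧ w.2.2 ∈ D w.1 ∧ w.2.1 - w.2.2 = x} =
        (q - 1) / (p1 * p2) - 1 := by
  intro x hx
  have hodd : p1 ≠ 2 := by rintro rfl; omega
  have hne : p1 ≠ p2 := by rintro rfl; omega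
  subst hN hf
  have : Fact p.Prime := ⟨hp⟩
  have : CharP F p := charP_of_card_eq_prime_pow (hF.trans hq)
  set P := p1 ^ (m - 1) with hP
  have hPpos : 0 < P := pow_pos hp1.pos _
  have hPr : P.Coprime p2 := ((Nat.coprime_primes hp1 hp2).mpr hne).pow_left _
  have hNP : p1 ^ m * p2 = P * (p1 * p2) := by
    rw [← mul_assoc, hP, ← pow_succ, Nat.sub_add_cancel hm]
  have hNdvd : p1 ^ m * p2 ∣ q - 1 := by
    have hqpos : 1 ≤ q := hq ▸ Nat.pow_pos hp.pos
    rw [← ZMod.natCast_eq_zero_iff, Nat.cast_sub hqpos, hq, Nat.cast_pow, pow_orderOf_eq_one]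
    simp
  set g : F := (γ : F) with hgdef
  have hg : g ≠ 0 := γ.ne_zero
  have hgen : ∀ y : F, y ≠ 0 → ∃ n : ℤ, y = g ^ n := by
    intro y hy
    have htop : Subgroup.zpowers γ = ⊤ := by
      refine Subgroup.eq_top_of_card_eq _ ?_
      rw [Nat.card_zpowers, hγ, Nat.card_units, Nat.card_eq_fintype_card, hF]
    obtain ⟨n, hn⟩ := Subgroup.mem_zpowers_iff.mp
      (htop ▸ Subgroup.mem_top (Units.mk0 y hy) : Units.mk0 y hy ∈ Subgroup.zpowers γ)
    exact ⟨n, by rw [hgdef, ← Units.val_zpow_eq_zpow_val, hn, Units.val_mk0]⟩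
  have hper' : ∀ n : ℤ, g ^ n = 1 → ((q - 1 : ℕ) : ℤ) ∣ n := by
    intro n hn
    rw [← hγ, orderOf_dvd_iff_zpow_eq_one, ← Units.val_inj, Units.val_zpow_eq_zpow_val]
    exact hn
  have hper : ∀ n : ℤ, g ^ n = 1 → ((p1 ^ m * p2 : ℕ) : ℤ) ∣ n :=
    fun n hn => (Int.natCast_dvd_natCast.mpr hNdvd).trans (hper' n hn)
  have hM : 1 < p1 * p2 := by nlinarith [hp1.two_le, hp2.two_le]
  have hζ := Complex.isPrimitiveRoot_exp (p1 * p2) (by omega)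
  set ζ := Complex.exp (2 * Real.pi * Complex.I / ((p1 * p2 : ℕ) : ℂ))
  have hcover : ∀ y : F, y ≠ 0 → ∃ k < p1 * p2, y ∈ D k := by
    intro y hy
    obtain ⟨n, rfl⟩ := hgen y hy
    obtain ⟨i, hi, k, rfl⟩ := exists_digit_repr hPpos hPr n
    have hMpos : (0 : ℤ) < ((p1 * p2 : ℕ) : ℤ) := by exact_mod_cast hM.le
    have hknn := Int.emod_nonneg k hMpos.ne'
    have hklt := Int.emod_lt_of_pos k hMpos
    refine ⟨(k % ((p1 * p2 : ℕ) : ℤ)).toNat, by omega, ?_⟩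
    rw [hD]
    have hord : (0 : ℤ) < ((q - 1 : ℕ) : ℤ) := by
      rw [← hγ]; exact_mod_cast orderOf_pos γ
    set d := k / ((p1 * p2 : ℕ) : ℤ)
    have hkd : k = (k % ((p1 * p2 : ℕ) : ℤ)) + ((p1 * p2 : ℕ) : ℤ) * d :=
      (Int.emod_add_mul_ediv k _).symm
    -- shift the exponent by a multiple of `q - 1` to make it nonnegative
    have htnn : 0 ≤ d + ((q - 1 : ℕ) : ℤ) * |d| := by
      nlinarith [neg_abs_le d, abs_nonneg d]
    refine ⟨i, hi, (d + ((q - 1 : ℕ) : ℤ) * |d|).toNat, ?_⟩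
    have hgq : g ^ ((q - 1 : ℕ) : ℤ) = 1 := by
      rw [zpow_natCast, ← hγ, hgdef, ← Units.val_pow_eq_pow_val, pow_orderOf_eq_one, Units.val_one]
    have hexp : ((i * p2 + (k % ((p1 * p2 : ℕ) : ℤ)).toNat * P +
        p1 ^ m * p2 * (d + ((q - 1 : ℕ) : ℤ) * |d|).toNat : ℕ) : ℤ) =
        ((i : ℤ) * p2 + k * P) + ((q - 1 : ℕ) : ℤ) * (((p1 ^ m * p2 : ℕ) : ℤ) * |d|) := by
      rw [Nat.cast_add, Nat.cast_add, Nat.cast_mul i, Nat.cast_mul _ P, Nat.cast_mul (p1 ^ m * p2),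
        Int.toNat_of_nonneg htnn, Int.toNat_of_nonneg hknn]
      have hNP' : ((p1 ^ m * p2 : ℕ) : ℤ) = P * ((p1 * p2 : ℕ) : ℤ) := by
        rw [hNP, Nat.cast_mul]
      linear_combination d * hNP' - (P : ℤ) * hkd
    rw [← zpow_natCast, hexp, zpow_add₀ hg _ (((q - 1 : ℕ) : ℤ) * _), zpow_mul g ((q - 1 : ℕ) : ℤ), hgq, one_zpow, mul_one]
  have hD0 : ∀ k < p1 * p2, (0 : F) ∉ D k := by
    intro k _ h
    rw [hD] at h
    obtain ⟨i, _, t, h⟩ := h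
    exact pow_ne_zero _ hg h.symm
  have hclass : ∀ j < p1 * p2, ∃ h : F → ℂ, h 0 = 0 ∧
      (∀ k < p1 * p2, ∀ y ∈ D k, h y = (ζ ^ j) ^ k) ∧
      (j ≠ 0 → ∑ v, h (v + x) * starRingEnd ℂ (h v) = -1) := by
    intro j hj
    rcases eq_or_ne j 0 with rfl | hj0
    · refine ⟨fun y => if y = 0 then 0 else 1, if_pos rfl, ?_, fun h => absurd rfl h⟩
      intro k hk y hy
      have : y ≠ 0 := by rintro rfl; exact hD0 k hk hy
      simp [this]
    · have hzM : (ζ ^ j) ^ (p1 * p2) = 1 := by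
        rw [← pow_mul, mul_comm, pow_mul, hζ.pow_eq_one, one_pow]
      obtain ⟨h, h0, hval, hcorr⟩ := exists_class_function hp1 hp2 hodd hne hm hcop hf2 hg hgen
        hper hzM (hζ.pow_ne_one_of_pos_of_lt hj0 hj)
      refine ⟨h, h0, ?_, fun _ => hcorr x hx⟩
      intro k _ y hy
      rw [hD] at hy
      obtain ⟨i, hi, t, rfl⟩ := hy
      have hexp : ((i * p2 + k * P + p1 ^ m * p2 * t : ℕ) : ℤ) =
          (i * p2 : ℤ) + ((k + p1 * p2 * t : ℕ) : ℤ) * (P : ℕ) := by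
        rw [hNP]; push_cast; ring
      rw [← zpow_natCast, hexp, hval i hi, zpow_natCast, pow_add, pow_mul _ (p1 * p2), hzM, one_pow,
        mul_one]
  choose! H hH0 hHval hHcorr using hclass
  have hfinal := card_differences hζ hM D hD0 hcover H hH0 hHval hHcorr hx
  rw [hF] at hfinal
  rw [← hfinal, Nat.mul_div_cancel_left _ (by omega), Nat.add_sub_cancel]
end
end

section
/- With N = p1^m·p2 and D_0 as in the context, let χ1, χ2 be the multiplicative characters of F_q with χ1(γ) = exp(2πi/p1^m) and χ2(γ) = exp(2πi/p2), let h be the class number of Q(√(−p1·p2)), let h0 = (f−h)/2, and let b, c be integers with b, c ≢ 0 (mod p), b² + p1·p2·c² = 4·p^h, b ≡ 2·p^{h/2} (mod ℓ) for ℓ ∈ {p1, p2} the prime congruent to 3 mod 4, and g(conj(χ1)·conj(χ2)) = ((b + c·i·√(p1·p2))/2)·p^{h0}. Then the Cayley graph Cay(F_q, D_0) is a strongly regular graph if and only if b, c ∈ {1, −1}, h is even, p1 = 2·p^{h/2} + (−1)^{(p1−1)/2}·b, and p2 = 2·p^{h/2} − (−1)^{(p1−1)/2}·b. -/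
open scoped Classical

noncomputable section

/-- Fourier transform on a finite field is injective. -/
theorem eq_zero_of_fourier_eq_zero {F : Type} [Field F] [Fintype F] {ψ : AddChar F ℂ}
    (hψ : ψ.IsPrimitive) (a : F → ℂ) (ha : ∀ c, ∑ x, a x * ψ (c * x) = 0) (d : F) : a d = 0 := by
  have h1 : ∑ c, ψ (-(c * d)) * ∑ x, a x * ψ (c * x) = 0 := by simp [ha]
  have h2 : ∑ c, ψ (-(c * d)) * ∑ x, a x * ψ (c * x)
      = ∑ x, a x * ∑ c, ψ (c * (x - d)) := by
    simp_rw [Finset.mul_sum]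
    rw [Finset.sum_comm]
    refine Finset.sum_congr rfl fun x _ => Finset.sum_congr rfl fun c _ => ?_
    rw [mul_sub, sub_eq_add_neg, AddChar.map_add_eq_mul]
    ring
  rw [h2] at h1
  simp_rw [AddChar.sum_mulShift _ hψ, sub_eq_zero] at h1
  simpa using h1

/-- The number of ways to write `d` as a sum of two elements of `D`. -/
def sumRepr {F : Type} [Field F] [Fintype F] (D : Set F) (d : F) : ℕ :=
  (Finset.univ.filter fun z : F => z ∈ D ∧ d - z ∈ D).card

theorem sum_sumRepr_mul {F : Type} [Field F] [Fintype F] (ψ : AddChar F ℂ) (D : Set F) (c : F) :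
    ∑ d, (sumRepr D d : ℂ) * ψ (c * d) = (∑ x ∈ D.toFinset, ψ (c * x)) ^ 2 := by
  have h1 : ∀ d, (sumRepr D d : ℂ) * ψ (c * d)
      = ∑ z, if z ∈ D then (if d - z ∈ D then ψ (c * d) else 0) else 0 := by
    intro d
    simp only [sumRepr, Finset.card_filter]
    push_cast
    rw [Finset.sum_mul]
    refine Finset.sum_congr rfl fun z _ => ?_
    by_cases h : z ∈ D <;> by_cases h' : d - z ∈ D <;> simp [h, h']
  have h2 : ∑ x ∈ D.toFinset, ψ (c * x) = ∑ x, if x ∈ D then ψ (c * x) else 0 := by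
    rw [← Finset.sum_filter]
    exact Finset.sum_congr (by ext; simp) fun _ _ => rfl
  simp_rw [h1]
  rw [Finset.sum_comm, h2, sq, Finset.sum_mul]
  refine Finset.sum_congr rfl fun z _ => ?_
  by_cases h : z ∈ D
  · simp only [h, if_true]
    rw [Finset.mul_sum, ← Equiv.sum_comp (Equiv.addRight z)]
    refine Finset.sum_congr rfl fun d _ => ?_
    by_cases h' : d ∈ D <;> simp [h', mul_add, AddChar.map_add_eq_mul, mul_comm]
  · simp [h]

theorem fromRel_sub_adj {F : Type} [Field F] {D : Set F} (h0 : (0 : F) ∉ D)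
    (hneg : ∀ x ∈ D, -x ∈ D) (x y : F) :
    (SimpleGraph.fromRel (fun x y : F => x - y ∈ D)).Adj x y ↔ x - y ∈ D := by
  rw [SimpleGraph.fromRel_adj]
  constructor
  · rintro ⟨_, h | h⟩
    · exact h
    · simpa using hneg _ h
  · intro h
    refine ⟨?_, Or.inl h⟩
    rintro rfl
    simp [h0] at h

theorem card_commonNeighbors_cayley {F : Type} [Field F] [Fintype F] {D : Set F}
    (h0 : (0 : F) ∉ D) (hneg : ∀ x ∈ D, -x ∈ D) (x y : F) :
    Fintype.card ((SimpleGraph.fromRel (fun x y : F => x - y ∈ D)).commonNeighbors x y)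
      = sumRepr D (x - y) := by
  rw [← Set.toFinset_card, sumRepr]
  refine Finset.card_bij' (fun w _ => x - w) (fun z _ => x - z) ?_ ?_ ?_ ?_
  · intro w hw
    simp only [Set.mem_toFinset, SimpleGraph.mem_commonNeighbors, fromRel_sub_adj h0 hneg] at hw
    simp only [Finset.mem_filter, Finset.mem_univ, true_and]
    refine ⟨hw.1, ?_⟩
    convert hneg _ hw.2 using 1
    ring
  · intro z hz
    simp only [Finset.mem_filter, Finset.mem_univ, true_and] at hz
    simp only [Set.mem_toFinset, SimpleGraph.mem_commonNeighbors, fromRel_sub_adj h0 hneg]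
    refine ⟨by simpa using hz.1, ?_⟩
    convert hneg _ hz.2 using 1
    ring
  · simp
  · simp

theorem degree_cayley {F : Type} [Field F] [Fintype F] {D : Set F}
    (h0 : (0 : F) ∉ D) (hneg : ∀ x ∈ D, -x ∈ D) (x : F) :
    (SimpleGraph.fromRel (fun x y : F => x - y ∈ D)).degree x = D.toFinset.card := by
  rw [← SimpleGraph.card_neighborFinset_eq_degree]
  refine Finset.card_bij' (fun w _ => x - w) (fun z _ => x - z) ?_ ?_ ?_ ?_
  · intro w hw
    rw [SimpleGraph.mem_neighborFinset, fromRel_sub_adj h0 hneg] at hw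
    simpa using hw
  · intro w hw
    rw [SimpleGraph.mem_neighborFinset, fromRel_sub_adj h0 hneg]
    simpa using hw
  · simp
  · simp

theorem sumRepr_zero {F : Type} [Field F] [Fintype F] {D : Set F}
    (hneg : ∀ x ∈ D, -x ∈ D) : sumRepr D 0 = D.toFinset.card := by
  rw [sumRepr]
  congr 1
  ext z
  simp only [Finset.mem_filter, Finset.mem_univ, true_and, zero_sub, Set.mem_toFinset]
  exact ⟨fun h => h.1, fun h => ⟨h, hneg z h⟩⟩

/-- A Cayley graph on a finite field is strongly regular iff the nontrivial character sums over
the connection set are roots of a common quadratic. -/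
theorem cayley_srg_iff_quadratic {F : Type} [Field F] [Fintype F] {ψ : AddChar F ℂ}
    (hψ : ψ.IsPrimitive) {D : Set F} (h0 : (0 : F) ∉ D) (hneg : ∀ x ∈ D, -x ∈ D)
    (hne : ∃ x, x ∈ D) (hnf : ∃ x, x ≠ 0 ∧ x ∉ D) {q : ℕ} (hq : Fintype.card F = q) :
    (SimpleGraph.fromRel (fun x y : F => x - y ∈ D) ≠ ⊤ ∧
     SimpleGraph.fromRel (fun x y : F => x - y ∈ D) ≠ ⊥ ∧
     ∃ k l u : ℕ, (SimpleGraph.fromRel (fun x y : F => x - y ∈ D)).IsSRGWith q k l u) ↔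
    ∃ α β : ℂ, ∀ c : F, c ≠ 0 →
      (∑ x ∈ D.toFinset, ψ (c * x)) ^ 2 = α * (∑ x ∈ D.toFinset, ψ (c * x)) + β := by
  have hadj := fromRel_sub_adj h0 hneg
  have hD : ∀ c, ∑ x ∈ D.toFinset, ψ (c * x) = ∑ x, (if x ∈ D then 1 else 0) * ψ (c * x) := by
    intro c
    simp_rw [ite_mul, one_mul, zero_mul]
    rw [← Finset.sum_filter]
    exact Finset.sum_congr (by ext; simp) fun _ _ => rfl
  constructor
  · rintro ⟨-, -, k, l, u, hG⟩
    refine ⟨(l : ℂ) - u, (k : ℂ) - u, fun c hc => ?_⟩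
    have hr : ∀ d, (sumRepr D d : ℂ)
        = ((l : ℂ) - u) * (if d ∈ D then 1 else 0) + ((k : ℂ) - u) * (if d = 0 then 1 else 0)
          + u := by
      intro d
      by_cases hd0 : d = 0
      · subst hd0
        have : D.toFinset.card = k := by
          rw [← degree_cayley h0 hneg 0]; exact hG.regular 0
        simp [h0, sumRepr_zero hneg, this]
      · have hc := card_commonNeighbors_cayley h0 hneg d 0
        rw [sub_zero] at hc
        by_cases hd : d ∈ D
        · have := hG.of_adj d 0 ((hadj _ _).2 (by simpa using hd))
          simp [hd, hd0, ← hc, ← this]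
        · have := hG.of_not_adj hd0
            (fun h => hd (by simpa using (hadj _ _).1 h))
          simp [hd, hd0, ← hc, ← this]
    have hu : ∑ x, ψ (c * x) = 0 := by
      have := AddChar.sum_mulShift c hψ
      simp_rw [mul_comm _ c] at this
      simpa [hc] using this
    rw [← sum_sumRepr_mul, hD]
    simp_rw [hr, add_mul, Finset.sum_add_distrib, mul_assoc, ← Finset.mul_sum, hu]
    simp
  · rintro ⟨α, β, hq'⟩
    obtain ⟨x1, hx1⟩ := hne
    obtain ⟨x2, hx20, hx2⟩ := hnf
    have hcard : (Fintype.card F : ℂ) ≠ 0 := by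
      exact_mod_cast Fintype.card_ne_zero
    obtain ⟨κ, hκ⟩ : ∃ κ : ℂ, ∀ d, (sumRepr D d : ℂ)
        = α * (if d ∈ D then 1 else 0) + β * (if d = 0 then 1 else 0) + κ := by
      set t := (∑ x ∈ D.toFinset, ψ (0 * x)) with ht
      refine ⟨(t ^ 2 - α * t - β) / Fintype.card F, fun d => ?_⟩
      have := eq_zero_of_fourier_eq_zero hψ (fun d => (sumRepr D d : ℂ) -
        (α * (if d ∈ D then 1 else 0) + β * (if d = 0 then 1 else 0)
          + (t ^ 2 - α * t - β) / Fintype.card F)) ?_ d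
      · exact sub_eq_zero.1 this
      · intro c
        simp_rw [sub_mul, Finset.sum_sub_distrib, sum_sumRepr_mul, add_mul,
          Finset.sum_add_distrib, mul_assoc, ← Finset.mul_sum, ← hD]
        have hδ : ∑ x : F, (if x = 0 then (1 : ℂ) else 0) * ψ (c * x) = 1 := by simp
        rw [hδ]
        by_cases hc : c = 0
        · subst hc
          rw [← ht]
          simp only [zero_mul, AddChar.map_zero_eq_one, Finset.sum_const, Finset.card_univ,
            nsmul_eq_mul, mul_one]
          field_simp
          ring
        · have hu : ∑ x, ψ (c * x) = 0 := by
            have := AddChar.sum_mulShift c hψ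
            simp_rw [mul_comm _ c] at this
            simpa [hc] using this
          rw [hu, hq' c hc]
          ring
    refine ⟨?_, ?_, D.toFinset.card, sumRepr D x1, sumRepr D x2, ?_⟩
    · intro h
      have := (hadj x2 0).1 (by rw [h]; exact hx20)
      exact hx2 (by simpa using this)
    · intro h
      have := (hadj x1 0).2 (by simpa using hx1)
      rw [h] at this
      exact this
    · refine ⟨hq, fun v => degree_cayley h0 hneg v, ?_, ?_⟩
      · intro v w hvw
        rw [hadj] at hvw
        have e : (sumRepr D (v - w) : ℂ) = sumRepr D x1 := by
          have h1 : v - w ≠ 0 := fun h => h0 (h ▸ hvw)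
          have h2 : x1 ≠ 0 := fun h => h0 (h ▸ hx1)
          rw [hκ, hκ]; simp [h1, h2, hvw, hx1]
        rw [card_commonNeighbors_cayley h0 hneg]
        exact_mod_cast e
      · intro v w hne hvw
        rw [hadj] at hvw
        have e : (sumRepr D (v - w) : ℂ) = sumRepr D x2 := by
          rw [hκ, hκ]; simp [sub_ne_zero.2 hne, hx20, hvw, hx2]
        refine Eq.trans ?_ ((card_commonNeighbors_cayley h0 hneg v w).trans (by exact_mod_cast e))
        rfl

section PrimePower

variable (r n : ℕ)

/-- Reduction `ℤ/r^(n+1) → ℤ/r^n`. -/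
def reduce : ZMod (r ^ (n + 1)) →+* ZMod (r ^ n) :=
  ZMod.castHom (pow_dvd_pow r n.le_succ) _

/-- The embedding `ℤ/r → ℤ/r^(n+1)` given by multiplication by `r^n`. -/
def embed : ZMod r →+ ZMod (r ^ (n + 1)) :=
  ZMod.lift r ⟨zmultiplesHom _ ((r : ZMod (r ^ (n + 1))) ^ n), by
    have : ((r ^ (n + 1) : ℕ) : ZMod (r ^ (n + 1))) = 0 := ZMod.natCast_self _
    push_cast at this
    simp [← this, pow_succ, mul_comm]⟩

theorem embed_natCast (k : ℕ) :
    embed r n (k : ZMod r) = (k : ZMod (r ^ (n + 1))) * (r : ZMod (r ^ (n + 1))) ^ n := by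
  have := ZMod.lift_coe r ⟨zmultiplesHom _ ((r : ZMod (r ^ (n + 1))) ^ n), by
    have : ((r ^ (n + 1) : ℕ) : ZMod (r ^ (n + 1))) = 0 := ZMod.natCast_self _
    push_cast at this
    simp [← this, pow_succ, mul_comm]⟩ (k : ℤ)
  rw [embed]
  simpa using this

theorem embed_natCast_mul (a : ℕ) (k : ZMod r) :
    embed r n (a * k) = a * embed r n k := by
  rw [← nsmul_eq_mul, map_nsmul, nsmul_eq_mul]

theorem reduce_natCast_eq_zero_iff (a : ℕ) :
    reduce r n (a : ZMod (r ^ (n + 1))) = 0 ↔ r ^ n ∣ a := by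
  rw [map_natCast, ZMod.natCast_eq_zero_iff]

theorem reduce_surjective : Function.Surjective (reduce r n) := ZMod.castHom_surjective _

variable [Fact r.Prime]

theorem reduce_eq_zero_iff (x : ZMod (r ^ (n + 1))) :
    reduce r n x = 0 ↔ ∃ k, embed r n k = x := by
  obtain ⟨a, rfl⟩ := ZMod.natCast_zmod_surjective x
  rw [reduce_natCast_eq_zero_iff]
  constructor
  · rintro ⟨t, rfl⟩
    exact ⟨t, by rw [embed_natCast]; push_cast; ring⟩
  · rintro ⟨k, hk⟩
    obtain ⟨b, rfl⟩ := ZMod.natCast_zmod_surjective k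
    rw [← reduce_natCast_eq_zero_iff r n a, ← hk, embed_natCast]
    have : ((r ^ n : ℕ) : ZMod (r ^ n)) = 0 := ZMod.natCast_self _
    push_cast at this
    simp [this]

theorem embed_injective : Function.Injective (embed r n) := by
  rw [injective_iff_map_eq_zero]
  intro k hk
  obtain ⟨b, rfl⟩ := ZMod.natCast_zmod_surjective k
  rw [embed_natCast] at hk
  have h : ((b * r ^ n : ℕ) : ZMod (r ^ (n + 1))) = 0 := by push_cast; exact hk
  rw [ZMod.natCast_eq_zero_iff, pow_succ, mul_comm] at h
  rw [ZMod.natCast_eq_zero_iff]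
  exact Nat.dvd_of_mul_dvd_mul_right (pow_pos (Fact.out : r.Prime).pos n)
    h

theorem sum_ker_reduce {A : Type*} [AddCommMonoid A] (g : ZMod (r ^ (n + 1)) → A) :
    ∑ x with reduce r n x = 0, g x = ∑ k, g (embed r n k) := by
  symm
  refine Finset.sum_bij (fun k _ => embed r n k) ?_ ?_ ?_ ?_
  · intro k _
    simpa using (reduce_eq_zero_iff r n _).2 ⟨k, rfl⟩
  · intro a _ b _ h
    exact embed_injective r n h
  · intro x hx
    obtain ⟨k, hk⟩ := (reduce_eq_zero_iff r n x).1 (by simpa using hx)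
    exact ⟨k, Finset.mem_univ _, hk⟩
  · intros; rfl

theorem sum_comp_reduce {A : Type*} [AddCommMonoid A] (g : ZMod (r ^ n) → A) :
    ∑ x, g (reduce r n x) = r • ∑ k, g k := by
  rw [← Finset.sum_fiberwise' (s := Finset.univ) (g := reduce r n) (f := g), Finset.smul_sum]
  refine Finset.sum_congr rfl fun k _ => ?_
  obtain ⟨x0, rfl⟩ := reduce_surjective r n k
  rw [Finset.sum_const]
  congr 1
  have h1 : (Finset.univ.filter fun x => reduce r n x = reduce r n x0).card
      = (Finset.univ.filter fun x => reduce r n x = 0).card := by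
    refine Finset.card_bij' (fun x _ => x - x0) (fun x _ => x + x0) ?_ ?_ ?_ ?_ <;>
      simp +contextual
  rw [h1, Finset.card_eq_sum_ones, sum_ker_reduce]
  simp [ZMod.card]

/-- If `x` and `x'` agree modulo `r^n` and are nonzero there, they differ by a square unit. -/
theorem exists_sq_mul_eq (hr : r ≠ 2) {x x' : ZMod (r ^ (n + 1))}
    (h : reduce r n x = reduce r n x') (h0 : reduce r n x ≠ 0) :
    ∃ u : (ZMod (r ^ (n + 1)))ˣ, x' = (u : ZMod (r ^ (n + 1))) ^ 2 * x := by
  have hp : r.Prime := Fact.out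
  obtain ⟨a, rfl⟩ := ZMod.natCast_zmod_surjective x
  have hx' : ∃ k, embed r n k = x' - a :=
    (reduce_eq_zero_iff r n _).1 (by rw [map_sub, h, sub_self])
  obtain ⟨k, hk⟩ := hx'
  obtain ⟨t, rfl⟩ := ZMod.natCast_zmod_surjective k
  rw [embed_natCast] at hk
  rw [Ne, reduce_natCast_eq_zero_iff] at h0
  obtain ⟨s, hs⟩ : ∃ s : ZMod (r ^ (n + 1)), (r : ZMod (r ^ (n + 1))) ^ n = r * a * s := by
    have hg : Nat.gcd (r * a) (r ^ (n + 1)) ∣ r ^ n := by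
      obtain ⟨j, hj, hj'⟩ := (Nat.dvd_prime_pow hp).1 (Nat.gcd_dvd_right (r * a) (r ^ (n + 1)))
      rw [hj']
      refine pow_dvd_pow _ ?_
      by_contra hlt
      have : j = n + 1 := by omega
      subst this
      have h2 := Nat.gcd_dvd_left (r * a) (r ^ (n + 1))
      rw [hj', pow_succ, mul_comm] at h2
      exact h0 (Nat.dvd_of_mul_dvd_mul_left hp.pos h2)
    obtain ⟨c, hc⟩ := hg
    refine ⟨(Nat.gcdA (r * a) (r ^ (n + 1)) : ZMod (r ^ (n + 1))) * c, ?_⟩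
    have hb := congrArg (Int.cast : ℤ → ZMod (r ^ (n + 1))) (Nat.gcd_eq_gcd_ab (r * a) (r ^ (n + 1)))
    have hz : (r : ZMod (r ^ (n + 1))) ^ (n + 1) = 0 := by
      have := ZMod.natCast_self (r ^ (n + 1)); push_cast at this; exact this
    have hc' := congrArg (Nat.cast : ℕ → ZMod (r ^ (n + 1))) hc
    push_cast at hb hc'
    rw [hz, zero_mul, add_zero] at hb
    rw [hc', hb]
    ring
  obtain ⟨w, hw⟩ : ∃ w : ZMod (r ^ (n + 1)), w = 1 + r * (s * t) := ⟨_, rfl⟩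
  have hpow : w ^ r ^ n = 1 := by
    have hd : (r : ZMod (r ^ (n + 1))) ∣ w - 1 := ⟨s * t, by rw [hw]; ring⟩
    have := dvd_sub_pow_of_dvd_sub hd n
    have hz : (r : ZMod (r ^ (n + 1))) ^ (n + 1) = 0 := by
      have := ZMod.natCast_self (r ^ (n + 1)); push_cast at this; exact this
    rw [hz, zero_dvd_iff, one_pow, sub_eq_zero] at this
    exact this
  have hunit : IsUnit w := IsUnit.of_pow_eq_one hpow (pow_pos hp.pos n).ne'
  obtain ⟨u, hu⟩ := hunit
  obtain ⟨j, hj⟩ : Odd (r ^ n) := (hp.odd_of_ne_two hr).pow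
  refine ⟨u ^ (j + 1), ?_⟩
  rw [Units.val_pow_eq_pow_val, hu, ← pow_mul, show (j + 1) * 2 = (2 * j + 1) + 1 by ring, ← hj,
    pow_succ w, hpow, one_mul, hw]
  linear_combination -hk + (t : ZMod (r ^ (n + 1))) * hs

end PrimePower

/-- A function on `ℤ/p1^(n+1) × ℤ/p2` constant on the orbits of multiplication by `p`, where `p`
is a primitive root modulo both factors and its powers contain all squares of units. -/
structure FrobeniusInvariant (p1 p2 n p : ℕ) (E : ZMod (p1 ^ (n + 1)) → ZMod p2 → ℤ) :
    Prop where
  odd1 : p1 ≠ 2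
  odd2 : p2 ≠ 2
  ne : p1 ≠ p2
  cop1 : p.Coprime p1
  cop2 : p.Coprime p2
  frob : ∀ x y, E (p * x) (p * y) = E x y
  gen1 : ∀ u : (ZMod (p1 ^ (n + 1)))ˣ, ∃ j : ℕ, (u : ZMod (p1 ^ (n + 1))) = (p : ZMod _) ^ j
  gen2 : ∀ y : ZMod p2, y ≠ 0 → ∃ j : ℕ, y = (p : ZMod p2) ^ j
  sq : ∀ (u : (ZMod (p1 ^ (n + 1)))ˣ) (v : (ZMod p2)ˣ), ∃ j : ℕ,
    (p : ZMod (p1 ^ (n + 1))) ^ j = (u : ZMod (p1 ^ (n + 1))) ^ 2 ∧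
      (p : ZMod p2) ^ j = (v : ZMod p2) ^ 2

/-- The sum of `E` over the translate of `{i * p2 : i < p1^n}`. -/
def translateSum (p1 p2 n : ℕ) (E : ZMod (p1 ^ (n + 1)) → ZMod p2 → ℤ)
    (x : ZMod (p1 ^ (n + 1))) (y : ZMod p2) : ℤ :=
  ∑ i ∈ Finset.range (p1 ^ n), E (x + i * p2) y

/-- The part of `E` off the kernel of reduction, as a function modulo `p1^n`. -/
def offKernel (p1 p2 n : ℕ) (E : ZMod (p1 ^ (n + 1)) → ZMod p2 → ℤ)
    (k : ZMod (p1 ^ n)) (y : ZMod p2) : ℤ :=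
  if k = 0 then 0 else E (k.val : ZMod (p1 ^ (n + 1))) y

theorem quadraticChar_eq_neg_one_of_generator {r p : ℕ} [Fact r.Prime] (hr : r ≠ 2)
    (hgen : ∀ y : ZMod r, y ≠ 0 → ∃ j : ℕ, y = (p : ZMod r) ^ j) (hcop : p.Coprime r) :
    quadraticChar (ZMod r) p = -1 := by
  have hp0 : (p : ZMod r) ≠ 0 := by
    rw [Ne, ZMod.natCast_eq_zero_iff, ← Nat.Prime.coprime_iff_not_dvd Fact.out]
    exact hcop.symm
  rcases quadraticChar_dichotomy hp0 with h | h
  · obtain ⟨a, ha⟩ := quadraticChar_exists_neg_one (F := ZMod r) (by rwa [ZMod.ringChar_zmod_n])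
    have ha0 : a ≠ 0 := by
      rintro rfl
      simp at ha
    obtain ⟨j, rfl⟩ := hgen a ha0
    rw [map_pow, h, one_pow] at ha
    norm_num at ha
  · exact h

namespace FrobeniusInvariant

variable {p1 p2 n p : ℕ} {E : ZMod (p1 ^ (n + 1)) → ZMod p2 → ℤ}

theorem isUnit_prime_pow (hE : FrobeniusInvariant p1 p2 n p E) (k : ℕ) :
    IsUnit (p : ZMod (p1 ^ k)) :=
  (ZMod.isUnit_iff_coprime _ _).2 (hE.cop1.pow_right _)

theorem frob_pow (hE : FrobeniusInvariant p1 p2 n p E) (j : ℕ) (x : ZMod (p1 ^ (n + 1)))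
    (y : ZMod p2) : E ((p : ZMod _) ^ j * x) ((p : ZMod p2) ^ j * y) = E x y := by
  induction j with
  | zero => simp
  | succ j ih =>
    rw [pow_succ' (p : ZMod (p1 ^ (n + 1))), pow_succ' (p : ZMod p2), mul_assoc, mul_assoc,
      hE.frob, ih]

theorem apply_sq_mul (hE : FrobeniusInvariant p1 p2 n p E) (u : (ZMod (p1 ^ (n + 1)))ˣ)
    (x : ZMod (p1 ^ (n + 1))) (y : ZMod p2) :
    E ((u : ZMod (p1 ^ (n + 1))) ^ 2 * x) y = E x y := by
  obtain ⟨j, h1, h2⟩ := hE.sq u 1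
  have := hE.frob_pow j x y
  rwa [h1, h2, Units.val_one, one_pow, one_mul] at this

variable [Fact p1.Prime]

theorem apply_eq_of_reduce_eq (hE : FrobeniusInvariant p1 p2 n p E) {x x' : ZMod (p1 ^ (n + 1))}
    (h : reduce p1 n x = reduce p1 n x') (h0 : reduce p1 n x ≠ 0) (y : ZMod p2) :
    E x y = E x' y := by
  obtain ⟨u, rfl⟩ := exists_sq_mul_eq p1 n hE.odd1 h h0
  exact (hE.apply_sq_mul u x y).symm

theorem gen1' (hE : FrobeniusInvariant p1 p2 n p E) (k : ZMod p1) (hk : k ≠ 0) :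
    ∃ j : ℕ, k = (p : ZMod p1) ^ j := by
  obtain ⟨a, rfl⟩ := ZMod.natCast_zmod_surjective k
  rw [Ne, ZMod.natCast_eq_zero_iff, ← Nat.Prime.coprime_iff_not_dvd Fact.out] at hk
  obtain ⟨u, hu⟩ := (ZMod.isUnit_iff_coprime a (p1 ^ (n + 1))).2 (hk.symm.pow_right _)
  obtain ⟨j, hj⟩ := hE.gen1 u
  refine ⟨j, ?_⟩
  rw [hu] at hj
  have := congrArg (ZMod.castHom (dvd_pow_self p1 n.succ_ne_zero) (ZMod p1)) hj
  simpa using this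

theorem apply_eq_offKernel (hE : FrobeniusInvariant p1 p2 n p E) {x : ZMod (p1 ^ (n + 1))}
    (h0 : reduce p1 n x ≠ 0) (y : ZMod p2) :
    E x y = offKernel p1 p2 n E (reduce p1 n x) y := by
  rw [offKernel, if_neg h0]
  exact hE.apply_eq_of_reduce_eq (by simp) h0 y

theorem apply_eq (hE : FrobeniusInvariant p1 p2 n p E) (x : ZMod (p1 ^ (n + 1))) (y : ZMod p2) :
    E x y = offKernel p1 p2 n E (reduce p1 n x) y + if reduce p1 n x = 0 then E x y else 0 := by
  by_cases h : reduce p1 n x = 0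
  · simp [h, offKernel]
  · rw [if_neg h, add_zero, ← hE.apply_eq_offKernel h]

theorem offKernel_frob (hE : FrobeniusInvariant p1 p2 n p E) (k : ZMod (p1 ^ n)) (y : ZMod p2) :
    offKernel p1 p2 n E (p * k) (p * y) = offKernel p1 p2 n E k y := by
  obtain ⟨x, rfl⟩ := reduce_surjective p1 n k
  have h : (p : ZMod (p1 ^ n)) * reduce p1 n x = reduce p1 n (p * x) := by simp
  by_cases h0 : reduce p1 n x = 0
  · simp [h0, offKernel]
  · have h1 : reduce p1 n (p * x) ≠ 0 := by
      rw [← h]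
      exact fun h2 => h0 ((hE.isUnit_prime_pow n).mul_right_eq_zero.1 h2)
    rw [h, ← hE.apply_eq_offKernel h1, ← hE.apply_eq_offKernel h0, hE.frob]

theorem sum_addChar_mul (hE : FrobeniusInvariant p1 p2 n p E)
    (θ : AddChar (ZMod (p1 ^ (n + 1))) ℂ) (hθ : θ (embed p1 n 1) ≠ 1) (y : ZMod p2) :
    ∑ x, θ x * E x y = ∑ k, θ (embed p1 n k) * E (embed p1 n k) y := by
  have h1 : ∑ x, θ x * (offKernel p1 p2 n E (reduce p1 n x) y : ℂ) = 0 := by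
    set s := ∑ x, θ x * (offKernel p1 p2 n E (reduce p1 n x) y : ℂ) with hs
    have h2 : s = θ (embed p1 n 1) * s := by
      conv_lhs => rw [hs, ← Equiv.sum_comp (Equiv.addRight (embed p1 n 1))]
      rw [hs, Finset.mul_sum]
      refine Finset.sum_congr rfl fun x _ => ?_
      have h3 : reduce p1 n (embed p1 n 1) = 0 := (reduce_eq_zero_iff p1 n _).2 ⟨1, rfl⟩
      simp only [Equiv.coe_addRight]
      rw [map_add (reduce p1 n), h3, add_zero, AddChar.map_add_eq_mul]
      ring
    have h3 : (θ (embed p1 n 1) - 1) * s = 0 := by linear_combination -h2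
    exact (mul_eq_zero.1 h3).resolve_left (sub_ne_zero.2 hθ)
  have h2 : ∀ x, θ x * (E x y : ℂ) = θ x * (offKernel p1 p2 n E (reduce p1 n x) y : ℂ)
      + if reduce p1 n x = 0 then θ x * (E x y : ℂ) else 0 := by
    intro x
    conv_lhs => rw [hE.apply_eq x y]
    split_ifs <;> push_cast <;> ring
  rw [Finset.sum_congr rfl fun x _ => h2 x, Finset.sum_add_distrib, h1, zero_add,
    ← Finset.sum_filter, sum_ker_reduce]

variable [Fact p2.Prime]

theorem sum_offKernel_frob (hE : FrobeniusInvariant p1 p2 n p E) (y : ZMod p2) :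
    ∑ k, offKernel p1 p2 n E k (p * y) = ∑ k, offKernel p1 p2 n E k y := by
  obtain ⟨u, hu⟩ := hE.isUnit_prime_pow n
  rw [← Equiv.sum_comp (Units.mulLeft u)]
  refine Finset.sum_congr rfl fun k _ => ?_
  rw [Units.mulLeft_apply, hu, hE.offKernel_frob]

theorem sum_offKernel_eq (hE : FrobeniusInvariant p1 p2 n p E) {y : ZMod p2} (hy : y ≠ 0) :
    ∑ k, offKernel p1 p2 n E k y = ∑ k, offKernel p1 p2 n E k 1 := by
  obtain ⟨j, rfl⟩ := hE.gen2 y hy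
  clear hy
  induction j with
  | zero => simp
  | succ j ih => rw [pow_succ', hE.sum_offKernel_frob, ih]

theorem bijOn_translate (hE : FrobeniusInvariant p1 p2 n p E) (c : ZMod (p1 ^ n)) :
    Function.Bijective fun i : Fin (p1 ^ n) => c + (i : ℕ) * (p2 : ZMod (p1 ^ n)) := by
  rw [Fintype.bijective_iff_injective_and_card]
  refine ⟨fun i j hij => ?_, by simp [ZMod.card]⟩
  have hu : IsUnit (p2 : ZMod (p1 ^ n)) := (ZMod.isUnit_iff_coprime _ _).2
    (((Nat.coprime_primes Fact.out Fact.out).2 hE.ne.symm).pow_right _)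
  have h1 := hu.mul_right_cancel (add_left_cancel hij)
  rw [ZMod.natCast_eq_natCast_iff', Nat.mod_eq_of_lt i.2, Nat.mod_eq_of_lt j.2] at h1
  exact Fin.ext h1

theorem translateSum_eq (hE : FrobeniusInvariant p1 p2 n p E) {x : ZMod (p1 ^ (n + 1))}
    {i0 : Fin (p1 ^ n)} (hi : reduce p1 n (x + (i0 : ℕ) * p2) = 0) (y : ZMod p2) :
    translateSum p1 p2 n E x y
      = ∑ k, offKernel p1 p2 n E k y + E (x + (i0 : ℕ) * p2) y := by
  have hb := hE.bijOn_translate (reduce p1 n x)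
  have hr : ∀ i : Fin (p1 ^ n), reduce p1 n (x + (i : ℕ) * p2)
      = reduce p1 n x + (i : ℕ) * (p2 : ZMod (p1 ^ n)) := fun i => by simp
  rw [translateSum, ← Fin.sum_univ_eq_sum_range (fun i => E (x + (i : ℕ) * p2) y)]
  rw [Finset.sum_congr rfl fun i _ => hE.apply_eq _ _, Finset.sum_add_distrib]
  congr 1
  · simp_rw [hr]
    exact hb.sum_comp fun k => offKernel p1 p2 n E k y
  · rw [Finset.sum_eq_single i0, if_pos hi]
    · intro i _ hne
      rw [if_neg]
      intro h
      exact hne (hb.1 (by simp only []; rw [← hr, ← hr, h, hi]))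
    · simp

theorem translateSum_embed (hE : FrobeniusInvariant p1 p2 n p E) (k : ZMod p1) (y : ZMod p2) :
    translateSum p1 p2 n E (embed p1 n k) y
      = ∑ k, offKernel p1 p2 n E k y + E (embed p1 n k) y := by
  have := hE.translateSum_eq (x := embed p1 n k)
    (i0 := ⟨0, pow_pos (Fact.out : p1.Prime).pos n⟩)
    (by simpa using (reduce_eq_zero_iff p1 n _).2 ⟨k, rfl⟩) y
  simpa using this

theorem exists_translateSum_eq (hE : FrobeniusInvariant p1 p2 n p E) (x : ZMod (p1 ^ (n + 1)))
    (y : ZMod p2) :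
    ∃ k, translateSum p1 p2 n E x y = translateSum p1 p2 n E (embed p1 n k) y := by
  obtain ⟨i0, hi⟩ := (hE.bijOn_translate (reduce p1 n x)).2 0
  have hi' : reduce p1 n (x + (i0 : ℕ) * p2) = 0 := by simpa using hi
  obtain ⟨k, hk⟩ := (reduce_eq_zero_iff p1 n _).1 hi'
  exact ⟨k, by rw [hE.translateSum_embed, hE.translateSum_eq hi', hk]⟩

theorem sum_apply (hE : FrobeniusInvariant p1 p2 n p E) (y : ZMod p2) :
    ∑ x, E x y = ∑ k, translateSum p1 p2 n E (embed p1 n k) y := by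
  rw [Finset.sum_congr rfl fun x _ => hE.apply_eq x y, Finset.sum_add_distrib,
    sum_comp_reduce p1 n fun k => offKernel p1 p2 n E k y, ← Finset.sum_filter, sum_ker_reduce]
  simp_rw [hE.translateSum_embed, Finset.sum_add_distrib]
  simp [ZMod.card]

theorem apply_embed_frob_pow (hE : FrobeniusInvariant p1 p2 n p E) (j : ℕ) (k : ZMod p1)
    (y : ZMod p2) : E (embed p1 n ((p : ZMod p1) ^ j * k)) ((p : ZMod p2) ^ j * y)
      = E (embed p1 n k) y := by
  rw [← Nat.cast_pow (α := ZMod p1) p j, embed_natCast_mul, Nat.cast_pow, hE.frob_pow]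

theorem apply_embed_zero (hE : FrobeniusInvariant p1 p2 n p E) {k : ZMod p1} (hk : k ≠ 0) :
    E (embed p1 n k) 0 = E (embed p1 n 1) 0 := by
  obtain ⟨j, rfl⟩ := hE.gen1' k hk
  simpa using hE.apply_embed_frob_pow j 1 0

theorem apply_zero_left (hE : FrobeniusInvariant p1 p2 n p E) {y : ZMod p2} (hy : y ≠ 0) :
    E (embed p1 n 0) y = E (embed p1 n 0) 1 := by
  obtain ⟨j, rfl⟩ := hE.gen2 y hy
  simpa using hE.apply_embed_frob_pow j 0 1

theorem apply_one_pow_even (hE : FrobeniusInvariant p1 p2 n p E) (i : ℕ) (y : ZMod p2) :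
    E (embed p1 n 1) ((p : ZMod p2) ^ (2 * i) * y) = E (embed p1 n 1) y := by
  have hu : IsUnit (p : ZMod p2) := (ZMod.isUnit_iff_coprime _ _).2 hE.cop2
  obtain ⟨v, hv⟩ := hu
  obtain ⟨j, h1, h2⟩ := hE.sq 1 (v ^ i)
  have := hE.frob_pow j (embed p1 n 1) y
  rwa [h1, h2, Units.val_one, one_pow, one_mul, Units.val_pow_eq_pow_val, hv, ← pow_mul,
    mul_comm i] at this

theorem two_mul_apply_embed (hE : FrobeniusInvariant p1 p2 n p E) {k : ZMod p1} {y : ZMod p2}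
    (hk : k ≠ 0) (hy : y ≠ 0) :
    2 * E (embed p1 n k) y = (E (embed p1 n 1) 1 + E (embed p1 n 1) p)
      + quadraticChar _ k * quadraticChar _ y * (E (embed p1 n 1) 1 - E (embed p1 n 1) p) := by
  have c1 := quadraticChar_eq_neg_one_of_generator hE.odd1 hE.gen1' hE.cop1
  have c2 := quadraticChar_eq_neg_one_of_generator hE.odd2 hE.gen2 hE.cop2
  have hu : IsUnit (p : ZMod p2) := (ZMod.isUnit_iff_coprime _ _).2 hE.cop2
  obtain ⟨v, hv⟩ := hu
  obtain ⟨j, rfl⟩ := hE.gen1' k hk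
  obtain ⟨i, hi⟩ := hE.gen2 ((v⁻¹ : (ZMod p2)ˣ) ^ j * y)
    (mul_ne_zero (pow_ne_zero _ (Units.ne_zero _)) hy)
  have hy' : y = (p : ZMod p2) ^ j * (p : ZMod p2) ^ i := by
    rw [← hi, ← hv, ← mul_assoc, ← mul_pow, Units.mul_inv, one_pow, one_mul]
  have h3 := hE.apply_embed_frob_pow j 1 ((p : ZMod p2) ^ i)
  rw [mul_one, ← hy'] at h3
  rw [h3, hy', map_mul, map_pow, map_pow, map_pow, c1, c2, ← mul_assoc, ← mul_pow]
  rw [neg_one_mul, neg_neg, one_pow, one_mul]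
  rcases Nat.even_or_odd' i with ⟨i', rfl | rfl⟩
  · have := hE.apply_one_pow_even i' 1
    rw [mul_one] at this
    rw [this, (even_two_mul i').neg_one_pow]
    ring
  · have := hE.apply_one_pow_even i' p
    rw [← pow_succ] at this
    rw [this, (odd_two_mul_add_one i').neg_one_pow]
    ring

end FrobeniusInvariant

/-- Double character sum of a function taking constant values on the four coordinate strata up to
a product of quadratic characters on the open one. -/
theorem sum_stratified {r s : ℕ} [Fact r.Prime] [Fact s.Prime] (K : ZMod r → ZMod s → ℂ)
    (a00 a10 a01 A D : ℂ) (h00 : K 0 0 = a00) (h10 : ∀ k ≠ 0, K k 0 = a10)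
    (h01 : ∀ y ≠ 0, K 0 y = a01)
    (h11 : ∀ k ≠ 0, ∀ y ≠ 0, K k y = A + quadraticChar _ k * quadraticChar _ y * D)
    (θ : AddChar (ZMod r) ℂ) (η : AddChar (ZMod s) ℂ) :
    ∑ y, η y * ∑ k, θ k * K k y = a00 + ((∑ k, θ k) - 1) * a10 + ((∑ y, η y) - 1) * a01
      + ((∑ k, θ k) - 1) * ((∑ y, η y) - 1) * A
      + (∑ k, (quadraticChar _ k : ℂ) * θ k) * (∑ y, (quadraticChar _ y : ℂ) * η y) * D := by
  have hδ1 : ∑ k, θ k * (if k = 0 then 1 else 0) = 1 := by simp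
  have hδ2 : ∑ y, η y * (if y = 0 then 1 else 0) = 1 := by simp
  have hK : ∀ k y, K k y = (a00 - a10 - a01 + A) * ((if k = 0 then 1 else 0) *
      (if y = 0 then 1 else 0)) + (a10 - A) * (if y = 0 then 1 else 0)
      + (a01 - A) * (if k = 0 then 1 else 0) + A
      + quadraticChar _ k * quadraticChar _ y * D := by
    intro k y
    by_cases hk : k = 0 <;> by_cases hy : y = 0
    · subst hk hy
      simp only [h00, if_true, MulChar.map_zero, Int.cast_zero]
      ring
    · subst hk; simp [hy, h01 y hy]
    · subst hy; simp [hk, h10 k hk]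
    · simp [hk, hy, h11 k hk y hy]
  have hin : ∀ y, ∑ k, θ k * K k y = (a00 - a10 - a01 + A) * (if y = 0 then 1 else 0)
      + (a10 - A) * (∑ k, θ k) * (if y = 0 then 1 else 0) + (a01 - A) + A * (∑ k, θ k)
      + (∑ k, (quadraticChar _ k : ℂ) * θ k) * D * quadraticChar _ y := by
    intro y
    have : ∀ k, θ k * K k y = ((a00 - a10 - a01 + A) * (if y = 0 then 1 else 0) + (a01 - A)) *
        (θ k * (if k = 0 then 1 else 0)) + ((a10 - A) * (if y = 0 then 1 else 0) + A) * θ k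
        + (D * quadraticChar _ y) * ((quadraticChar _ k : ℂ) * θ k) := by
      intro k
      rw [hK]
      ring
    rw [Finset.sum_congr rfl fun k _ => this k]
    simp_rw [Finset.sum_add_distrib, ← Finset.mul_sum, hδ1]
    ring
  have hout : ∀ y, η y * ∑ k, θ k * K k y
      = ((a00 - a10 - a01 + A) + (a10 - A) * (∑ k, θ k)) * (η y * (if y = 0 then 1 else 0))
      + ((a01 - A) + A * (∑ k, θ k)) * η y
      + (∑ k, (quadraticChar _ k : ℂ) * θ k) * D * ((quadraticChar _ y : ℂ) * η y) := by
    intro y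
    rw [hin]
    ring
  rw [Finset.sum_congr rfl fun y _ => hout y]
  simp_rw [Finset.sum_add_distrib, ← Finset.mul_sum, hδ2]
  ring

namespace FrobeniusInvariant

variable {p1 p2 n p : ℕ} [Fact p1.Prime] [Fact p2.Prime]
  {E : ZMod (p1 ^ (n + 1)) → ZMod p2 → ℤ}

/-- Over the values of `translateSum`, only five orbit representatives occur. -/
theorem translateSum_strata (hE : FrobeniusInvariant p1 p2 n p E) :
    (∀ k ≠ 0, translateSum p1 p2 n E (embed p1 n k) 0
      = translateSum p1 p2 n E (embed p1 n 1) 0) ∧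
    (∀ y ≠ 0, translateSum p1 p2 n E (embed p1 n 0) y
      = translateSum p1 p2 n E (embed p1 n 0) 1) ∧
    ∀ k ≠ 0, ∀ y ≠ 0, 2 * translateSum p1 p2 n E (embed p1 n k) y
      = (translateSum p1 p2 n E (embed p1 n 1) 1 + translateSum p1 p2 n E (embed p1 n 1) p)
        + quadraticChar _ k * quadraticChar _ y *
        (translateSum p1 p2 n E (embed p1 n 1) 1 - translateSum p1 p2 n E (embed p1 n 1) p) := by
  have hp0 : (p : ZMod p2) ≠ 0 := by
    rw [Ne, ZMod.natCast_eq_zero_iff, ← Nat.Prime.coprime_iff_not_dvd Fact.out]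
    exact hE.cop2.symm
  simp_rw [hE.translateSum_embed]
  refine ⟨fun k hk => by rw [hE.apply_embed_zero hk],
    fun y hy => by rw [hE.apply_zero_left hy, hE.sum_offKernel_eq hy], fun k hk y hy => ?_⟩
  rw [hE.sum_offKernel_eq hy, hE.sum_offKernel_eq hp0]
  linear_combination hE.two_mul_apply_embed hk hy

/-- The four character sums of `E` in terms of the five values of its translate sums. -/
theorem characterSums (hE : FrobeniusInvariant p1 p2 n p E)
    (θ : AddChar (ZMod (p1 ^ (n + 1))) ℂ) (hθ : θ (embed p1 n 1) ≠ 1)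
    (η : AddChar (ZMod p2) ℂ) (hη : η ≠ 1) {t00 t10 t01 tp tm : ℤ}
    (h00 : translateSum p1 p2 n E (embed p1 n 0) 0 = t00)
    (h10 : translateSum p1 p2 n E (embed p1 n 1) 0 = t10)
    (h01 : translateSum p1 p2 n E (embed p1 n 0) 1 = t01)
    (hp : translateSum p1 p2 n E (embed p1 n 1) 1 = tp)
    (hm : translateSum p1 p2 n E (embed p1 n 1) p = tm) :
    (2 * ∑ y, ∑ x, (E x y : ℂ) = 2 * t00 + 2 * (p1 - 1) * t10 + 2 * (p2 - 1) * t01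
      + (p1 - 1) * (p2 - 1) * (tp + tm)) ∧
    (2 * ∑ y, ∑ x, θ x * E x y = 2 * t00 - 2 * t10 + (p2 - 1) * (2 * t01 - (tp + tm))) ∧
    (2 * ∑ y, η y * ∑ x, (E x y : ℂ) = 2 * t00 + 2 * (p1 - 1) * t10 - 2 * t01
      - (p1 - 1) * (tp + tm)) ∧
    (2 * ∑ y, η y * ∑ x, θ x * E x y = 2 * t00 - 2 * t10 - 2 * t01 + (tp + tm)
      + (∑ k, (quadraticChar _ k : ℂ) * θ (embed p1 n k)) *
        (∑ y, (quadraticChar _ y : ℂ) * η y) * (tp - tm)) := by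
  have hq : ∀ (r : ℕ) [Fact r.Prime], r ≠ 2 → ∑ k, (quadraticChar (ZMod r) k : ℂ) = 0 := by
    intro r _ hr
    have := quadraticChar_sum_zero (F := ZMod r) (by rwa [ZMod.ringChar_zmod_n])
    exact_mod_cast this
  have hp0 : (p : ZMod p2) ≠ 0 := by
    rw [Ne, ZMod.natCast_eq_zero_iff, ← Nat.Prime.coprime_iff_not_dvd Fact.out]
    exact hE.cop2.symm
  obtain ⟨s10, s01, s11⟩ := hE.translateSum_strata
  have hθ' : θ.compAddMonoidHom (embed p1 n) ≠ 1 := by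
    intro h
    exact hθ (by simpa using DFunLike.congr_fun h 1)
  have sθ : ∑ k, θ (embed p1 n k) = 0 := AddChar.sum_eq_zero_of_ne_one hθ'
  have sη := AddChar.sum_eq_zero_of_ne_one hη
  have KT := sum_stratified (fun k y => (translateSum p1 p2 n E (embed p1 n k) y : ℂ))
    t00 t10 t01 ((tp + tm) / 2) ((tp - tm) / 2) (by simp only [h00])
    (fun k hk => by simp only [s10 k hk, h10]) (fun y hy => by simp only [s01 y hy, h01])
    (fun k hk y hy => by
      have := s11 k hk y hy
      rw [hp, hm] at this
      have := congrArg (Int.cast : ℤ → ℂ) this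
      push_cast at this
      linear_combination this / 2)
  obtain ⟨R0, hR0⟩ : ∃ R, ∑ k, offKernel p1 p2 n E k 0 = R := ⟨_, rfl⟩
  obtain ⟨R1, hR1⟩ : ∃ R, ∑ k, offKernel p1 p2 n E k 1 = R := ⟨_, rfl⟩
  rw [hE.translateSum_embed] at h00 h10 h01 hp hm
  rw [hE.sum_offKernel_eq hp0] at hm
  rw [hR0] at h00 h10
  rw [hR1] at h01 hp hm
  have KE := sum_stratified (fun k y => (E (embed p1 n k) y : ℂ))
    (t00 - R0) (t10 - R0) (t01 - R1) ((tp + tm) / 2 - R1) ((tp - tm) / 2)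
    (by simp [← h00])
    (fun k hk => by rw [hE.apply_embed_zero hk]; simp [← h10])
    (fun y hy => by rw [hE.apply_zero_left hy]; simp [← h01])
    (fun k hk y hy => by
      have := congrArg (Int.cast : ℤ → ℂ) (hE.two_mul_apply_embed hk hy)
      rw [← hp, ← hm]
      push_cast at this ⊢
      linear_combination this / 2)
  have c0 := KT 1 1
  have c1 := KE (θ.compAddMonoidHom (embed p1 n)) 1
  have c2 := KT 1 η
  have c3 := KE (θ.compAddMonoidHom (embed p1 n)) η
  simp only [AddChar.one_apply, one_mul, mul_one, sθ, sη, hq p1 hE.odd1, hq p2 hE.odd2,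
    Finset.sum_const, Finset.card_univ, ZMod.card, nsmul_eq_mul,
    AddChar.compAddMonoidHom_apply] at c0 c1 c2 c3
  have e1 : ∀ y, ∑ x, (E x y : ℂ) = ∑ k, (translateSum p1 p2 n E (embed p1 n k) y : ℂ) := by
    intro y
    exact_mod_cast hE.sum_apply y
  simp_rw [e1, hE.sum_addChar_mul θ hθ, c0, c1, c2, c3]
  refine ⟨by ring, by ring, by ring, by ring⟩

end FrobeniusInvariant

theorem two_valued_iff {p1 p2 P s b c ε t00 t10 t01 tp tm : ℤ} (hε : ε = 1 ∨ ε = -1)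
    (hp1 : 0 < p1) (hp2 : 0 < p2) (ho1 : Odd p1) (ho2 : Odd p2) (hP : 0 < P) (hs : 0 < s)
    (hc : c ≠ 0) (hcop : IsCoprime b P) (hbc : b ^ 2 + p1 * p2 * c ^ 2 = 4 * P ^ 2)
    (h1 : 2 * t00 - 2 * t10 + (p2 - 1) * (2 * t01 - (tp + tm)) = 2 * (ε * P * s))
    (h2 : 2 * t00 + 2 * (p1 - 1) * t10 - 2 * t01 - (p1 - 1) * (tp + tm) = -2 * (ε * P * s))
    (h3 : 2 * t00 - 2 * t10 - 2 * t01 + (tp + tm) = b * s)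
    (hD : tp - tm = c * s ∨ tp - tm = -(c * s)) :
    ((t00 = tp ∨ t00 = tm) ∧ (t10 = tp ∨ t10 = tm) ∧ (t01 = tp ∨ t01 = tm)) ↔
      ((b = 1 ∨ b = -1) ∧ (c = 1 ∨ c = -1) ∧ p1 = 2 * P + ε * b ∧ p2 = 2 * P - ε * b) := by
  have k01 : p2 * (2 * t01 - (tp + tm)) = s * (2 * ε * P - b) := by linear_combination h1 - h3
  have k10 : p1 * (2 * t10 - (tp + tm)) = s * (-(2 * ε * P + b)) := by
    linear_combination h2 - h3
  have k00 : 2 * t00 - (tp + tm) = b * s + (2 * t10 - (tp + tm)) + (2 * t01 - (tp + tm)) := by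
    linear_combination h3
  have key : ∀ t, (t = tp ∨ t = tm) ↔
      ∃ σ : ℤ, (σ = 1 ∨ σ = -1) ∧ 2 * t - (tp + tm) = σ * (c * s) := by
    intro t
    constructor
    · rintro (rfl | rfl) <;> rcases hD with hD | hD
      · exact ⟨1, by simp, by linear_combination hD⟩
      · exact ⟨-1, by simp, by linear_combination hD⟩
      · exact ⟨-1, by simp, by linear_combination -hD⟩
      · exact ⟨1, by simp, by linear_combination -hD⟩
    · rintro ⟨σ, rfl | rfl, h⟩ <;> rcases hD with hD | hD <;> first
        | (left; linarith) | (right; linarith)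
  rw [key, key, key]
  constructor
  · rintro ⟨⟨σ0, hσ0, e0⟩, ⟨σ1, hσ1, e1⟩, ⟨σ2, hσ2, e2⟩⟩
    rw [e1] at k10 k00
    rw [e2] at k01 k00
    rw [e0] at k00
    have l01 : p2 * (σ2 * c) = 2 * ε * P - b :=
      mul_left_cancel₀ hs.ne' (by linear_combination k01)
    have l10 : p1 * (σ1 * c) = -(2 * ε * P + b) :=
      mul_left_cancel₀ hs.ne' (by linear_combination k10)
    have l00 : σ0 * c = b + σ1 * c + σ2 * c :=
      mul_left_cancel₀ hs.ne' (by linear_combination k00)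
    have hε2 : ε ^ 2 = 1 := by rcases hε with rfl | rfl <;> norm_num
    have hprod : σ1 * σ2 = -1 := by
      have hne : p1 * p2 * c ^ 2 ≠ 0 := by positivity
      refine mul_left_cancel₀ hne ?_
      have : (p1 * (σ1 * c)) * (p2 * (σ2 * c)) = -(2 * ε * P + b) * (2 * ε * P - b) := by
        rw [l01, l10]
      linear_combination this + hbc - 4 * P ^ 2 * hε2
    have hσ : σ1 = -σ2 := by
      rcases hσ1 with rfl | rfl <;> rcases hσ2 with rfl | rfl <;> simp_all
    have hb : b = σ0 * c := by rw [hσ] at l00; linear_combination -l00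
    have hb2 : b ^ 2 = c ^ 2 := by rw [hb]; rcases hσ0 with rfl | rfl <;> ring
    have hdvd : b ^ 2 ∣ 4 := by
      have : b ^ 2 ∣ 4 * P ^ 2 := ⟨1 + p1 * p2, by rw [← hbc, ← hb2]; ring⟩
      exact (hcop.pow (m := 2) (n := 2)).dvd_of_dvd_mul_right this
    have hble : b ^ 2 ≤ 4 := Int.le_of_dvd (by norm_num) hdvd
    have hb0 : b ≠ 0 := by
      rintro rfl
      norm_num at hdvd
    have hbb : b = 1 ∨ b = -1 := by
      have u1 : b ≤ 2 := by nlinarith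
      have u2 : -2 ≤ b := by nlinarith
      have h4 : b ^ 2 ≠ 4 := by
        intro h4
        rw [← hb2, h4] at hbc
        have hPe : Even (P ^ 2) := by
          rw [show P ^ 2 = p1 * p2 + 1 by linarith]
          exact (ho1.mul ho2).add_one
        have hPe' : (2 : ℤ) ∣ P := ((Int.even_pow.1 hPe).1).two_dvd
        have hbe : (2 : ℤ) ∣ b := by
          refine Int.prime_two.dvd_of_dvd_pow (n := 2) ?_
          rw [h4]; norm_num
        have := hcop.isUnit_of_dvd' hbe hPe'
        exact Int.prime_two.not_isUnit this
      have : b = -2 ∨ b = -1 ∨ b = 0 ∨ b = 1 ∨ b = 2 := by omega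
      rcases this with h | h | h | h | h
      · exact absurd (by rw [h]; norm_num) h4
      · exact Or.inr h
      · exact absurd h hb0
      · exact Or.inl h
      · exact absurd (by rw [h]; norm_num) h4
    have hcc : c = 1 ∨ c = -1 := by
      have : c ^ 2 = 1 := by rw [← hb2]; rcases hbb with rfl | rfl <;> norm_num
      rcases mul_eq_zero.1 (show (c - 1) * (c + 1) = 0 by linear_combination this) with h | h <;>
        omega
    refine ⟨hbb, hcc, ?_⟩
    have hsum : 4 * ε * P = σ2 * c * (p1 + p2) := by
      rw [hσ] at l10; linear_combination -l01 + l10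
    have hτ : σ2 * c = ε := by
      have hτ1 : σ2 * c = 1 ∨ σ2 * c = -1 := by
        rcases hσ2 with rfl | rfl <;> rcases hcc with rfl | rfl <;> norm_num
      rcases hτ1 with h | h <;> rcases hε with rfl | rfl <;> rw [h] at hsum ⊢ <;> exfalso <;>
        linarith
    rw [hσ] at l10
    rw [hτ] at l01
    rw [neg_mul, hτ] at l10
    constructor
    · linear_combination (-ε) * l10 + (2 * P - p1) * hε2
    · linear_combination ε * l01 + (2 * P - p2) * hε2
  · rintro ⟨hb, hc1, r1, r2⟩
    have hε2 : ε ^ 2 = 1 := by rcases hε with rfl | rfl <;> norm_num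
    have l01 : 2 * t01 - (tp + tm) = s * ε :=
      mul_left_cancel₀ hp2.ne' (by rw [k01]; linear_combination (-s * ε) * r2 + s * b * hε2)
    have l10 : 2 * t10 - (tp + tm) = -s * ε :=
      mul_left_cancel₀ hp1.ne' (by rw [k10]; linear_combination (s * ε) * r1 + s * b * hε2)
    rw [l01, l10] at k00
    have fin : ∀ v : ℤ, (v = 1 ∨ v = -1) →
        ∃ σ : ℤ, (σ = 1 ∨ σ = -1) ∧ s * v = σ * (c * s) := by
      rintro v (rfl | rfl) <;> rcases hc1 with rfl | rfl
      · exact ⟨1, by simp, by ring⟩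
      · exact ⟨-1, by simp, by ring⟩
      · exact ⟨-1, by simp, by ring⟩
      · exact ⟨1, by simp, by ring⟩
    refine ⟨?_, ?_, ?_⟩
    · rw [k00]
      obtain ⟨σ, h, h'⟩ := fin b hb
      exact ⟨σ, h, by linear_combination h'⟩
    · rw [l10]
      obtain ⟨σ, h, h'⟩ := fin (-ε) (by rcases hε with rfl | rfl <;> norm_num)
      exact ⟨σ, h, by linear_combination h'⟩
    · rw [l01]
      exact fin ε hε

theorem isIntegral_addChar_apply {F : Type} [Field F] (p : ℕ) [Fact p.Prime] [Algebra (ZMod p) F] (ψ : AddChar F ℂ) (x : F) : IsIntegral ℤ (ψ x) := by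
  have : CharP F p := charP_of_injective_algebraMap (algebraMap (ZMod p) F).injective p
  refine IsIntegral.of_pow (Nat.Prime.pos (Fact.out : p.Prime)) (?_ : IsIntegral ℤ (ψ x ^ p))
  rw [← AddChar.map_nsmul_eq_pow, nsmul_eq_mul, CharP.cast_eq_zero, zero_mul,
    AddChar.map_zero_eq_one]
  exact isIntegral_one

section Period

variable {F B : Type} [Field F] [Fintype F]

/-- The Gaussian period of the fibre of `L` over `z`. -/
def period (ψ : AddChar F ℂ) (L : Fˣ → B) (z : B) : ℂ :=
  ∑ u : Fˣ, if L u = z then ψ u else 0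

theorem sum_mul_period [Fintype B] (ψ : AddChar F ℂ) (L : Fˣ → B) (g : B → ℂ) :
    ∑ z, g z * period ψ L z = ∑ u : Fˣ, g (L u) * ψ u := by
  simp_rw [period, Finset.mul_sum, mul_ite, mul_zero]
  rw [Finset.sum_comm]
  simp

theorem period_mul_inv {B : Type} [CommGroup B] (ψ : AddChar F ℂ) (L : Fˣ →* B) (z : B) (c : Fˣ) :
    ∑ u : Fˣ, (if L u = z then ψ (c * u) else 0) = period ψ L (L c * z) := by
  rw [period, ← Equiv.sum_comp (Equiv.mulLeft c) fun u : Fˣ => if L u = L c * z then ψ u else 0]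
  simp

variable {p : ℕ} [Fact p.Prime] [Algebra (ZMod p) F]

theorem exists_int_eq_period {B : Type} [CommGroup B] (ψ : AddChar F ℂ) (L : Fˣ →* B)
    (hL : ∀ t : (ZMod p)ˣ, L (Units.map (algebraMap (ZMod p) F) t) = 1) (z : B) :
    ∃ e : ℤ, period ψ L z = e := by
  have hp : p.Prime := Fact.out
  have hint : IsIntegral ℤ (period ψ L z) := by
    refine IsIntegral.sum _ fun u _ => ?_
    split_ifs
    · exact isIntegral_addChar_apply p ψ _
    · exact isIntegral_zero
  have hconst : ∀ t : (ZMod p)ˣ,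
      ∑ u : Fˣ, (if L u = z then ψ (algebraMap (ZMod p) F t * u) else 0) = period ψ L z := by
    intro t
    have := period_mul_inv ψ L z (Units.map (algebraMap (ZMod p) F) t)
    rwa [hL, one_mul] at this
  have hinner : ∀ u : Fˣ, ∃ k : ℤ,
      ∑ t : (ZMod p)ˣ, (if L u = z then ψ (algebraMap (ZMod p) F t * u) else 0) = k := by
    intro u
    by_cases hu : L u = z
    · simp only [hu, if_true]
      have h1 := AddChar.sum_eq_ite (ψ.compAddMonoidHom
        ((AddMonoidHom.mulRight (u : F)).comp (algebraMap (ZMod p) F).toAddMonoidHom))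
      have h2 : ∑ t : (ZMod p)ˣ, ψ (algebraMap (ZMod p) F t * u)
          = ∑ t : ZMod p, ψ (algebraMap (ZMod p) F t * u) - 1 := by
        rw [← Finset.sum_erase_add _ _ (Finset.mem_univ (0 : ZMod p))]
        simp only [map_zero, zero_mul, AddChar.map_zero_eq_one, add_sub_cancel_right]
        refine Finset.sum_bij (fun t _ => (t : ZMod p)) (by simp)
          (fun _ _ _ _ h => Units.ext h) (fun t ht => ?_) (by simp)
        exact ⟨Units.mk0 t (by simpa using ht), by simp⟩
      rw [h2]
      simp only [AddChar.compAddMonoidHom_apply, AddMonoidHom.comp_apply,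
        AddMonoidHom.mulRight_apply] at h1
      erw [h1]
      split_ifs
      · exact ⟨p - 1, by simp⟩
      · exact ⟨-1, by simp⟩
    · exact ⟨0, by simp [hu]⟩
  choose k hk using hinner
  have hmul : ((p - 1 : ℕ) : ℂ) * period ψ L z = (∑ u, k u : ℤ) := by
    have : ∑ t : (ZMod p)ˣ, ∑ u : Fˣ, (if L u = z then ψ (algebraMap (ZMod p) F t * u) else 0)
        = ((p - 1 : ℕ) : ℂ) * period ψ L z := by
      simp_rw [hconst]
      simp [ZMod.card_units_eq_totient, Nat.totient_prime hp]
    rw [← this, Finset.sum_comm]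
    simp_rw [hk]
    push_cast
    rfl
  have hp1 : ((p - 1 : ℕ) : ℂ) ≠ 0 := Nat.cast_ne_zero.2 (Nat.sub_pos_of_lt hp.one_lt).ne'
  have hrat : period ψ L z = algebraMap ℚ ℂ ((∑ u, k u : ℤ) / (p - 1 : ℕ)) := by
    rw [map_div₀]
    simp only [map_intCast, map_natCast]
    rw [eq_div_iff hp1, mul_comm, hmul]
  rw [hrat] at hint
  rw [isIntegral_algebraMap_iff (algebraMap ℚ ℂ).injective] at hint
  obtain ⟨e, he⟩ := IsIntegrallyClosed.isIntegral_iff.1 hint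
  exact ⟨e, by rw [hrat, ← he]; simp⟩

theorem period_pow_char {B : Type} [CommGroup B] (ψ : AddChar F ℂ) (hψ : ∀ x, ψ (x ^ p) = ψ x)
    (L : Fˣ →* B) (hB : Function.Injective fun z : B => z ^ p) (z : B) :
    period ψ L (z ^ p) = period ψ L z := by
  have : CharP F p := charP_of_injective_algebraMap (algebraMap (ZMod p) F).injective p
  have hinj : Function.Injective fun u : Fˣ => u ^ p := by
    intro u v h
    refine Units.ext (frobenius_inj F p ?_)
    simpa [frobenius_def] using congrArg (Units.val) h
  rw [period, period, ← Function.Bijective.sum_comp (Finite.injective_iff_bijective.1 hinj)]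
  refine Finset.sum_congr rfl fun u _ => ?_
  simp only [map_pow, Units.val_pow_eq_pow_val, hψ, hB.eq_iff]

end Period

/-- The canonical additive character of a finite field of characteristic `p`. -/
def traceChar (p : ℕ) [Fact p.Prime] (F : Type) [Field F] [Algebra (ZMod p) F] : AddChar F ℂ :=
  ZMod.stdAddChar.compAddMonoidHom (Algebra.trace (ZMod p) F).toAddMonoidHom

section TraceChar

variable (p : ℕ) [Fact p.Prime] {F : Type} [Field F] [Algebra (ZMod p) F]

theorem traceChar_apply (x : F) : traceChar p F x = Complex.exp (2 * (Real.pi : ℂ) * Complex.I *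
    ((Algebra.trace (ZMod p) F x).val : ℂ) / (p : ℂ)) := by
  have := ZMod.stdAddChar_coe (N := p) ((Algebra.trace (ZMod p) F x).val : ℤ)
  simpa [traceChar] using this

variable [Fintype F]

theorem traceChar_isPrimitive : (traceChar p F).IsPrimitive := by
  refine AddChar.IsPrimitive.of_ne_one fun h => ?_
  obtain ⟨x, hx⟩ := Algebra.trace_surjective (ZMod p) F 1
  have h1 := DFunLike.congr_fun h x
  have h2 : ZMod.stdAddChar (N := p) 1 = ZMod.stdAddChar (N := p) 0 := by
    rw [← hx]
    simpa [traceChar] using h1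
  exact one_ne_zero (ZMod.injective_stdAddChar h2)

theorem traceChar_pow_char (x : F) : traceChar p F (x ^ p) = traceChar p F x := by
  have := Algebra.trace_eq_of_algEquiv (FiniteField.frobeniusAlgEquivOfAlgebraic (ZMod p) F) x
  simp only [FiniteField.coe_frobeniusAlgEquivOfAlgebraic, ZMod.card] at this
  simp [traceChar, this]

end TraceChar

section Residues

theorem exists_pow_eq_of_orderOf {M p : ℕ} [NeZero M] (hc : p.Coprime M)
    (h : orderOf (p : ZMod M) = M.totient) (u : (ZMod M)ˣ) :
    ∃ j : ℕ, (u : ZMod M) = (p : ZMod M) ^ j := by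
  have ho : orderOf (ZMod.unitOfCoprime p hc) = Nat.card (ZMod M)ˣ := by
    rw [← orderOf_units, ZMod.coe_unitOfCoprime, h, Nat.card_eq_fintype_card,
      ZMod.card_units_eq_totient]
  have hu : u ∈ Submonoid.powers (ZMod.unitOfCoprime p hc) := by
    rw [mem_powers_iff_mem_zpowers]
    rw [Subgroup.eq_top_of_card_eq (Subgroup.zpowers (ZMod.unitOfCoprime p hc))
      (by rw [Nat.card_zpowers, ho])]
    trivial
  obtain ⟨j, rfl⟩ := hu
  exact ⟨j, by simp⟩

theorem exists_pow_eq_sq_of_orderOf {M p : ℕ} [NeZero M] (hc : p.Coprime M)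
    (h : 2 * orderOf (p : ZMod M) = M.totient) (u : (ZMod M)ˣ) :
    ∃ j : ℕ, (p : ZMod M) ^ j = (u : ZMod M) ^ 2 := by
  have hi : (Subgroup.zpowers (ZMod.unitOfCoprime p hc)).index = 2 := by
    have h1 := (Subgroup.zpowers (ZMod.unitOfCoprime p hc)).card_mul_index
    rw [Nat.card_zpowers, ← orderOf_units, ZMod.coe_unitOfCoprime, Nat.card_eq_fintype_card,
      ZMod.card_units_eq_totient, ← h, mul_comm] at h1
    refine Nat.eq_of_mul_eq_mul_right ?_ h1
    have := Nat.totient_pos.2 (NeZero.pos M)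
    omega
  have hu := Subgroup.sq_mem_of_index_two hi u
  rw [← mem_powers_iff_mem_zpowers] at hu
  obtain ⟨j, hj⟩ := hu
  refine ⟨j, ?_⟩
  have := congrArg Units.val hj
  simpa using this

theorem exists_pow_eq_sq_prod {M M' p : ℕ} [NeZero M] [NeZero M'] (hcop : M.Coprime M')
    (hc : p.Coprime (M * M')) (h : 2 * orderOf (p : ZMod (M * M')) = (M * M').totient)
    (u : (ZMod M)ˣ) (v : (ZMod M')ˣ) :
    ∃ j : ℕ, (p : ZMod M) ^ j = (u : ZMod M) ^ 2 ∧ (p : ZMod M') ^ j = (v : ZMod M') ^ 2 := by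
  obtain ⟨j, hj⟩ := exists_pow_eq_sq_of_orderOf hc h
    (Units.map (ZMod.chineseRemainder hcop).symm (MulEquiv.prodUnits.symm (u, v)))
  have := congrArg (ZMod.chineseRemainder hcop) hj
  simp only [map_pow, map_natCast, Units.coe_map, MonoidHom.coe_coe,
    RingEquiv.apply_symm_apply] at this
  rw [show ((MulEquiv.prodUnits.symm (u, v) : (ZMod M × ZMod M')ˣ) : ZMod M × ZMod M')
    = ((u : ZMod M), (v : ZMod M')) from rfl] at this
  exact ⟨j, by simpa using congrArg Prod.fst this, by simpa using congrArg Prod.snd this⟩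

theorem pow_half_eq_neg_one {r p : ℕ} [Fact r.Prime] (hr : r ≠ 2)
    (hgen : ∀ y : ZMod r, y ≠ 0 → ∃ j : ℕ, y = (p : ZMod r) ^ j) (hcop : p.Coprime r) :
    (p : ZMod r) ^ ((r - 1) / 2) = -1 := by
  have h := quadraticChar_eq_pow_of_char_ne_two' (F := ZMod r)
    (by rwa [ZMod.ringChar_zmod_n]) (p : ZMod r)
  rw [quadraticChar_eq_neg_one_of_generator hr hgen hcop, ZMod.card] at h
  have ho : Odd r := (Fact.out : r.Prime).odd_of_ne_two hr
  rw [show (r - 1) / 2 = r / 2 by obtain ⟨k, rfl⟩ := ho; omega, ← h]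
  simp

/-- The sign of a square root of `Q ^ 2` is determined by its residue modulo an odd number. -/
theorem eq_neg_mul_of_zmod {r : ℕ} (hr : 2 < r) {G Q σ : ℤ} (hσ : σ = 1 ∨ σ = -1)
    (hG : G ^ 2 = Q ^ 2) (hQ : (Q : ZMod r) = σ) (h : (G : ZMod r) = -1) : G = -σ * Q := by
  have h2 : (2 : ZMod r) ≠ 0 := by
    intro h
    have := (ZMod.natCast_eq_zero_iff 2 r).1 (by exact_mod_cast h)
    exact absurd (Nat.le_of_dvd two_pos this) (by omega)
  rcases sq_eq_sq_iff_eq_or_eq_neg.1 hG with rfl | rfl <;> rcases hσ with rfl | rfl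
  · exfalso
    rw [h] at hQ
    apply h2
    push_cast at hQ
    linear_combination -hQ
  · ring
  · ring
  · exfalso
    push_cast at h hQ
    apply h2
    linear_combination h + hQ

end Residues

section Logarithm

theorem pow_injective_of_coprime {M M' a : ℕ} (h : (M * M').Coprime a) :
    Function.Injective fun z : Multiplicative (ZMod M × ZMod M') => z ^ a := by
  have : (Nat.card (Multiplicative (ZMod M × ZMod M'))).Coprime a := by
    rwa [Nat.card_congr Multiplicative.toAdd, Nat.card_prod, Nat.card_zmod, Nat.card_zmod]
  exact (powCoprime this).injective

variable {F : Type} [Field F] {γ : Fˣ} {M M' : ℕ} {L : Fˣ →* Multiplicative (ZMod M × ZMod M')}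

theorem logHom_pow (hL : L γ = Multiplicative.ofAdd (1, 1)) (k : ℕ) :
    L (γ ^ k) = Multiplicative.ofAdd ((k : ZMod M), (k : ZMod M')) := by
  rw [map_pow, hL, ← ofAdd_nsmul]
  simp

theorem logHom_surjective [NeZero M] [NeZero M'] (hL : L γ = Multiplicative.ofAdd (1, 1))
    (hcop : M.Coprime M') (x : ZMod M) (y : ZMod M') :
    ∃ u, L u = Multiplicative.ofAdd (x, y) := by
  refine ⟨γ ^ (Nat.chineseRemainder hcop x.val y.val : ℕ), ?_⟩
  rw [logHom_pow hL]
  have h := (Nat.chineseRemainder hcop x.val y.val).2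
  have h1 := (ZMod.natCast_eq_natCast_iff _ _ _).2 h.1
  have h2 := (ZMod.natCast_eq_natCast_iff _ _ _).2 h.2
  rw [h1, h2]
  simp

theorem logHom_eq_one_of_pow {a : ℕ} (h : (M * M').Coprime a) {u : Fˣ} (hu : u ^ a = 1) :
    L u = 1 := by
  refine pow_injective_of_coprime h ?_
  simp only [← map_pow, hu, one_pow, map_one]

theorem logHom_neg (h : (M * M').Coprime 2) (u : Fˣ) : L (-u) = L u := by
  rw [← neg_one_mul, map_mul, logHom_eq_one_of_pow h (u := -1) (by simp), one_mul]

variable [Fintype F]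

theorem exists_pow_eq_of_orderOf_eq (hγ : orderOf γ = Fintype.card F - 1) (u : Fˣ) :
    ∃ k : ℕ, γ ^ k = u := by
  have hu : u ∈ Subgroup.zpowers γ := by
    rw [Subgroup.eq_top_of_card_eq (Subgroup.zpowers γ)
      (by rw [Nat.card_zpowers, hγ, Nat.card_eq_fintype_card, Fintype.card_units])]
    trivial
  rw [← mem_powers_iff_mem_zpowers] at hu
  exact hu

theorem exists_logHom (hγ : orderOf γ = Fintype.card F - 1)
    (hdvd : M * M' ∣ Fintype.card F - 1) :
    ∃ L : Fˣ →* Multiplicative (ZMod M × ZMod M'), L γ = Multiplicative.ofAdd (1, 1) := by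
  have hg : ∀ u : Fˣ, u ∈ Subgroup.zpowers γ := fun u => by
    obtain ⟨k, rfl⟩ := exists_pow_eq_of_orderOf_eq hγ u
    exact Subgroup.pow_mem _ (Subgroup.mem_zpowers γ) k
  have ho : orderOf (Multiplicative.ofAdd ((1, 1) : ZMod M × ZMod M')) ∣ orderOf γ := by
    rw [orderOf_dvd_iff_pow_eq_one, hγ, ← ofAdd_nsmul, ofAdd_eq_one]
    have h1 : ((Fintype.card F - 1 : ℕ) : ZMod M) = 0 :=
      (ZMod.natCast_eq_zero_iff _ _).2 ((dvd_mul_right _ _).trans hdvd)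
    have h2 : ((Fintype.card F - 1 : ℕ) : ZMod M') = 0 :=
      (ZMod.natCast_eq_zero_iff _ _).2 ((dvd_mul_left _ _).trans hdvd)
    ext <;> simp [h1, h2]
  exact ⟨monoidHomOfForallMemZpowers hg ho, monoidHomOfForallMemZpowers_apply_gen hg ho⟩

theorem exists_eq_pow_iff (hγ : orderOf γ = Fintype.card F - 1)
    (hdvd : M * M' ∣ Fintype.card F - 1) (hcop : M.Coprime M')
    (hL : L γ = Multiplicative.ofAdd (1, 1)) (u : Fˣ) (i : ℕ) :
    (∃ t : ℕ, (u : F) = (γ : F) ^ (i * M' + M * M' * t)) ↔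
      L u = Multiplicative.ofAdd ((i : ZMod M) * M', 0) := by
  constructor
  · rintro ⟨t, ht⟩
    have : u = γ ^ (i * M' + M * M' * t) := Units.ext (by simpa using ht)
    rw [this, logHom_pow hL]
    simp
  · intro h
    obtain ⟨k, rfl⟩ := exists_pow_eq_of_orderOf_eq hγ u
    rw [logHom_pow hL, Multiplicative.ofAdd.injective.eq_iff, Prod.mk.injEq] at h
    have h1 : k ≡ i * M' [MOD M] := (ZMod.natCast_eq_natCast_iff _ _ _).1 (by simpa using h.1)
    have h2 : k ≡ i * M' [MOD M'] := (ZMod.natCast_eq_natCast_iff _ _ _).1 (by simpa using h.2)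
    have h3 : k ≡ i * M' [MOD M * M'] := (Nat.modEq_and_modEq_iff_modEq_mul hcop).1 ⟨h1, h2⟩
    have h4 : k + (Fintype.card F - 1) * (i * M') ≡ i * M' [MOD M * M'] := by
      have := (Nat.modEq_zero_iff_dvd.2 (hdvd.mul_right (i * M')))
      simpa using h3.add this
    have hpos : 0 < Fintype.card F - 1 := Nat.sub_pos_of_lt Fintype.one_lt_card
    have hle : i * M' ≤ k + (Fintype.card F - 1) * (i * M') :=
      (Nat.le_mul_of_pos_left _ hpos).trans (Nat.le_add_left _ _)
    obtain ⟨t, ht⟩ := (Nat.modEq_iff_dvd' hle).1 h4.symm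
    refine ⟨t, ?_⟩
    rw [← ht, Nat.add_sub_cancel' hle, Units.val_pow_eq_pow_val, pow_add, pow_mul, ← hγ,
      ← Units.val_pow_eq_pow_val γ (orderOf γ), pow_orderOf_eq_one]
    simp

end Logarithm

section GaussSums

variable {F : Type} [Field F] [Fintype F]

theorem sum_units_eq (f : F → ℂ) : ∑ u : Fˣ, f u = ∑ x, f x - f 0 := by
  rw [← Finset.sum_erase_add _ _ (Finset.mem_univ (0 : F)), add_sub_cancel_right]
  refine Finset.sum_bij (fun u _ => (u : F)) (by simp)
    (fun _ _ _ _ h => Units.ext h) (fun t ht => ?_) (by simp)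
  exact ⟨Units.mk0 t (by simpa using ht), by simp⟩

theorem gaussSum_mul_star {χ : MulChar F ℂ} (hχ : χ ≠ 1) {ψ : AddChar F ℂ} (hψ : ψ.IsPrimitive) :
    gaussSum χ ψ * star (gaussSum χ ψ) = Fintype.card F := by
  rw [star_gaussSum_eq, gaussSum_mul_gaussSum_eq_card hχ hψ]

variable {γ : Fˣ} {M M' : ℕ} [NeZero M] [NeZero M']
  {L : Fˣ →* Multiplicative (ZMod M × ZMod M')} {ψ : AddChar F ℂ} {E : ZMod M → ZMod M' → ℤ}

theorem gaussSum_eq_sum_period (hγ : orderOf γ = Fintype.card F - 1)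
    (hL : L γ = Multiplicative.ofAdd (1, 1))
    (hE : ∀ x y, period ψ L (Multiplicative.ofAdd (x, y)) = E x y) {χ : MulChar F ℂ}
    {θ : AddChar (ZMod M) ℂ} {η : AddChar (ZMod M') ℂ} (hχ : χ γ = θ 1 * η 1) :
    gaussSum χ ψ = ∑ y, η y * ∑ x, θ x * E x y := by
  have hval : ∀ u : Fˣ, χ u = θ (L u).toAdd.1 * η (L u).toAdd.2 := by
    intro u
    obtain ⟨k, rfl⟩ := exists_pow_eq_of_orderOf_eq hγ u
    rw [logHom_pow hL, Units.val_pow_eq_pow_val, map_pow, hχ, mul_pow,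
      ← AddChar.map_nsmul_eq_pow, ← AddChar.map_nsmul_eq_pow]
    simp
  have h1 : gaussSum χ ψ = ∑ u : Fˣ, χ u * ψ u := by
    rw [sum_units_eq fun x => χ x * ψ x]
    simp [gaussSum, MulChar.map_zero]
  rw [h1]
  simp_rw [hval]
  rw [← sum_mul_period ψ L fun z => θ z.toAdd.1 * η z.toAdd.2,
    ← Equiv.sum_comp Multiplicative.ofAdd, Fintype.sum_prod_type_right]
  simp only [toAdd_ofAdd, hE, Finset.mul_sum]
  exact Finset.sum_congr rfl fun y _ => Finset.sum_congr rfl fun x _ => by ring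

theorem sum_period_eq_neg_one (hψ : ψ.IsPrimitive)
    (hE : ∀ x y, period ψ L (Multiplicative.ofAdd (x, y)) = E x y) :
    ∑ y, ∑ x, E x y = -1 := by
  have h1 : ∑ u : Fˣ, ψ u = -1 := by
    rw [sum_units_eq, AddChar.sum_eq_zero_of_ne_one (by simpa using hψ one_ne_zero), AddChar.map_zero_eq_one, zero_sub]
  have h2 := sum_mul_period ψ L fun _ => 1
  simp only [one_mul, h1] at h2
  rw [← Equiv.sum_comp Multiplicative.ofAdd, Fintype.sum_prod_type_right] at h2
  simp only [hE] at h2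
  exact_mod_cast h2

variable {p1 p2 n p : ℕ} [Fact p1.Prime] [Fact p2.Prime]
  {L : Fˣ →* Multiplicative (ZMod (p1 ^ (n + 1)) × ZMod p2)}
  {E : ZMod (p1 ^ (n + 1)) → ZMod p2 → ℤ}

theorem sum_connectionSet_eq_translateSum
    (hE : ∀ x y, period ψ L (Multiplicative.ofAdd (x, y)) = E x y) (hne : p1 ≠ p2) {D : Set F}
    (h0 : (0 : F) ∉ D) (hD : ∀ u : Fˣ, (u : F) ∈ D ↔ ∃ i < p1 ^ n,
      L u = Multiplicative.ofAdd ((i : ZMod (p1 ^ (n + 1))) * p2, 0))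
    {w : Fˣ} {x : ZMod (p1 ^ (n + 1))} {y : ZMod p2} (hw : L w = Multiplicative.ofAdd (x, y)) :
    ∑ z ∈ D.toFinset, ψ (w * z) = translateSum p1 p2 n E x y := by
  have h1 : ∑ z ∈ D.toFinset, ψ (w * z) = ∑ u : Fˣ, if (u : F) ∈ D then ψ (w * u) else 0 := by
    rw [sum_units_eq fun z => if z ∈ D then ψ (w * z) else 0, if_neg h0, sub_zero,
      ← Finset.sum_filter]
    refine Finset.sum_congr ?_ fun _ _ => rfl
    ext; simp
  have hunit : IsUnit (p2 : ZMod (p1 ^ (n + 1))) := by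
    rw [ZMod.isUnit_iff_coprime]
    exact ((Nat.coprime_primes Fact.out Fact.out).2 hne.symm).pow_right _
  have h2 : ∀ u : Fˣ, (if (u : F) ∈ D then ψ (w * u) else 0) = ∑ i ∈ Finset.range (p1 ^ n),
      if L u = Multiplicative.ofAdd ((i : ZMod (p1 ^ (n + 1))) * p2, 0)
        then ψ (w * u) else 0 := by
    intro u
    split_ifs with h
    · obtain ⟨i, hi, hu⟩ := (hD u).1 h
      rw [Finset.sum_eq_single_of_mem i (Finset.mem_range.2 hi), if_pos hu]
      intro j hj hji
      rw [if_neg]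
      intro hj'
      rw [hu, Multiplicative.ofAdd.injective.eq_iff, Prod.mk.injEq] at hj'
      have := hunit.mul_right_cancel hj'.1
      rw [ZMod.natCast_eq_natCast_iff'] at this
      have hle : p1 ^ n ≤ p1 ^ (n + 1) := Nat.pow_le_pow_right (Fact.out : p1.Prime).pos n.le_succ
      rw [Nat.mod_eq_of_lt (hi.trans_le hle),
        Nat.mod_eq_of_lt ((Finset.mem_range.1 hj).trans_le hle)] at this
      exact hji this.symm
    · refine (Finset.sum_eq_zero fun i hi => if_neg fun hu => h ?_).symm
      exact (hD u).2 ⟨i, Finset.mem_range.1 hi, hu⟩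
  rw [h1, Finset.sum_congr rfl fun u _ => h2 u, Finset.sum_comm, translateSum, Int.cast_sum]
  refine Finset.sum_congr rfl fun i _ => ?_
  rw [← hE, ← add_zero y, ← Prod.mk_add_mk, ofAdd_add, ← hw, ← period_mul_inv]
  congr!

theorem frobeniusInvariant_period [Fact p.Prime] [Algebra (ZMod p) F]
    (hψ : ∀ x, ψ (x ^ p) = ψ x)
    (hE : ∀ x y, period ψ L (Multiplicative.ofAdd (x, y)) = E x y)
    (h1 : p1 ≠ 2) (h2 : p2 ≠ 2) (hne : p1 ≠ p2) (hcop : p.Coprime (p1 ^ (n + 1) * p2))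
    (hord1 : orderOf (p : ZMod (p1 ^ (n + 1))) = (p1 ^ (n + 1)).totient)
    (hord2 : orderOf (p : ZMod p2) = p2.totient)
    (hord : 2 * orderOf (p : ZMod (p1 ^ (n + 1) * p2)) = (p1 ^ (n + 1) * p2).totient) :
    FrobeniusInvariant p1 p2 n p E where
  odd1 := h1
  odd2 := h2
  ne := hne
  cop1 := (hcop.coprime_mul_right_right).coprime_dvd_right (dvd_pow_self p1 n.succ_ne_zero)
  cop2 := hcop.coprime_mul_left_right
  frob x y := by
    have := period_pow_char ψ hψ L (pow_injective_of_coprime hcop.symm) (Multiplicative.ofAdd (x, y))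
    rw [← ofAdd_nsmul, Prod.smul_mk, nsmul_eq_mul, nsmul_eq_mul, hE, hE] at this
    exact_mod_cast this
  gen1 := exists_pow_eq_of_orderOf hcop.coprime_mul_right_right hord1
  gen2 y hy := exists_pow_eq_of_orderOf hcop.coprime_mul_left_right hord2 (Units.mk0 y hy)
  sq := exists_pow_eq_sq_prod
    (((Nat.coprime_primes Fact.out Fact.out).2 hne).pow_left _) hcop hord

end GaussSums

section QuadraticGaussSum

theorem sq_sum_quadraticChar_mul {r : ℕ} [Fact r.Prime] (hr : r ≠ 2) {η : AddChar (ZMod r) ℂ}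
    (hη : η ≠ 1) :
    (∑ y, (quadraticChar (ZMod r) y : ℂ) * η y) ^ 2 = (ZMod.χ₄ r : ℤ) * (r : ℂ) := by
  have hr' : ringChar (ZMod r) ≠ 2 := by rwa [ZMod.ringChar_zmod_n]
  have h := gaussSum_sq (χ := (quadraticChar (ZMod r)).ringHomComp (Int.castRingHom ℂ))
    ((MulChar.ringHomComp_ne_one_iff (Int.cast_injective)).2 (quadraticChar_ne_one hr'))
    ((quadraticChar_isQuadratic (ZMod r)).comp _) (AddChar.IsPrimitive.of_ne_one hη)
  rw [MulChar.ringHomComp_apply, quadraticChar_neg_one hr', ZMod.card] at h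
  simpa [gaussSum] using h

theorem eq_of_sq_eq_neg {a : ℝ} (ha : 0 ≤ a) {g : ℂ} (hg : g ^ 2 = -a) :
    g = Complex.I * Real.sqrt a ∨ g = -(Complex.I * Real.sqrt a) := by
  rw [← sq_eq_sq_iff_eq_or_eq_neg, hg, mul_pow, Complex.I_sq, ← Complex.ofReal_pow,
    Real.sq_sqrt ha]
  ring

end QuadraticGaussSum

namespace FrobeniusInvariant

variable {p1 p2 n p : ℕ} [Fact p1.Prime] [Fact p2.Prime]
  {E : ZMod (p1 ^ (n + 1)) → ZMod p2 → ℤ}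

/-- Membership of all translate sums in `{tp, tm}` as a quadratic relation. -/
theorem quadratic_iff (hE : FrobeniusInvariant p1 p2 n p E)
    {t00 t10 t01 tp tm : ℤ} (hne : tp ≠ tm)
    (h00 : translateSum p1 p2 n E (embed p1 n 0) 0 = t00)
    (h10 : translateSum p1 p2 n E (embed p1 n 1) 0 = t10)
    (h01 : translateSum p1 p2 n E (embed p1 n 0) 1 = t01)
    (hp : translateSum p1 p2 n E (embed p1 n 1) 1 = tp)
    (hm : translateSum p1 p2 n E (embed p1 n 1) p = tm) :
    (∃ α β : ℂ, ∀ x y, (translateSum p1 p2 n E x y : ℂ) ^ 2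
      = α * translateSum p1 p2 n E x y + β) ↔
      (t00 = tp ∨ t00 = tm) ∧ (t10 = tp ∨ t10 = tm) ∧ (t01 = tp ∨ t01 = tm) := by
  constructor
  · rintro ⟨α, β, h⟩
    have ep := h (embed p1 n 1) 1
    have em := h (embed p1 n 1) p
    rw [hp] at ep
    rw [hm] at em
    have hα : α = tp + tm := by
      have h1 : ((tp : ℂ) - tm) * (tp + tm - α) = 0 := by linear_combination ep - em
      rcases mul_eq_zero.1 h1 with h2 | h2
      · exact absurd (by exact_mod_cast sub_eq_zero.1 h2) hne
      · linear_combination -h2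
    have key : ∀ t : ℤ, (t : ℂ) ^ 2 = α * t + β → t = tp ∨ t = tm := by
      intro t ht
      have h1 : ((t : ℂ) - tp) * (t - tm) = 0 := by
        rw [hα] at ht ep
        linear_combination ht - ep
      rcases mul_eq_zero.1 h1 with h2 | h2
      · exact Or.inl (by exact_mod_cast sub_eq_zero.1 h2)
      · exact Or.inr (by exact_mod_cast sub_eq_zero.1 h2)
    exact ⟨key _ (h00 ▸ h _ _), key _ (h10 ▸ h _ _), key _ (h01 ▸ h _ _)⟩
  · rintro ⟨a00, a10, a01⟩
    refine ⟨tp + tm, -(tp * tm), fun x y => ?_⟩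
    obtain ⟨s10, s01, s11⟩ := hE.translateSum_strata
    have key : translateSum p1 p2 n E x y = tp ∨ translateSum p1 p2 n E x y = tm := by
      obtain ⟨k, hk⟩ := hE.exists_translateSum_eq x y
      rw [hk]
      by_cases hk0 : k = 0 <;> by_cases hy : y = 0
      · rwa [hk0, hy, h00]
      · rwa [hk0, s01 y hy, h01]
      · rwa [hy, s10 k hk0, h10]
      · have h := s11 k hk0 y hy
        rw [hp, hm] at h
        rcases quadraticChar_dichotomy hk0 with h1 | h1 <;>
          rcases quadraticChar_dichotomy hy with h2 | h2 <;> rw [h1, h2] at h <;> omega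
    rcases key with h | h <;> rw [h] <;> ring

/-- Residues of the square root of `p ^ f` when `2 * f = φ(p1^(n+1) * p2)`. -/
theorem half_order (hE : FrobeniusInvariant p1 p2 n p E) {f : ℕ}
    (hf : 2 * f = (p1 ^ (n + 1) * p2).totient) :
    ∃ f', f = 2 * f' ∧ (p : ZMod p1) ^ f' = (-1) ^ ((p2 - 1) / 2) ∧
      (p : ZMod p2) ^ f' = (-1) ^ ((p1 - 1) / 2) := by
  have hp1 : p1.Prime := Fact.out
  have hp2 : p2.Prime := Fact.out
  obtain ⟨a, ha⟩ := hp1.odd_of_ne_two hE.odd1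
  obtain ⟨b, hb⟩ := hp2.odd_of_ne_two hE.odd2
  have ea : (p1 - 1) / 2 = a := by omega
  have eb : (p2 - 1) / 2 = b := by omega
  have hodd : Odd (p1 ^ n) := (hp1.odd_of_ne_two hE.odd1).pow
  have r1 := pow_half_eq_neg_one hE.odd1 hE.gen1' hE.cop1
  have r2 := pow_half_eq_neg_one hE.odd2 hE.gen2 hE.cop2
  rw [ea] at r1 ⊢
  rw [eb] at r2 ⊢
  refine ⟨p1 ^ n * a * b, ?_, ?_, ?_⟩
  · rw [Nat.totient_mul (((Nat.coprime_primes hp1 hp2).2 hE.ne).pow_left _),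
      Nat.totient_prime_pow_succ hp1, Nat.totient_prime hp2] at hf
    rw [show p1 - 1 = 2 * a by omega, show p2 - 1 = 2 * b by omega] at hf
    linarith
  · rw [mul_comm (p1 ^ n), mul_assoc, pow_mul, r1, pow_mul, hodd.neg_one_pow]
  · rw [mul_comm, pow_mul, r2, pow_mul, hodd.neg_one_pow]

/-- The translate sums satisfy a common quadratic equation exactly under the arithmetic conditions
on the index 2 Gauss sum data. -/
theorem quadratic_iff_arithmetic (hE : FrobeniusInvariant p1 p2 n p E) (hpp : p.Prime)
    (hmod : (p1 % 4 = 1 ∧ p2 % 4 = 3) ∨ (p1 % 4 = 3 ∧ p2 % 4 = 1)) {f : ℕ}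
    (hf : 2 * f = (p1 ^ (n + 1) * p2).totient)
    {θ : AddChar (ZMod (p1 ^ (n + 1))) ℂ} (hθ : θ (embed p1 n 1) ≠ 1)
    {η : AddChar (ZMod p2) ℂ} (hη : η ≠ 1) (hsum : ∑ y, ∑ x, E x y = -1) {G1 G2 G12 : ℂ}
    (e1 : G1 = ∑ y, ∑ x, θ x * E x y) (n1 : G1 * star G1 = (p : ℂ) ^ f)
    (e2 : G2 = ∑ y, η y * ∑ x, (E x y : ℂ)) (n2 : G2 * star G2 = (p : ℂ) ^ f)
    (e12 : G12 = ∑ y, η y * ∑ x, θ x * E x y) (n12 : G12 * star G12 = (p : ℂ) ^ f)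
    {h h0 : ℕ} {b c : ℤ} (hb : ¬ (p : ℤ) ∣ b) (hc : c ≠ 0)
    (hbc : b ^ 2 + (p1 : ℤ) * (p2 : ℤ) * c ^ 2 = 4 * (p : ℤ) ^ h)
    (hg : G12 = (((b : ℂ) + (c : ℂ) * Complex.I * (Real.sqrt ((p1 : ℝ) * (p2 : ℝ)) : ℂ)) / 2)
      * (p : ℂ) ^ h0) :
    (∃ α β : ℂ, ∀ x y, (translateSum p1 p2 n E x y : ℂ) ^ 2
      = α * translateSum p1 p2 n E x y + β) ↔
    ((b = 1 ∨ b = -1) ∧ (c = 1 ∨ c = -1) ∧ 2 ∣ h ∧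
      (p1 : ℤ) = 2 * (p : ℤ) ^ (h / 2) + (-1) ^ ((p1 - 1) / 2) * b ∧
      (p2 : ℤ) = 2 * (p : ℤ) ^ (h / 2) - (-1) ^ ((p1 - 1) / 2) * b) := by
  have hp1 : p1.Prime := Fact.out
  have hp2 : p2.Prime := Fact.out
  set w := Real.sqrt ((p1 : ℝ) * (p2 : ℝ)) with hw
  have hw2 : w ^ 2 = p1 * p2 := Real.sq_sqrt (by positivity)
  have hw0 : w ≠ 0 := by
    intro h
    rw [h] at hw2
    have : (0 : ℝ) < p1 * p2 := by
      have := hp1.pos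
      have := hp2.pos
      positivity
    norm_num at hw2
    rcases hw2 with h | h
    · exact hp1.ne_zero h
    · exact hp2.ne_zero h
  obtain ⟨f', rfl, m1, m2⟩ := hE.half_order hf
  -- the exponent of the Gauss sum
  have hexp : f' * 2 = h + 2 * h0 := by
    rw [hg] at n12
    have : (((b : ℝ) ^ 2 + w ^ 2 * c ^ 2) / 4) * ((p : ℝ) ^ h0) ^ 2 = (p : ℝ) ^ (2 * f') := by
      have h1 := congrArg Complex.re n12
      rw [Complex.star_def, Complex.mul_conj, Complex.ofReal_re, Complex.normSq_mul] at h1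
      have h2 : Complex.normSq (((b : ℂ) + (c : ℂ) * Complex.I * (w : ℂ)) / 2)
          = ((b : ℝ) ^ 2 + w ^ 2 * c ^ 2) / 4 := by
        rw [map_div₀, Complex.normSq_apply]
        norm_num [Complex.normSq_apply]
        ring
      rw [h2, map_pow, Complex.normSq_natCast] at h1
      have h3 : (((p : ℂ) ^ (2 * f'))).re = (p : ℝ) ^ (2 * f') := by
        rw [← Complex.ofReal_natCast, ← Complex.ofReal_pow, Complex.ofReal_re]
      rw [h3] at h1
      rw [← h1]
      ring
    have hbc' : (b : ℝ) ^ 2 + (p1 * p2) * c ^ 2 = 4 * (p : ℝ) ^ h := by exact_mod_cast hbc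
    rw [hw2, hbc'] at this
    have h4 : p ^ (h + 2 * h0) = p ^ (2 * f') := by
      have : (p : ℝ) ^ (h + 2 * h0) = (p : ℝ) ^ (2 * f') := by rw [← this]; ring
      exact_mod_cast this
    rw [mul_comm, Nat.pow_right_injective hpp.two_le h4]
  obtain ⟨h', rfl⟩ : 2 ∣ h := by omega
  have hf' : f' = h' + h0 := by omega
  rw [Nat.mul_div_cancel_left _ two_pos]
  obtain ⟨t00, h00⟩ : ∃ t, translateSum p1 p2 n E (embed p1 n 0) 0 = t := ⟨_, rfl⟩
  obtain ⟨t10, h10⟩ : ∃ t, translateSum p1 p2 n E (embed p1 n 1) 0 = t := ⟨_, rfl⟩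
  obtain ⟨t01, h01⟩ : ∃ t, translateSum p1 p2 n E (embed p1 n 0) 1 = t := ⟨_, rfl⟩
  obtain ⟨tp, htp⟩ : ∃ t, translateSum p1 p2 n E (embed p1 n 1) 1 = t := ⟨_, rfl⟩
  obtain ⟨tm, htm⟩ : ∃ t, translateSum p1 p2 n E (embed p1 n 1) p = t := ⟨_, rfl⟩
  obtain ⟨c0, c1, c2, c3⟩ := hE.characterSums θ hθ η hη h00 h10 h01 htp htm
  rw [← e1] at c1
  rw [← e2] at c2
  rw [← e12] at c3
  have hsum' : ∑ y, ∑ x, (E x y : ℂ) = -1 := by exact_mod_cast hsum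
  rw [hsum'] at c0
  obtain ⟨a1, ha1⟩ := hp1.odd_of_ne_two hE.odd1
  obtain ⟨a2, ha2⟩ := hp2.odd_of_ne_two hE.odd2
  have ea1 : (p1 - 1) / 2 = a1 := by omega
  have ea2 : (p2 - 1) / 2 = a2 := by omega
  rw [ea1] at m2 ⊢
  rw [ea2] at m1
  obtain ⟨ε, hε⟩ : ∃ ε : ℤ, (-1) ^ a1 = ε := ⟨_, rfl⟩
  have hε1 : ε = 1 ∨ ε = -1 := by rw [← hε]; exact neg_one_pow_eq_or ℤ a1
  have hε2 : (-1) ^ a2 = -ε := by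
    rw [← hε]
    rcases hmod with ⟨h1, h2⟩ | ⟨h1, h2⟩
    · rw [Even.neg_one_pow (n := a1) (Nat.even_iff.2 (by omega)),
        Odd.neg_one_pow (n := a2) (Nat.odd_iff.2 (by omega))]
    · rw [Odd.neg_one_pow (n := a1) (Nat.odd_iff.2 (by omega)),
        Even.neg_one_pow (n := a2) (Nat.even_iff.2 (by omega))]
      norm_num
  -- the two Gauss sums of prime power order
  have real_sq : ∀ {G : ℂ} {g : ℤ}, G = g → G * star G = (p : ℂ) ^ (2 * f') →
      g ^ 2 = ((p : ℤ) ^ f') ^ 2 := by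
    rintro G g rfl h
    rw [Complex.star_def, map_intCast] at h
    rw [← pow_mul, mul_comm f', pow_two]
    exact_mod_cast h
  have v1 : G1 = ((-1 - p1 * (t10 + a2 * (tp + tm)) : ℤ) : ℂ) := by
    have q2 : (p2 : ℂ) = 2 * a2 + 1 := by exact_mod_cast ha2
    push_cast
    rw [q2] at c0 c1
    linear_combination (c1 - c0) / 2
  have v2 : G2 = ((-1 - p2 * (t01 + a1 * (tp + tm)) : ℤ) : ℂ) := by
    have q1 : (p1 : ℂ) = 2 * a1 + 1 := by exact_mod_cast ha1
    push_cast
    rw [q1] at c0 c2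
    linear_combination (c2 - c0) / 2
  have l1 := hp1.two_le
  have l2 := hp2.two_le
  have g1 := eq_neg_mul_of_zmod (r := p1) (Q := (p : ℤ) ^ f') (σ := -ε) (by have := hE.odd1; omega)
    (by omega) (real_sq v1 n1) (by rw [← hε2]; push_cast; exact m1) (by simp)
  have g2 := eq_neg_mul_of_zmod (r := p2) (Q := (p : ℤ) ^ f') (σ := ε) (by have := hE.odd2; omega)
    hε1 (real_sq v2 n2) (by rw [← hε]; push_cast; exact m2) (by simp)
  rw [g1] at v1
  rw [g2] at v2
  rw [hf', pow_add] at v1 v2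
  -- the product of the quadratic Gauss sums
  have hθ' : θ.compAddMonoidHom (embed p1 n) ≠ 1 := by
    intro h
    exact hθ (by simpa using DFunLike.congr_fun h 1)
  have s1 := sq_sum_quadraticChar_mul hE.odd1 hθ'
  have s2 := sq_sum_quadraticChar_mul hE.odd2 hη
  simp only [AddChar.compAddMonoidHom_apply] at s1
  have hχ4 : ZMod.χ₄ p1 * ZMod.χ₄ p2 = -1 := by
    rcases hmod with ⟨h1, h2⟩ | ⟨h1, h2⟩
    · rw [ZMod.χ₄_nat_one_mod_four h1, ZMod.χ₄_nat_three_mod_four h2]; norm_num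
    · rw [ZMod.χ₄_nat_three_mod_four h1, ZMod.χ₄_nat_one_mod_four h2]; norm_num
  have hχ4' : ((ZMod.χ₄ p1 : ℤ) : ℂ) * (ZMod.χ₄ p2 : ℤ) = -1 := by exact_mod_cast hχ4
  obtain ⟨g, hgdef⟩ : ∃ g, (∑ k, (quadraticChar _ k : ℂ) * θ (embed p1 n k)) *
        (∑ y, (quadraticChar _ y : ℂ) * η y) = g := ⟨_, rfl⟩
  have hg2 : g ^ 2 = -((p1 * p2 : ℝ) : ℂ) := by
    rw [← hgdef, mul_pow, s1, s2]
    push_cast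
    linear_combination (p1 * p2 : ℂ) * hχ4'
  rw [hgdef, hg] at c3
  have hw' := eq_of_sq_eq_neg (by positivity) hg2
  rw [← hw] at hw'
  have h3D : 2 * t00 - 2 * t10 - 2 * t01 + (tp + tm) = b * (p : ℤ) ^ h0 ∧
      (tp - tm = c * (p : ℤ) ^ h0 ∨ tp - tm = -(c * (p : ℤ) ^ h0)) := by
    have hcast : (p : ℂ) ^ h0 = (((p : ℤ) ^ h0 : ℤ) : ℂ) := by push_cast; rfl
    rw [hcast] at c3
    obtain ⟨s, hs⟩ : ∃ s : ℤ, (p : ℤ) ^ h0 = s := ⟨_, rfl⟩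
    rw [hs] at c3 ⊢
    have main : ∀ {τ : ℤ}, g = τ * (Complex.I * w) →
        2 * t00 - 2 * t10 - 2 * t01 + (tp + tm) = b * s ∧ τ * (tp - tm) = c * s := by
      intro τ hτ
      rw [hτ] at c3
      have hre := congrArg Complex.re c3
      have him := congrArg Complex.im c3
      simp at hre him
      constructor
      · have : (2 * t00 - 2 * t10 - 2 * t01 + (tp + tm) : ℝ) = b * s := by
          linear_combination -hre
        exact_mod_cast this
      · have : (τ * (tp - tm) : ℝ) = c * s := by
          refine mul_left_cancel₀ hw0 ?_
          linear_combination -him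
        exact_mod_cast this
    rcases hw' with h | h
    · obtain ⟨r1, r2⟩ := main (τ := 1) (by rw [h]; simp)
      exact ⟨r1, Or.inl (by linarith)⟩
    · obtain ⟨r1, r2⟩ := main (τ := -1) (by rw [h]; simp)
      exact ⟨r1, Or.inr (by linarith)⟩
  obtain ⟨h3, hD⟩ := h3D
  have hP : 0 < (p : ℤ) ^ h' := by have := hpp.pos; positivity
  have hs : 0 < (p : ℤ) ^ h0 := by have := hpp.pos; positivity
  have hcop : IsCoprime b ((p : ℤ) ^ h') :=
    (((Nat.prime_iff_prime_int.1 hpp).irreducible.coprime_iff_not_dvd.2 hb).symm).pow_right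
  have hne : tp ≠ tm := by
    intro h
    have := mul_ne_zero hc hs.ne'
    rcases hD with hD | hD <;> apply this <;> omega
  have h1 : 2 * t00 - 2 * t10 + (p2 - 1) * (2 * t01 - (tp + tm))
      = 2 * (ε * (p : ℤ) ^ h' * (p : ℤ) ^ h0) := by
    rw [v1] at c1
    push_cast at c1
    have : (2 * t00 - 2 * t10 + (p2 - 1) * (2 * t01 - (tp + tm)) : ℂ)
      = 2 * (ε * (p : ℂ) ^ h' * (p : ℂ) ^ h0) := by linear_combination -c1
    exact_mod_cast this
  have h2 : 2 * t00 + 2 * (p1 - 1) * t10 - 2 * t01 - (p1 - 1) * (tp + tm)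
      = -2 * (ε * (p : ℤ) ^ h' * (p : ℤ) ^ h0) := by
    rw [v2] at c2
    push_cast at c2
    have : (2 * t00 + 2 * (p1 - 1) * t10 - 2 * t01 - (p1 - 1) * (tp + tm) : ℂ)
      = -2 * (ε * (p : ℂ) ^ h' * (p : ℂ) ^ h0) := by linear_combination -c2
    exact_mod_cast this
  rw [hE.quadratic_iff hne h00 h10 h01 htp htm, two_valued_iff hε1 (by exact_mod_cast hp1.pos)
    (by exact_mod_cast hp2.pos) (by exact_mod_cast hp1.odd_of_ne_two hE.odd1)
    (by exact_mod_cast hp2.odd_of_ne_two hE.odd2) hP hs hc hcop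
    (by rw [hbc, pow_mul']) h1 h2 h3 hD, hε]
  simp

end FrobeniusInvariant

theorem not_dvd_sub_one_of_orderOf {M r p : ℕ} [NeZero M] (hr : r.Prime) (hrM : r ∣ M)
    (h2 : Nat.Coprime 2 M) (hc : p.Coprime M) (h : orderOf (p : ZMod M) = M.totient) (hp : 0 < p) :
    ¬ r ∣ p - 1 := by
  intro hd
  obtain ⟨j, hj⟩ := exists_pow_eq_of_orderOf hc h (ZMod.unitOfCoprime 2 h2)
  have h1 := congrArg (ZMod.castHom hrM (ZMod r)) hj
  simp only [ZMod.coe_unitOfCoprime, map_natCast, map_pow] at h1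
  have hp1 : (p : ZMod r) = 1 := by
    have := (ZMod.natCast_eq_zero_iff _ _).2 hd
    rw [Nat.cast_sub hp, Nat.cast_one] at this
    exact sub_eq_zero.1 this
  rw [hp1, one_pow] at h1
  have : Fact r.Prime := ⟨hr⟩
  exact one_ne_zero (α := ZMod r) (by push_cast at h1; linear_combination h1)

theorem inv_stdAddChar_ne_one {M : ℕ} [NeZero M] {x : ZMod M} (hx : x ≠ 0) :
    (ZMod.stdAddChar (N := M))⁻¹ x ≠ 1 := by
  rw [AddChar.inv_apply', Ne, inv_eq_one, ← AddChar.map_zero_eq_one (ZMod.stdAddChar (N := M))]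
  exact fun h => hx (ZMod.injective_stdAddChar h)

theorem exp_eq_stdAddChar_one (M : ℕ) [NeZero M] :
    Complex.exp (2 * (Real.pi : ℂ) * Complex.I / (M : ℂ)) = ZMod.stdAddChar (1 : ZMod M) := by
  have := ZMod.stdAddChar_coe (N := M) 1
  simpa using this.symm

theorem inv_stdAddChar_mul_ne_one {M M' : ℕ} [NeZero M] [Fact M'.Prime] (h : ¬ M' ∣ M) :
    (ZMod.stdAddChar (N := M))⁻¹ 1 * (ZMod.stdAddChar (N := M'))⁻¹ 1 ≠ 1 := by
  intro h1
  have h2 := congrArg (· ^ M) h1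
  simp only [mul_pow, ← AddChar.map_nsmul_eq_pow, one_pow, nsmul_eq_mul, mul_one,
    ZMod.natCast_self, AddChar.map_zero_eq_one, one_mul] at h2
  exact inv_stdAddChar_ne_one (fun h3 => h ((ZMod.natCast_eq_zero_iff _ _).1 h3)) h2

/-- Criterion for `Cay(F_q, D_0)` with `N = p1^m * p2` to be strongly regular, in terms of
the index-2 Gauss sum data `(b, c, h)` (Corollary 5.2 in [FX]). -/
theorem cayley_srg_iff_two_primes
    (p1 p2 m N p f q : ℕ)
    (hp1 : p1.Prime) (hp2 : p2.Prime)
    (hmod : (p1 % 4 = 1 ∧ p2 % 4 = 3) ∨ (p1 % 4 = 3 ∧ p2 % 4 = 1))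
    (hm : 1 ≤ m) (hN : N = p1 ^ m * p2)
    (hp : p.Prime) (hcop : Nat.Coprime p N)
    (hord1 : orderOf (p : ZMod (p1 ^ m)) = Nat.totient (p1 ^ m))
    (hord2 : orderOf (p : ZMod p2) = Nat.totient p2)
    (hf : f = orderOf (p : ZMod N)) (hf2 : 2 * f = N.totient)
    (hq : q = p ^ f)
    (F : Type) [Field F] [Fintype F] [Algebra (ZMod p) F]
    (hF : Fintype.card F = q)
    (γ : Fˣ) (hγ : orderOf γ = q - 1)
    (D0 : Set F)
    (hD0 : D0 = {x : F | ∃ i < p1 ^ (m - 1), ∃ t : ℕ, x = ((γ : F)) ^ (i * p2 + N * t)})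
    (χ1 χ2 : MulChar F ℂ)
    (hχ1 : χ1 ((γ : F)) = Complex.exp (2 * (Real.pi : ℂ) * Complex.I / ((p1 : ℂ) ^ m)))
    (hχ2 : χ2 ((γ : F)) = Complex.exp (2 * (Real.pi : ℂ) * Complex.I / (p2 : ℂ)))
    (K : Type) [Field K] [NumberField K]
    (hK : Module.finrank ℚ K = 2) (hKα : ∃ α : K, α ^ 2 = -((p1 : K) * (p2 : K)))
    (h h0 : ℕ) (hh : h = NumberField.classNumber K) (hh0 : h0 = (f - h) / 2)
    (ℓ : ℕ) (hℓ : ℓ = p1 ∨ ℓ = p2) (hℓmod : ℓ % 4 = 3)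
    (b c : ℤ) (hb : ¬ (p : ℤ) ∣ b) (hc : ¬ (p : ℤ) ∣ c)
    (hbc : b ^ 2 + (p1 : ℤ) * (p2 : ℤ) * c ^ 2 = 4 * (p : ℤ) ^ h)
    (hbmod : b ≡ 2 * (p : ℤ) ^ (h / 2) [ZMOD (ℓ : ℤ)])
    (hg : (∑ a : F, (starRingEnd ℂ) (χ1 a) * (starRingEnd ℂ) (χ2 a) *
            Complex.exp (2 * (Real.pi : ℂ) * Complex.I *
              ((Algebra.trace (ZMod p) F a).val : ℂ) / (p : ℂ)))
        = (((b : ℂ) + (c : ℂ) * Complex.I * (Real.sqrt ((p1 : ℝ) * (p2 : ℝ)) : ℂ)) / 2)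
            * (p : ℂ) ^ h0) :
    (SimpleGraph.fromRel (fun x y : F => x - y ∈ D0) ≠ ⊤ ∧
     SimpleGraph.fromRel (fun x y : F => x - y ∈ D0) ≠ ⊥ ∧
     ∃ k l u : ℕ, (SimpleGraph.fromRel (fun x y : F => x - y ∈ D0)).IsSRGWith q k l u) ↔
    ((b = 1 ∨ b = -1) ∧ (c = 1 ∨ c = -1) ∧ 2 ∣ h ∧
      (p1 : ℤ) = 2 * (p : ℤ) ^ (h / 2) + (-1) ^ ((p1 - 1) / 2) * b ∧
      (p2 : ℤ) = 2 * (p : ℤ) ^ (h / 2) - (-1) ^ ((p1 - 1) / 2) * b) := by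
  obtain ⟨n, rfl⟩ : ∃ n, m = n + 1 := ⟨m - 1, by omega⟩
  rw [Nat.add_sub_cancel] at hD0
  subst hN hf
  have : Fact p.Prime := ⟨hp⟩
  have : Fact p1.Prime := ⟨hp1⟩
  have : Fact p2.Prime := ⟨hp2⟩
  have hne : p1 ≠ p2 := by omega
  have ho1 : p1 ≠ 2 := by omega
  have ho2 : p2 ≠ 2 := by omega
  have hcopM : (p1 ^ (n + 1)).Coprime p2 := ((Nat.coprime_primes hp1 hp2).2 hne).pow_left _
  have hM2 : Nat.Coprime 2 (p1 ^ (n + 1)) :=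
    ((Nat.coprime_primes Nat.prime_two hp1).2 ho1.symm).pow_right _
  have h2p2 : Nat.Coprime 2 p2 := (Nat.coprime_primes Nat.prime_two hp2).2 ho2.symm
  have hN2 : (p1 ^ (n + 1) * p2).Coprime 2 := (hM2.mul_right h2p2).symm
  have hNp : (p1 ^ (n + 1) * p2).Coprime (p - 1) := by
    refine Nat.Coprime.mul_left (Nat.Coprime.pow_left _ ?_) ?_
    · exact (Nat.Prime.coprime_iff_not_dvd hp1).2 (not_dvd_sub_one_of_orderOf hp1
        (dvd_pow_self p1 n.succ_ne_zero) hM2 hcop.coprime_mul_right_right hord1 hp.pos)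
    · exact (Nat.Prime.coprime_iff_not_dvd hp2).2 (not_dvd_sub_one_of_orderOf hp2
        dvd_rfl h2p2 hcop.coprime_mul_left_right hord2 hp.pos)
  set f := orderOf (p : ZMod (p1 ^ (n + 1) * p2)) with hf
  have hdvd : p1 ^ (n + 1) * p2 ∣ Fintype.card F - 1 := by
    rw [hF, hq, ← ZMod.natCast_eq_zero_iff, Nat.cast_sub (Nat.one_le_pow _ _ hp.pos),
      Nat.cast_pow, hf, pow_orderOf_eq_one]
    simp
  rw [← hF] at hγ
  obtain ⟨L, hL⟩ := exists_logHom hγ hdvd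
  set ψ := traceChar p F with hψ
  have hprim : ψ.IsPrimitive := traceChar_isPrimitive p
  choose E hE using fun x y => exists_int_eq_period ψ L (fun t => logHom_eq_one_of_pow hNp
    (by rw [← map_pow, ZMod.units_pow_card_sub_one_eq_one, map_one]))
    (Multiplicative.ofAdd (x, y))
  have hinv : FrobeniusInvariant p1 p2 n p E :=
    frobeniusInvariant_period (traceChar_pow_char p) hE ho1 ho2 hne hcop hord1 hord2 hf2
  -- the connection set
  have hzero : (0 : F) ∉ D0 := by
    rw [hD0]
    rintro ⟨i, -, t, h⟩
    exact pow_ne_zero _ γ.ne_zero h.symm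
  have hD : ∀ u : Fˣ, (u : F) ∈ D0 ↔ ∃ i < p1 ^ n,
      L u = Multiplicative.ofAdd ((i : ZMod (p1 ^ (n + 1))) * p2, 0) := by
    intro u
    simp only [hD0, Set.mem_ofPred_eq, exists_eq_pow_iff hγ hdvd hcopM hL]
  have hneg : ∀ x ∈ D0, -x ∈ D0 := by
    intro x hx
    have hx0 : x ≠ 0 := fun h => hzero (h ▸ hx)
    obtain ⟨u, rfl⟩ : ∃ u : Fˣ, (u : F) = x := ⟨Units.mk0 x hx0, rfl⟩
    rw [← Units.val_neg, hD, logHom_neg hN2]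
    exact (hD u).1 hx
  have hone : (1 : F) ∈ D0 := by
    rw [hD0]
    exact ⟨0, Nat.pow_pos hp1.pos, 0, by simp⟩
  have hγD : (γ : F) ∉ D0 := by
    rw [hD, hL]
    rintro ⟨i, -, h⟩
    exact one_ne_zero (congrArg Prod.snd (Multiplicative.ofAdd.injective h))
  have hsum : ∀ (w : Fˣ) x y, L w = Multiplicative.ofAdd (x, y) →
      ∑ z ∈ D0.toFinset, ψ (w * z) = translateSum p1 p2 n E x y :=
    fun w x y hw => sum_connectionSet_eq_translateSum hE hne hzero hD hw
  rw [cayley_srg_iff_quadratic hprim hzero hneg ⟨1, hone⟩ ⟨γ, γ.ne_zero, hγD⟩ hF]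
  have hcomb : (∃ α β : ℂ, ∀ c ≠ 0, (∑ x ∈ D0.toFinset, ψ (c * x)) ^ 2
      = α * (∑ x ∈ D0.toFinset, ψ (c * x)) + β) ↔
      ∃ α β : ℂ, ∀ x y, (translateSum p1 p2 n E x y : ℂ) ^ 2
        = α * translateSum p1 p2 n E x y + β := by
    refine exists_congr fun α => exists_congr fun β => ⟨fun h x y => ?_, fun h c hc => ?_⟩
    · obtain ⟨w, hw⟩ := logHom_surjective hL hcopM x y
      rw [← hsum w x y hw]
      exact h w w.ne_zero
    · have := hsum (Units.mk0 c hc) _ _ rfl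
      rw [Units.val_mk0] at this
      rw [this]
      exact h _ _
  rw [hcomb]
  -- the Gauss sums
  set θ := (ZMod.stdAddChar (N := p1 ^ (n + 1)))⁻¹ with hθ
  set η := (ZMod.stdAddChar (N := p2))⁻¹ with hη
  have hval : ∀ (χ : MulChar F ℂ) (M : ℕ) [NeZero M],
      χ (γ : F) = Complex.exp (2 * (Real.pi : ℂ) * Complex.I / (M : ℂ)) →
      χ⁻¹ (γ : F) = (ZMod.stdAddChar (N := M))⁻¹ 1 := by
    intro χ M _ h
    rw [← MulChar.star_apply', h, exp_eq_stdAddChar_one, AddChar.inv_apply,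
      AddChar.map_neg_eq_conj]
    rfl
  have v1 : χ1⁻¹ (γ : F) = θ 1 := hval χ1 (p1 ^ (n + 1)) (by rw [hχ1]; push_cast; rfl)
  have v2 : χ2⁻¹ (γ : F) = η 1 := hval χ2 p2 hχ2
  have v12 : (χ1⁻¹ * χ2⁻¹) (γ : F) = θ 1 * η 1 := by rw [MulChar.mul_apply, v1, v2]
  have hχne : ∀ χ : MulChar F ℂ, χ γ ≠ 1 → χ ≠ 1 := by
    rintro χ h rfl
    exact h (MulChar.one_apply_coe γ)
  have : Fact (1 < p1 ^ (n + 1)) := ⟨Nat.one_lt_pow n.succ_ne_zero hp1.one_lt⟩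
  have norm : ∀ χ : MulChar F ℂ, χ γ ≠ 1 →
      gaussSum χ ψ * star (gaussSum χ ψ) = (p : ℂ) ^ f := by
    intro χ h
    rw [gaussSum_mul_star (hχne χ h) hprim, hF, hq, Nat.cast_pow]
  have hθ1 : θ 1 ≠ 1 := inv_stdAddChar_ne_one one_ne_zero
  have hη1 : η 1 ≠ 1 := inv_stdAddChar_ne_one one_ne_zero
  have hθη : θ 1 * η 1 ≠ 1 := inv_stdAddChar_mul_ne_one fun hd =>
    hne ((Nat.prime_dvd_prime_iff_eq hp2 hp1).1 (hp2.dvd_of_dvd_pow hd)).symm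
  have e1 := gaussSum_eq_sum_period (χ := χ1⁻¹) (θ := θ) (η := 1) hγ hL hE (by rw [v1, AddChar.one_apply, mul_one])
  have e2 := gaussSum_eq_sum_period (χ := χ2⁻¹) (θ := 1) (η := η) hγ hL hE (by rw [v2, AddChar.one_apply, one_mul])
  have e12 := gaussSum_eq_sum_period hγ hL hE v12
  simp only [AddChar.one_apply, one_mul] at e1 e2
  refine hinv.quadratic_iff_arithmetic (h0 := h0) hp hmod hf2
    (inv_stdAddChar_ne_one fun h => one_ne_zero (embed_injective p1 n (h.trans (map_zero _).symm)))
    (fun h => hη1 (by rw [h, AddChar.one_apply])) (sum_period_eq_neg_one hprim hE)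
    e1 (norm _ (v1 ▸ hθ1)) e2 (norm _ (v2 ▸ hη1)) e12 (norm _ (v12 ▸ hθη)) hb
    (fun h => hc (h ▸ dvd_zero _)) hbc ?_
  rw [← hg, gaussSum]
  refine Finset.sum_congr rfl fun a _ => ?_
  rw [hψ, traceChar_apply, MulChar.mul_apply, ← MulChar.star_apply', ← MulChar.star_apply']
  rfl
end
end

section
/- With N = p1^m and D_0, ..., D_{p1−1} as in the context: for every nonzero x ∈ F_q, the number of triples (k, u, v) with 0 ≤ k ≤ p1−1, u ∈ D_k, v ∈ D_k and u − v = x equals (q−1)/p1 − 1. (Equivalently, in the group ring Z[(F_q, +)] one has Σ_{k=0}^{p1−1} D_k² = (q−1)·0 + ((q−1)/p1 − 1)·(F_q − 0), which shows the fusion scheme with classes D_k is pseudocyclic.) -/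
open scoped Classical

noncomputable section

/-- A finite field of characteristic `p` has a primitive complex additive character which is
invariant under the Frobenius map. -/
theorem exists_isPrimitive_frobenius_invariant (F : Type) [Field F] [Fintype F] (p : ℕ)
    [Fact p.Prime] [CharP F p] :
    ∃ ψ : AddChar F ℂ, ψ.IsPrimitive ∧ ∀ x, ψ (x ^ p) = ψ x := by
  let _ : Algebra (ZMod p) F := ZMod.algebra F p
  let tr : F →+ ZMod p := (Algebra.trace (ZMod p) F).toAddMonoidHom
  refine ⟨(ZMod.stdAddChar (N := p)).compAddMonoidHom tr, AddChar.IsPrimitive.of_ne_one ?_, ?_⟩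
  · intro h
    obtain ⟨b, hb⟩ := Algebra.trace_surjective (ZMod p) F 1
    have h1 : ZMod.stdAddChar (N := p) 1 = ZMod.stdAddChar (N := p) 0 := by
      have := DFunLike.congr_fun h b
      rw [AddChar.map_zero_eq_one, ← hb]
      exact this
    exact one_ne_zero (ZMod.injective_stdAddChar h1)
  · intro x
    have h := Algebra.trace_eq_of_algEquiv
      (FiniteField.frobeniusAlgEquivOfAlgebraic (ZMod p) F) x
    have hx : FiniteField.frobeniusAlgEquivOfAlgebraic (ZMod p) F x = x ^ p := by
      simp [ZMod.card]
    rw [hx] at h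
    exact congrArg (ZMod.stdAddChar (N := p)) h

/-- If `p` generates a subgroup of index two in `(ℤ/ℓ^m)ˣ`, then translating by `ℓ^(m-1)` a number
not divisible by `ℓ^(m-1)` amounts modulo `ℓ^m` to multiplying it by a power of `p`. -/
theorem exists_add_modEq_pow_mul {l m p s : ℕ} (hl : l.Prime) (hodd : Odd l) (hm : 1 ≤ m)
    (hcop : p.Coprime (l ^ m)) (hind : 2 * orderOf (p : ZMod (l ^ m)) = (l ^ m).totient)
    (hs : ¬ l ^ (m - 1) ∣ s) :
    ∃ e : ℕ, s + l ^ (m - 1) ≡ p ^ e * s [MOD l ^ m] := by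
  have hNe : NeZero (l ^ m) := ⟨pow_ne_zero _ hl.ne_zero⟩
  have hs0 : s ≠ 0 := by rintro rfl; exact hs (dvd_zero _)
  obtain ⟨r, s', hs', rfl⟩ := Nat.exists_eq_pow_mul_and_not_dvd hs0 l hl.ne_one
  have hr : r < m - 1 := by
    by_contra! h
    exact hs (Dvd.dvd.mul_right (pow_dvd_pow l h) _)
  obtain ⟨w, -, hw⟩ := Nat.exists_mul_mod_eq_one_of_coprime
    ((Nat.Prime.coprime_iff_not_dvd hl).2 hs').symm hl.one_lt
  set u : ℕ := 1 + l ^ (m - 1 - r) * w with hu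
  have hlu : (l : ℤ) ∣ (u : ℤ) - 1 := by
    rw [hu]; push_cast; rw [add_sub_cancel_left]
    exact Dvd.dvd.mul_right (dvd_pow_self _ (by omega)) _
  have hucop : u.Coprime (l ^ m) := by
    refine Nat.Coprime.pow_right _ (((Nat.Prime.coprime_iff_not_dvd hl).2 fun h => ?_).symm)
    have h1 : (l : ℤ) ∣ 1 := by
      have := dvd_sub (Int.natCast_dvd_natCast.2 h) hlu
      simpa using this
    exact hl.one_lt.ne' (by exact_mod_cast Int.eq_one_of_dvd_one (by positivity) h1)
  let U : (ZMod (l ^ m))ˣ := ZMod.unitOfCoprime u hucop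
  let g : (ZMod (l ^ m))ˣ := ZMod.unitOfCoprime p hcop
  have hUpow : U ^ l ^ (m - 1) = 1 := by
    have h := dvd_sub_pow_of_dvd_sub hlu (m - 1)
    rw [Nat.sub_add_cancel hm, one_pow] at h
    ext
    have h2 := (ZMod.intCast_zmod_eq_zero_iff_dvd _ (l ^ m)).2 (by exact_mod_cast h)
    push_cast at h2
    simpa [U, sub_eq_zero] using h2
  have hindex : (Subgroup.zpowers g).index = 2 := by
    have hg : orderOf g = orderOf (p : ZMod (l ^ m)) := by
      rw [← orderOf_units]; simp [g]
    have h1 := (Subgroup.zpowers g).card_mul_index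
    rw [Nat.card_zpowers, hg, Nat.card_eq_fintype_card, ZMod.card_units_eq_totient, ← hind,
      mul_comm 2] at h1
    refine Nat.eq_of_mul_eq_mul_left (Nat.pos_of_ne_zero fun h0 => ?_) h1
    rw [h0] at hind
    exact (Nat.totient_pos.2 (pow_pos hl.pos m)).ne (by simpa using hind)
  obtain ⟨c, hc⟩ := (hodd.pow : Odd (l ^ (m - 1)))
  have hUmem : U ∈ Subgroup.zpowers g := by
    have h := Subgroup.sq_mem_of_index_two hindex (U ^ (c + 1))
    have h2 : (U ^ (c + 1)) ^ 2 = U := by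
      rw [← pow_mul, show (c + 1) * 2 = l ^ (m - 1) + 1 by omega, pow_succ, hUpow, one_mul]
    rwa [h2] at h
  obtain ⟨e, he⟩ := mem_zpowers_iff_mem_range_orderOf.1 hUmem |> Finset.mem_image.1
  refine ⟨e, ?_⟩
  have hpe : p ^ e ≡ u [MOD l ^ m] := by
    rw [← ZMod.natCast_eq_natCast_iff]
    have := congrArg Units.val he.2
    push_cast
    simpa [U, g] using this
  refine Nat.ModEq.trans ?_ (hpe.symm.mul_right _)
  have h1 : u * (l ^ r * s') = l ^ r * s' + l ^ (m - 1) * (s' * w) := by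
    rw [hu, show l ^ (m - 1) = l ^ (m - 1 - r) * l ^ r by rw [← pow_add]; congr 1; omega]
    ring
  rw [h1]
  refine Nat.ModEq.add_left _ ?_
  have h2 : s' * w ≡ 1 [MOD l] := by rw [Nat.ModEq, hw, Nat.mod_eq_of_lt hl.one_lt]
  have h3 := h2.symm.mul_left' (l ^ (m - 1))
  rwa [mul_one, ← pow_succ, Nat.sub_add_cancel hm] at h3

theorem sum_range_window_succ {R : Type*} [AddCommMonoid R] {g : ℕ → R} {K s : ℕ}
    (h : g (s + K) = g s) :
    ∑ i ∈ Finset.range K, g (s + 1 + i) = ∑ i ∈ Finset.range K, g (s + i) := by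
  rcases K with _ | K
  · simp
  · rw [Finset.sum_range_succ, Finset.sum_range_succ', add_zero, ← h]
    exact congrArg₂ _ (Finset.sum_congr rfl fun i _ => by congr 1; omega) (by congr 1; omega)

/-- A function that is constant between consecutive multiples of `K` and periodic modulo `P * K`
has the same sum along every progression of step `K` and length `P`. -/
theorem sum_range_step_eq {R : Type*} [AddCommMonoid R] {g : ℕ → R} {K P : ℕ} (hK : 0 < K)
    (hstep : ∀ s, ¬ K ∣ s → g (s + 1) = g s) (hper : ∀ s, g (s + P * K) = g s) (s : ℕ) :
    ∑ k ∈ Finset.range P, g (s + k * K) = ∑ k ∈ Finset.range P, g (k * K) := by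
  set T : ℕ → R := fun s => ∑ k ∈ Finset.range P, g (s + k * K) with hT
  have hT1 : ∀ s, ¬ K ∣ s → T (s + 1) = T s := fun s hs => by
    refine Finset.sum_congr rfl fun k _ => ?_
    rw [add_right_comm, hstep]
    rwa [Nat.dvd_add_left (Dvd.intro_left k rfl)]
  have hTK : ∀ s, T (s + K) = T s := fun s => by
    have := sum_range_window_succ (g := fun k => g (s + k * K)) (K := P) (s := 0)
      (by simpa using hper s)
    simp only [zero_add] at this
    rw [hT]
    simp only
    rw [← this]
    exact Finset.sum_congr rfl fun k _ => by congr 1; ring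
  have hmul : ∀ c, T (c * K) = T 0 := fun c => by
    induction c with
    | zero => simp
    | succ c ih => rw [add_mul, one_mul, hTK, ih]
  have hinside : ∀ c j, j < K → T (c * K + 1 + j) = T (c * K + 1) := fun c j => by
    induction j with
    | zero => simp
    | succ j ih =>
      intro hj
      rw [← ih (by omega), ← add_assoc, hT1]
      rw [add_assoc, Nat.dvd_add_right (Dvd.intro_left c rfl)]
      exact Nat.not_dvd_of_pos_of_lt (by omega) (by omega)
  have hall : ∀ s, T s = T 0 := fun s => by
    have hone : ∀ c, T (c * K + 1) = T 0 := fun c => by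
      rw [← hinside c (K - 1) (by omega), ← hmul (c + 1)]
      congr 1
      rw [add_mul]; omega
    rw [← Nat.div_add_mod s K, mul_comm]
    rcases Nat.eq_zero_or_pos (s % K) with h0 | h0
    · rw [h0, add_zero, hmul]
    · have hlt := Nat.mod_lt s hK
      rw [show s / K * K + s % K = s / K * K + 1 + (s % K - 1) by omega,
        hinside _ _ (by omega), hone]
  simpa [hT] using hall s

/-- If the power spectrum of a family of subsets is constant away from zero, then so is the number
of representations as a difference within the family. -/
theorem card_mul_sum_card_sub_eq {F : Type} [Field F] [Fintype F] {ψ : AddChar F ℂ}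
    (hψ : ψ.IsPrimitive) {ι : Type*} (I : Finset ι) (A : ι → Finset F) (C : ℂ)
    (hC : ∀ a ≠ 0, ∑ k ∈ I, (∑ u ∈ A k, ψ (a * u)) * (∑ v ∈ A k, ψ⁻¹ (a * v)) = C)
    {x : F} (hx : x ≠ 0) :
    (Fintype.card F : ℂ) * (∑ k ∈ I, ({w ∈ A k ×ˢ A k | w.1 - w.2 = x}.card : ℂ)) =
      ∑ k ∈ I, ((A k).card : ℂ) ^ 2 - C := by
  have h1 : (Fintype.card F : ℂ) * (∑ k ∈ I, ({w ∈ A k ×ˢ A k | w.1 - w.2 = x}.card : ℂ)) =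
      ∑ a : F, ψ (a * -x) *
        ∑ k ∈ I, (∑ u ∈ A k, ψ (a * u)) * (∑ v ∈ A k, ψ⁻¹ (a * v)) := by
    simp_rw [Finset.mul_sum I]
    rw [Finset.sum_comm]
    refine Finset.sum_congr rfl fun k _ => ?_
    have hprod : ∀ a : F, (∑ u ∈ A k, ψ (a * u)) * (∑ v ∈ A k, ψ⁻¹ (a * v)) =
        ∑ w ∈ A k ×ˢ A k, ψ (a * w.1) * ψ⁻¹ (a * w.2) := fun a => by
      rw [Finset.sum_mul_sum, Finset.sum_product]
    simp_rw [hprod, Finset.mul_sum]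
    rw [Finset.sum_comm, Finset.card_filter, Nat.cast_sum, Finset.mul_sum]
    refine Finset.sum_congr rfl fun w _ => ?_
    have := AddChar.sum_mulShift (w.1 - w.2 - x) hψ
    simp only [sub_eq_zero] at this
    rw [Nat.cast_ite, Nat.cast_one, Nat.cast_zero, mul_ite, mul_one, mul_zero]
    rw [Nat.cast_ite, Nat.cast_zero] at this
    rw [← this]
    refine Finset.sum_congr rfl fun a _ => ?_
    rw [AddChar.inv_apply, ← AddChar.map_add_eq_mul, ← AddChar.map_add_eq_mul]
    congr 1; ring
  have h2 := AddChar.sum_mulShift (-x) hψ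
  rw [if_neg (neg_ne_zero.2 hx), ← Finset.add_sum_erase _ _ (Finset.mem_univ 0), zero_mul,
    AddChar.map_zero_eq_one, Nat.cast_zero] at h2
  rw [h1, ← Finset.add_sum_erase _ _ (Finset.mem_univ 0), Finset.sum_congr rfl
    (fun a ha => by rw [hC a (Finset.ne_of_mem_erase ha)] :
      ∀ a ∈ Finset.univ.erase (0 : F), _ = ψ (a * -x) * C), ← Finset.sum_mul,
    eq_neg_of_add_eq_zero_right h2]
  simp [pow_two, sub_eq_add_neg]

/-- The number of representations as a difference within a family of subsets, when it does not
depend on the nonzero difference. -/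
theorem card_sub_one_mul_eq {F : Type} [Field F] [Fintype F] {ι : Type*} (I : Finset ι)
    (A : ι → Finset F) (n : ℕ)
    (hn : ∀ x ≠ 0, ∑ k ∈ I, {w ∈ A k ×ˢ A k | w.1 - w.2 = x}.card = n) :
    ∑ k ∈ I, (A k).card + (Fintype.card F - 1) * n = ∑ k ∈ I, (A k).card ^ 2 := by
  have htot : ∑ x : F, ∑ k ∈ I, {w ∈ A k ×ˢ A k | w.1 - w.2 = x}.card =
      ∑ k ∈ I, (A k).card ^ 2 := by
    rw [Finset.sum_comm]
    refine Finset.sum_congr rfl fun k _ => ?_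
    rw [pow_two, ← Finset.card_product]
    exact (Finset.card_eq_sum_card_fiberwise fun _ _ => Finset.mem_univ _).symm
  rw [← htot, ← Finset.add_sum_erase _ _ (Finset.mem_univ 0),
    Finset.sum_congr rfl (fun x hx => hn x (Finset.ne_of_mem_erase hx)), Finset.sum_const,
    Finset.card_erase_of_mem (Finset.mem_univ _), Finset.card_univ, smul_eq_mul]
  congr 1
  refine Finset.sum_congr rfl fun k _ => ?_
  rw [← Finset.diag_card]
  congr 1
  ext ⟨u, v⟩
  simp only [Finset.mem_diag, Finset.mem_filter, Finset.mem_product, sub_eq_zero]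
  aesop

/-- The sum of an additive character over a coset of the group of `M`-th roots of unity. -/
def cyclotomicPeriod {F : Type} [Field F] [Fintype F] (ψ : AddChar F ℂ) (M : ℕ) (c : F) : ℂ :=
  ∑ y with y ^ M = 1, ψ (c * y)

theorem cyclotomicPeriod_mul {F : Type} [Field F] [Fintype F] (ψ : AddChar F ℂ) {M : ℕ} (c : F)
    {h : F} (hh0 : h ≠ 0) (hh : h ^ M = 1) :
    cyclotomicPeriod ψ M (c * h) = cyclotomicPeriod ψ M c := by
  refine Finset.sum_equiv (Equiv.mulLeft₀ h hh0) (fun y => ?_) (fun y _ => ?_)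
  · simp [mul_pow, hh]
  · simp [mul_assoc]

theorem cyclotomicPeriod_pow {F : Type} [Field F] [Fintype F] {ψ : AddChar F ℂ} {p : ℕ}
    [Fact p.Prime] [CharP F p] (hψ : ∀ x, ψ (x ^ p) = ψ x) (M : ℕ) (c : F) :
    cyclotomicPeriod ψ M (c ^ p) = cyclotomicPeriod ψ M c := by
  refine (Finset.sum_equiv (frobeniusEquiv F p).toEquiv (fun y => ?_) (fun y _ => ?_)).symm
  · have h : (y ^ p) ^ M = 1 ↔ y ^ M = 1 := by
      rw [pow_right_comm]
      exact ⟨fun h => frobenius_inj F p (by simpa [frobenius_def] using h), fun h => by simp [h]⟩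
    simp [frobenius_def, h]
  · simp [frobenius_def, ← mul_pow, hψ]

theorem cyclotomicPeriod_modEq {F : Type} [Field F] [Fintype F] (ψ : AddChar F ℂ) {N M : ℕ}
    {γ : Fˣ} (hγ : γ ^ (N * M) = 1) {a b : ℕ} (h : a ≡ b [MOD N]) :
    cyclotomicPeriod ψ M ((γ : F) ^ a) = cyclotomicPeriod ψ M ((γ : F) ^ b) := by
  have hmod : ∀ n, cyclotomicPeriod ψ M ((γ : F) ^ n) =
      cyclotomicPeriod ψ M ((γ : F) ^ (n % N)) := fun n => by
    conv_lhs => rw [← Nat.mod_add_div n N, pow_add]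
    refine cyclotomicPeriod_mul ψ _ (pow_ne_zero _ γ.ne_zero) ?_
    rw [← pow_mul, mul_right_comm, pow_mul, ← Units.val_pow_eq_pow_val, hγ]
    simp
  rw [hmod a, hmod b, h]

/-- Under the index two hypothesis, a sum of `l ^ (m - 1)` consecutive periods changes only when
the window moves past a multiple of `l ^ (m - 1)`. -/
theorem sum_cyclotomicPeriod_succ {F : Type} [Field F] [Fintype F] {ψ : AddChar F ℂ}
    {l m p M : ℕ} [Fact p.Prime] [CharP F p] (hψ : ∀ x, ψ (x ^ p) = ψ x)
    (hl : l.Prime) (hodd : Odd l) (hm : 1 ≤ m)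
    (hcop : p.Coprime (l ^ m)) (hind : 2 * orderOf (p : ZMod (l ^ m)) = (l ^ m).totient)
    {γ : Fˣ} (hγ : γ ^ (l ^ m * M) = 1) {s : ℕ} (hs : ¬ l ^ (m - 1) ∣ s) :
    ∑ i ∈ Finset.range (l ^ (m - 1)), cyclotomicPeriod ψ M ((γ : F) ^ (s + 1 + i)) =
      ∑ i ∈ Finset.range (l ^ (m - 1)), cyclotomicPeriod ψ M ((γ : F) ^ (s + i)) := by
  refine sum_range_window_succ (g := fun n => cyclotomicPeriod ψ M ((γ : F) ^ n)) ?_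
  obtain ⟨e, he⟩ := exists_add_modEq_pow_mul hl hodd hm hcop hind hs
  rw [cyclotomicPeriod_modEq ψ hγ he]
  clear he
  induction e with
  | zero => simp
  | succ e ih => rw [pow_succ, mul_right_comm, pow_mul, cyclotomicPeriod_pow hψ, ih]

/-- The union of the cyclotomic classes of `γ ^ i` for `a ≤ i < a + K`, with respect to the group
of `M`-th roots of unity. -/
def cyclotomicBlock {F : Type} [Field F] [Fintype F] (γ : Fˣ) (M K a : ℕ) : Finset F :=
  (Finset.range K ×ˢ ({y | y ^ M = 1} : Finset F)).image fun w => (γ : F) ^ (a + w.1) * w.2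

theorem injOn_cyclotomicBlock {F : Type} [Field F] [Fintype F] {γ : Fˣ} {N M K : ℕ}
    (hγ : orderOf γ = N * M) (hM : 0 < M) (hKN : K ≤ N) (a : ℕ) :
    Set.InjOn (fun w : ℕ × F => (γ : F) ^ (a + w.1) * w.2)
      (Finset.range K ×ˢ ({y | y ^ M = 1} : Finset F) : Finset (ℕ × F)) := by
  rintro ⟨i, y⟩ hi ⟨j, z⟩ hj h
  simp only [Finset.coe_product, Set.mem_prod, Finset.mem_coe, Finset.mem_range,
    Finset.mem_filter, Finset.mem_univ, true_and] at hi hj h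
  have hγ0 : (γ : F) ≠ 0 := γ.ne_zero
  rw [pow_add, pow_add, mul_assoc, mul_assoc] at h
  have h1 := mul_left_cancel₀ (pow_ne_zero a hγ0) h
  have h2 : γ ^ (i * M) = γ ^ (j * M) := by
    have := congrArg (· ^ M) h1
    simp only [mul_pow, hi.2, hj.2, mul_one, ← pow_mul] at this
    exact Units.ext (by simpa using this)
  have h3 := pow_injOn_Iio_orderOf (x := γ)
    (by rw [Set.mem_Iio, hγ]; exact Nat.mul_lt_mul_of_pos_right (hi.1.trans_le hKN) hM)
    (by rw [Set.mem_Iio, hγ]; exact Nat.mul_lt_mul_of_pos_right (hj.1.trans_le hKN) hM) h2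
  obtain rfl := Nat.eq_of_mul_eq_mul_right hM h3
  rw [mul_left_cancel₀ (pow_ne_zero i hγ0) h1]

theorem sum_cyclotomicBlock {F : Type} [Field F] [Fintype F] (ψ : AddChar F ℂ) {γ : Fˣ}
    {N M K : ℕ} (hγ : orderOf γ = N * M) (hM : 0 < M) (hKN : K ≤ N) (a s : ℕ) :
    ∑ u ∈ cyclotomicBlock γ M K a, ψ ((γ : F) ^ s * u) =
      ∑ i ∈ Finset.range K, cyclotomicPeriod ψ M ((γ : F) ^ (s + a + i)) := by
  rw [cyclotomicBlock, Finset.sum_image (injOn_cyclotomicBlock hγ hM hKN a), Finset.sum_product]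
  refine Finset.sum_congr rfl fun i _ => Finset.sum_congr rfl fun y _ => ?_
  simp only [add_assoc, pow_add, mul_assoc]

theorem filter_pow_eq_one_eq_image {F : Type} [Field F] [Fintype F] {γ : Fˣ} {N M : ℕ}
    (hγ : orderOf γ = N * M) (hM : 0 < M) (hgen : ∀ x : Fˣ, ∃ n : ℕ, γ ^ n = x) :
    ({y | y ^ M = 1} : Finset F) = (Finset.range M).image fun t => (γ : F) ^ (N * t) := by
  have hone : ((γ : F) ^ (N * M)) = 1 := by
    rw [← Units.val_pow_eq_pow_val, ← hγ, pow_orderOf_eq_one, Units.val_one]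
  ext y
  simp only [Finset.mem_filter, Finset.mem_univ, true_and, Finset.mem_image, Finset.mem_range]
  constructor
  · intro hy
    obtain ⟨n, hn⟩ := hgen (Units.mk0 y (by rintro rfl; simp [hM.ne'] at hy))
    have hyn : y = (γ : F) ^ n := by
      rw [← Units.val_pow_eq_pow_val, hn, Units.val_mk0]
    have h1 : γ ^ (n * M) = 1 := Units.ext (by
      rw [Units.val_pow_eq_pow_val, pow_mul, ← hyn, hy, Units.val_one])
    obtain ⟨t, rfl⟩ := Nat.dvd_of_mul_dvd_mul_right hM (hγ ▸ orderOf_dvd_of_pow_eq_one h1)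
    refine ⟨t % M, Nat.mod_lt _ hM, ?_⟩
    rw [hyn]
    conv_rhs => rw [← Nat.mod_add_div t M, mul_add, ← mul_assoc, pow_add, pow_mul _ (N * M), hone]
    simp
  · rintro ⟨t, -, rfl⟩
    rw [← pow_mul, mul_right_comm, pow_mul, hone, one_pow]

theorem card_cyclotomicBlock {F : Type} [Field F] [Fintype F] {γ : Fˣ} {N M K : ℕ}
    (hγ : orderOf γ = N * M) (hM : 0 < M) (hN : 0 < N) (hKN : K ≤ N)
    (hgen : ∀ x : Fˣ, ∃ n : ℕ, γ ^ n = x) (a : ℕ) :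
    (cyclotomicBlock γ M K a).card = K * M := by
  rw [cyclotomicBlock, Finset.card_image_of_injOn (injOn_cyclotomicBlock hγ hM hKN a),
    Finset.card_product, Finset.card_range, filter_pow_eq_one_eq_image hγ hM hgen,
    Finset.card_image_of_injOn, Finset.card_range]
  intro t ht t' ht' h
  simp only [Finset.coe_range, Set.mem_Iio] at ht ht' h
  have h1 : γ ^ (N * t) = γ ^ (N * t') := Units.ext (by simpa using h)
  have h2 := pow_injOn_Iio_orderOf (x := γ)
    (by rw [Set.mem_Iio, hγ]; exact Nat.mul_lt_mul_of_pos_left ht hN)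
    (by rw [Set.mem_Iio, hγ]; exact Nat.mul_lt_mul_of_pos_left ht' hN) h1
  exact Nat.eq_of_mul_eq_mul_left hN h2

theorem mem_cyclotomicBlock {F : Type} [Field F] [Fintype F] {γ : Fˣ} {N M K : ℕ}
    (hγ : orderOf γ = N * M) (hM : 0 < M) (hgen : ∀ x : Fˣ, ∃ n : ℕ, γ ^ n = x) (a : ℕ) {x : F} :
    x ∈ cyclotomicBlock γ M K a ↔ ∃ i < K, ∃ t : ℕ, x = (γ : F) ^ (i + a + N * t) := by
  simp only [cyclotomicBlock, Finset.mem_image, Finset.mem_product, Finset.mem_range, Prod.exists]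
  constructor
  · rintro ⟨i, y, ⟨hi, hy⟩, rfl⟩
    rw [filter_pow_eq_one_eq_image hγ hM hgen] at hy
    obtain ⟨t, -, rfl⟩ := Finset.mem_image.1 hy
    exact ⟨i, hi, t, by rw [pow_add _ (i + a), add_comm i a]⟩
  · rintro ⟨i, hi, t, rfl⟩
    refine ⟨i, (γ : F) ^ (N * t), ⟨hi, ?_⟩, by rw [pow_add _ (i + a), add_comm i a]⟩
    have hone : (γ : F) ^ (N * M) = 1 := by
      rw [← Units.val_pow_eq_pow_val, ← hγ, pow_orderOf_eq_one, Units.val_one]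
    simp [← pow_mul, mul_right_comm N t M, pow_mul _ (N * M), hone]

/-- The power spectrum of the family of blocks of `l ^ (m - 1)` consecutive cyclotomic classes is
constant away from zero. -/
theorem sum_cyclotomicBlock_mul_sum_inv {F : Type} [Field F] [Fintype F] {ψ : AddChar F ℂ}
    {l m p M : ℕ} [Fact p.Prime] [CharP F p] (hψ : ∀ x, ψ (x ^ p) = ψ x)
    (hl : l.Prime) (hodd : Odd l) (hm : 1 ≤ m)
    (hcop : p.Coprime (l ^ m)) (hind : 2 * orderOf (p : ZMod (l ^ m)) = (l ^ m).totient)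
    {γ : Fˣ} (hγ : orderOf γ = l ^ m * M) (hM : 0 < M) (s : ℕ) :
    ∑ k ∈ Finset.range l,
        (∑ u ∈ cyclotomicBlock γ M (l ^ (m - 1)) (k * l ^ (m - 1)), ψ ((γ : F) ^ s * u)) *
        (∑ v ∈ cyclotomicBlock γ M (l ^ (m - 1)) (k * l ^ (m - 1)), ψ⁻¹ ((γ : F) ^ s * v)) =
      ∑ k ∈ Finset.range l,
        (∑ i ∈ Finset.range (l ^ (m - 1)),
          cyclotomicPeriod ψ M ((γ : F) ^ (k * l ^ (m - 1) + i))) *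
        (∑ i ∈ Finset.range (l ^ (m - 1)),
          cyclotomicPeriod ψ⁻¹ M ((γ : F) ^ (k * l ^ (m - 1) + i))) := by
  have hψ' : ∀ x, ψ⁻¹ (x ^ p) = ψ⁻¹ x := fun x => by
    rw [AddChar.inv_apply', AddChar.inv_apply', hψ]
  have hone : γ ^ (l ^ m * M) = 1 := hγ ▸ pow_orderOf_eq_one γ
  have hKN : l ^ (m - 1) ≤ l ^ m := Nat.pow_le_pow_right hl.pos (Nat.sub_le _ _)
  have hlK : l * l ^ (m - 1) = l ^ m := by rw [← pow_succ', Nat.sub_add_cancel hm]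
  simp_rw [sum_cyclotomicBlock _ hγ hM hKN]
  refine sum_range_step_eq (g := fun n =>
    (∑ i ∈ Finset.range (l ^ (m - 1)), cyclotomicPeriod ψ M ((γ : F) ^ (n + i))) *
    (∑ i ∈ Finset.range (l ^ (m - 1)), cyclotomicPeriod ψ⁻¹ M ((γ : F) ^ (n + i))))
    (pow_pos hl.pos _) (fun s hs => ?_) (fun s => ?_) s
  · rw [sum_cyclotomicPeriod_succ hψ hl hodd hm hcop hind hone hs,
      sum_cyclotomicPeriod_succ hψ' hl hodd hm hcop hind hone hs]
  · have hmod : ∀ i, s + l * l ^ (m - 1) + i ≡ s + i [MOD l ^ m] := fun i => by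
      rw [hlK, add_right_comm]
      exact Nat.add_modEq_right
    exact congrArg₂ _ (Finset.sum_congr rfl fun i _ => cyclotomicPeriod_modEq ψ hone (hmod i))
      (Finset.sum_congr rfl fun i _ => cyclotomicPeriod_modEq ψ⁻¹ hone (hmod i))

theorem natCard_triples_eq_sum {F : Type} [Field F] [Fintype F] (P : ℕ) (A : ℕ → Finset F)
    (x : F) :
    Nat.card {w : ℕ × F × F //
        w.1 < P ∧ w.2.1 ∈ A w.1 ∧ w.2.2 ∈ A w.1 ∧ w.2.1 - w.2.2 = x} =
      ∑ k ∈ Finset.range P, {w ∈ A k ×ˢ A k | w.1 - w.2 = x}.card := by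
  rw [← Finset.card_sigma, ← Nat.card_eq_finsetCard]
  exact Nat.card_congr
    { toFun := fun w => ⟨⟨w.1.1, w.1.2⟩, by
        simpa [and_assoc] using w.2⟩
      invFun := fun w => ⟨(w.1.1, w.1.2), by
        have hw := w.2
        simp only [Finset.mem_sigma, Finset.mem_filter, Finset.mem_product, Finset.mem_range,
          and_assoc] at hw
        exact hw⟩
      left_inv := fun _ => rfl
      right_inv := fun _ => rfl }

/-- For `N = p1^m`: for every nonzero `x ∈ F_q`, the number of triples `(k, u, v)` with
`0 ≤ k ≤ p1 - 1`, `u, v ∈ D_k` and `u - v = x` equals `(q-1)/p1 - 1`;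
this is the pseudocyclicity of the fusion scheme. -/
theorem pseudocyclic_prime_power
    (p1 m N p f q : ℕ)
    (hp1 : p1.Prime) (hp1_gt : 3 < p1) (hp1_mod : p1 % 4 = 3)
    (hm : 1 ≤ m) (hN : N = p1 ^ m)
    (hp : p.Prime) (hcop : Nat.Coprime p N)
    (hf : f = orderOf (p : ZMod N)) (hf2 : 2 * f = N.totient)
    (hq : q = p ^ f)
    (F : Type) [Field F] [Fintype F]
    (hF : Fintype.card F = q)
    (γ : Fˣ) (hγ : orderOf γ = q - 1)
    (D : ℕ → Set F)
    (hD : ∀ k, D k = {x : F | ∃ i < p1 ^ (m - 1), ∃ t : ℕ,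
        x = ((γ : F)) ^ (i + k * p1 ^ (m - 1) + N * t)}) :
    ∀ x : F, x ≠ 0 →
      Nat.card {w : ℕ × F × F //
          w.1 < p1 ∧ w.2.1 ∈ D w.1 ∧ w.2.2 ∈ D w.1 ∧ w.2.1 - w.2.2 = x} =
        (q - 1) / p1 - 1 := by
  subst hN hf
  have : Fact p.Prime := ⟨hp⟩
  have hchar : CharP F p := charP_of_card_eq_prime_pow (hF.trans hq)
  have hq1 : 1 < q := hF ▸ Fintype.one_lt_card
  obtain ⟨M, hqM⟩ : p1 ^ m ∣ q - 1 := by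
    rw [← ZMod.natCast_eq_zero_iff, Nat.cast_sub hq1.le, hq]
    push_cast
    rw [pow_orderOf_eq_one, sub_self]
  have hM : 0 < M := Nat.pos_of_ne_zero fun h => by simp [h] at hqM; omega
  have hγM := hγ.trans hqM
  have hodd : Odd p1 := Nat.odd_iff.2 (by omega)
  have hgen : ∀ x : Fˣ, ∃ n : ℕ, γ ^ n = x := fun x => by
    have htop : Subgroup.zpowers γ = ⊤ := by
      refine Subgroup.eq_top_of_card_eq _ ?_
      rw [Nat.card_zpowers, hγ, Nat.card_units, Nat.card_eq_fintype_card, hF]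
    exact (mem_powers_iff_mem_zpowers.2 (htop ▸ Subgroup.mem_top x))
  set K := p1 ^ (m - 1) with hK
  have hNK : p1 ^ m = p1 * K := by rw [hK, ← pow_succ', Nat.sub_add_cancel hm]
  have hKN : K ≤ p1 ^ m := Nat.pow_le_pow_right hp1.pos (Nat.sub_le _ _)
  set A : ℕ → Finset F := fun k => cyclotomicBlock γ M K (k * K) with hA
  have hcardA : ∀ k, (A k).card = K * M := fun k =>
    card_cyclotomicBlock hγM hM (pow_pos hp1.pos m) hKN hgen _
  have hDA : ∀ k, D k = A k := fun k => by
    ext y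
    rw [hD, Finset.mem_coe, mem_cyclotomicBlock hγM hM hgen]
    rfl
  obtain ⟨ψ, hprim, hψ⟩ := exists_isPrimitive_frobenius_invariant F p
  have hconst := fun (x : F) (hx : x ≠ 0) =>
    card_mul_sum_card_sub_eq hprim (Finset.range p1) A _ (fun a ha => by
      obtain ⟨s, hs⟩ := hgen (Units.mk0 a ha)
      have has : a = (γ : F) ^ s := by rw [← Units.val_pow_eq_pow_val, hs, Units.val_mk0]
      rw [has]
      exact sum_cyclotomicBlock_mul_sum_inv hψ hp1 hodd hm hcop hf2 hγM hM s) hx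
  intro x hx
  simp_rw [hDA, Finset.mem_coe]
  rw [natCard_triples_eq_sum]
  have hcount := card_sub_one_mul_eq (Finset.range p1) A
    (∑ k ∈ Finset.range p1, {w ∈ A k ×ˢ A k | w.1 - w.2 = x}.card) fun y hy => by
      have h := (hconst y hy).trans (hconst x hx).symm
      have h0 : (Fintype.card F : ℂ) ≠ 0 := Nat.cast_ne_zero.2 Fintype.card_ne_zero
      exact_mod_cast mul_left_cancel₀ h0 h
  have hKM : 0 < K * M := Nat.mul_pos (pow_pos hp1.pos _) hM
  have hq' : q - 1 = p1 * (K * M) := by rw [hqM, hNK, mul_assoc]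
  simp only [hcardA, Finset.sum_const, Finset.card_range, smul_eq_mul, hF] at hcount
  rw [hq', Nat.mul_div_cancel_left _ hp1.pos]
  rw [hq'] at hcount
  generalize ∑ k ∈ Finset.range p1, {w ∈ A k ×ˢ A k | w.1 - w.2 = x}.card = n at hcount ⊢
  have h := Nat.eq_of_mul_eq_mul_left (Nat.mul_pos hp1.pos hKM)
    (show p1 * (K * M) * (1 + n) = p1 * (K * M) * (K * M) by rw [mul_add, mul_one, hcount]; ring)
  omega
end
end
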